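/- arXiv:2303.14902 — 5 statements merged into one kernel-verified Lean document; each statement's English description precedes it below -/
import Mathlib

section
/- Let K be an algebraically closed field of characteristic 2, let V be an n-dimensional K-vector space with n ≥ 1, and let u be a unipotent endomorphism of V with a single Jordan block of size n, i.e. (u − 1)^{n−1} ≠ 0 and (u − 1)^{n} = 0. Let Λ²u denote the induced map on the exterior square Λ²(V), determined by (Λ²u)(x ∧ y) = (ux) ∧ (uy). Then dim ker(Λ²u − 1) = ⌊n/2⌋; equivalently, the number of Jordan blocks of Λ²u on Λ²(V) is ⌊n/2⌋. -/
open scoped TensorProduct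

/-- The exterior square `Λ²(V)`: the quotient of `V ⊗ V` by the span of all `x ⊗ x`. -/
noncomputable abbrev ExtSq (K V : Type*) [Field K] [AddCommGroup V] [Module K V] : Type _ :=
  TensorProduct K V V ⧸
    Submodule.span K {z : TensorProduct K V V | ∃ x : V, z = x ⊗ₜ[K] x}

/-- The wedge product `x ∧ y` in the exterior square, i.e. the image of `x ⊗ y`. -/
noncomputable def ExtSq.wedge {K V : Type*} [Field K] [AddCommGroup V] [Module K V]
    (x y : V) : ExtSq K V :=
  Submodule.Quotient.mk (x ⊗ₜ[K] y)

open Polynomial in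
theorem aux_adjoin {K A : Type*} [Field K] [CommRing A] [Algebra K A] (x : A) (m : ℕ)
    (h1 : x ^ m = 0) (h2 : ∀ k < m, x ^ k ≠ 0) :
    Module.finrank K (Algebra.adjoin K {x}) = m := by
  have hint : IsIntegral K x := ⟨X ^ m, monic_X_pow m, by simp [h1]⟩
  rw [(Algebra.adjoin.powerBasis hint).finrank, Algebra.adjoin.powerBasis_dim]
  have hd : minpoly K x ∣ X ^ m := minpoly.dvd _ _ (by simp [h1])
  obtain ⟨k, hk, hkk⟩ := (dvd_prime_pow prime_X m).1 hd
  have heq : minpoly K x = X ^ k :=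
    eq_of_monic_of_associated (minpoly.monic hint) (monic_X_pow k) hkk
  have h0 := minpoly.aeval K x
  rw [heq] at h0 ⊢
  simp only [map_pow, aeval_X] at h0
  rw [natDegree_X_pow]
  by_contra hne
  exact h2 k (lt_of_le_of_ne hk hne) h0

set_option maxHeartbeats 2000000 in
/-- core: abstract situation -/
theorem aux_core {K V A : Type*} [Field K] [CharP K 2] [AddCommGroup V] [Module K V]
    [FiniteDimensional K V] [CommRing A] [Algebra K A] [FiniteDimensional K A]
    (q q' : A) (hq : q * q' = 1) (hgen : Algebra.adjoin K {q} = ⊤)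
    (st : A →ₐ[K] A) (hst : st q = q') (hst' : st q' = q)
    (e : A ≃ₗ[K] V) (u : Module.End K V) (he : ∀ a, e (q * a) = u (e a))
    (w : Module.End K (ExtSq K V))
    (hw : ∀ x y : V, w (ExtSq.wedge x y) = ExtSq.wedge (u x) (u y)) :
    Module.finrank K ↥(LinearMap.ker (w - 1)) +
      Module.finrank K (Algebra.adjoin K {q + q'}) = Module.finrank K A := by
  have hA2 : ∀ a : A, a + a = 0 := fun a => by
    have : (2 : K) = 0 := CharTwo.two_eq_zero
    rw [← two_smul K a, this, zero_smul]
  set S := Algebra.adjoin K {q + q'} with hS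
  have hs : q + q' ∈ S := Algebra.subset_adjoin rfl
  -- induction principle
  have hind : ∀ P : Submodule K A, 1 ∈ P → (∀ a ∈ P, q * a ∈ P) → ∀ a, a ∈ P := by
    intro P h1 hm a
    have ha : a ∈ Algebra.adjoin K {q} := by rw [hgen]; trivial
    rw [Algebra.adjoin_singleton_eq_range_aeval] at ha
    obtain ⟨p, rfl⟩ := ha
    have hpow : ∀ k : ℕ, q ^ k ∈ P := by
      intro k
      induction k with
      | zero => simpa using h1
      | succ k ih => rw [pow_succ']; exact hm _ ih
    change Polynomial.aeval q p ∈ P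
    rw [Polynomial.aeval_eq_sum_range]
    exact P.sum_mem fun i _ => P.smul_mem _ (hpow i)
  have hstS : ∀ a ∈ S, st a = a := by
    intro a ha
    have : S ≤ AlgHom.equalizer st (AlgHom.id K A) := by
      rw [hS, Algebra.adjoin_le_iff]
      rintro _ rfl
      simp [hst, hst', add_comm]
    exact this ha
  have hdecomp : ∀ c : A, ∃ α ∈ S, ∃ β ∈ S, c = α + β * q := by
    let P : Submodule K A :=
      { carrier := {c | ∃ α ∈ S, ∃ β ∈ S, c = α + β * q}
        zero_mem' := ⟨0, S.zero_mem, 0, S.zero_mem, by simp⟩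
        add_mem' := by
          rintro _ _ ⟨α, hα, β, hβ, rfl⟩ ⟨α', hα', β', hβ', rfl⟩
          exact ⟨_, S.add_mem hα hα', _, S.add_mem hβ hβ', by ring⟩
        smul_mem' := by
          rintro k _ ⟨α, hα, β, hβ, rfl⟩
          exact ⟨_, S.smul_mem hα k, _, S.smul_mem hβ k, by simp [smul_add]⟩ }
    refine hind P ⟨1, S.one_mem, 0, S.zero_mem, by simp⟩ ?_
    rintro _ ⟨α, hα, β, hβ, rfl⟩
    refine ⟨β, hβ, α + β * (q + q'), S.add_mem hα (S.mul_mem hβ hs), ?_⟩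
    linear_combination (-β) * hq - hA2 β
  have hnorm : ∀ c : A, st c * c ∈ S := by
    intro c
    obtain ⟨α, hα, β, hβ, rfl⟩ := hdecomp c
    have : st (α + β * q) * (α + β * q) = α * α + β * β + α * β * (q + q') := by
      rw [map_add, map_mul, hst, hstS α hα, hstS β hβ]
      linear_combination (β * β) * hq
    rw [this]
    exact S.add_mem (S.add_mem (S.mul_mem hα hα) (S.mul_mem hβ hβ))
      (S.mul_mem (S.mul_mem hα hβ) hs)
  -- the map φ
  let S' : Submodule K A := Subalgebra.toSubmodule S
  let B : V →ₗ[K] V →ₗ[K] (A ⧸ S') :=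
    ((LinearMap.mul K A).compl₁₂ (st.toLinearMap ∘ₗ e.symm.toLinearMap)
      e.symm.toLinearMap).compr₂ S'.mkQ
  have hB : ∀ x y, B x y = S'.mkQ (st (e.symm x) * e.symm y) := fun x y => rfl
  let φ : ExtSq K V →ₗ[K] (A ⧸ S') := Submodule.liftQ _ (TensorProduct.lift B) (by
    rw [Submodule.span_le]
    rintro _ ⟨x, rfl⟩
    simp only [SetLike.mem_coe, LinearMap.mem_ker, TensorProduct.lift.tmul, hB]
    rw [Submodule.mkQ_apply, Submodule.Quotient.mk_eq_zero]
    exact hnorm _)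
  have hφ : ∀ x y, φ (ExtSq.wedge x y) = S'.mkQ (st (e.symm x) * e.symm y) := fun x y => by
    simp [φ, ExtSq.wedge, hB]
  have heu : ∀ x, e.symm (u x) = q * e.symm x := by
    intro x
    rw [LinearEquiv.symm_apply_eq, he, LinearEquiv.apply_symm_apply]
  have hle1 : LinearMap.range (w - 1) ≤ LinearMap.ker φ := by
    rw [LinearMap.range_le_ker_iff]
    apply Submodule.linearMap_qext
    apply TensorProduct.ext'
    intro x y
    change φ ((w - 1) (ExtSq.wedge x y)) = 0
    rw [LinearMap.sub_apply, hw, Module.End.one_apply, map_sub, hφ, hφ, heu, heu, map_mul st, hst,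
      ← map_sub]
    have : q' * st (e.symm x) * (q * e.symm y) - st (e.symm x) * e.symm y = 0 := by
      linear_combination (st (e.symm x) * e.symm y) * hq
    rw [this, map_zero]
  -- inverse direction
  let R := LinearMap.range (w - 1)
  let W : V →ₗ[K] V →ₗ[K] (ExtSq K V ⧸ R) :=
    (TensorProduct.mk K V V).compr₂ (R.mkQ ∘ₗ Submodule.mkQ _)
  have hW : ∀ x y, W x y = R.mkQ (ExtSq.wedge x y) := fun x y => rfl
  have hWself : ∀ x, W x x = 0 := fun x => by
    have : (ExtSq.wedge x x : ExtSq K V) = 0 := by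
      rw [ExtSq.wedge, Submodule.Quotient.mk_eq_zero]
      exact Submodule.subset_span ⟨x, rfl⟩
    rw [hW, this, map_zero]
  have hWu : ∀ x y, W (u x) (u y) = W x y := fun x y => by
    rw [hW, hW, ← sub_eq_zero, ← map_sub, Submodule.mkQ_apply, Submodule.Quotient.mk_eq_zero]
    exact ⟨ExtSq.wedge x y, by simp [hw]⟩
  have hWswap : ∀ x y, W x y + W y x = 0 := fun x y => by
    have := hWself (x + y)
    rw [map_add, map_add W, LinearMap.add_apply, LinearMap.add_apply, hWself, hWself, zero_add,
      add_zero, add_comm] at this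
    exact this
  let ψ : A →ₗ[K] (ExtSq K V ⧸ R) := W (e 1) ∘ₗ e.toLinearMap
  have hψ : ∀ a b, ψ (st a * b) = W (e a) (e b) := by
    let P : Submodule K A :=
      { carrier := {a | ∀ b, ψ (st a * b) = W (e a) (e b)}
        zero_mem' := by intro b; simp
        add_mem' := by
          intro a a' h h' b
          simp only [Set.mem_ofPred_eq] at h h'
          rw [map_add, add_mul, map_add, h, h', map_add, map_add, LinearMap.add_apply]
        smul_mem' := by
          intro k a h b
          simp only [Set.mem_ofPred_eq] at h
          rw [map_smul, smul_mul_assoc, map_smul, h, map_smul, map_smul, LinearMap.smul_apply] }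
    refine hind P ?_ ?_
    · intro b
      simp [ψ]
    · intro a ha b
      have hb : b = q * (q' * b) := by rw [← mul_assoc, hq, one_mul]
      conv_rhs => rw [hb, he, he, hWu]
      rw [← ha (q' * b), map_mul st, hst]
      congr 1
      ring
  have hψS : S' ≤ LinearMap.ker ψ := by
    intro a ha
    change a ∈ Algebra.adjoin K {q + q'} at ha
    rw [Algebra.adjoin_singleton_eq_range_aeval] at ha
    obtain ⟨p, rfl⟩ := ha
    change Polynomial.aeval (q + q') p ∈ _
    rw [Polynomial.aeval_eq_sum_range]
    refine Submodule.sum_mem _ fun i _ => Submodule.smul_mem _ _ ?_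
    rw [LinearMap.mem_ker]
    have hsj : ∀ j : ℕ, st ((q + q') ^ j) = (q + q') ^ j := fun j => hstS _ (S.pow_mem hs j)
    obtain ⟨j, rfl | rfl⟩ := Nat.even_or_odd' i
    · have : (q + q') ^ (2 * j) = st ((q + q') ^ j) * (q + q') ^ j := by rw [hsj]; ring
      rw [this, hψ, hWself]
    · have : (q + q') ^ (2 * j + 1) = st ((q + q') ^ j) * (q * (q + q') ^ j)
          + st (q * (q + q') ^ j) * (q + q') ^ j := by rw [map_mul, hsj, hst]; ring
      rw [this, map_add, hψ, hψ, hWswap]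
  let Ψ : (A ⧸ S') →ₗ[K] (ExtSq K V ⧸ R) := S'.liftQ ψ hψS
  have hcomp : R.mkQ = Ψ ∘ₗ φ := by
    apply Submodule.linearMap_qext
    apply TensorProduct.ext'
    intro x y
    change R.mkQ (ExtSq.wedge x y) = Ψ (φ (ExtSq.wedge x y))
    rw [hφ, Submodule.mkQ_apply S', Submodule.liftQ_apply, hψ]
    simp [hW]
  have hle2 : LinearMap.ker φ ≤ LinearMap.range (w - 1) := by
    intro z hz
    have h : R.mkQ z = 0 := by
      rw [hcomp, LinearMap.comp_apply, LinearMap.mem_ker.1 hz, map_zero]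
    rwa [Submodule.mkQ_apply, Submodule.Quotient.mk_eq_zero] at h
  have hker : LinearMap.range (w - 1) = LinearMap.ker φ := le_antisymm hle1 hle2
  have hsurj : LinearMap.range φ = ⊤ := by
    rw [LinearMap.range_eq_top]
    intro z
    obtain ⟨a, rfl⟩ := S'.mkQ_surjective z
    exact ⟨ExtSq.wedge (e 1) (e a), by simp [hφ]⟩
  have e1 := LinearMap.finrank_range_add_finrank_ker (w - 1)
  have e2 := LinearMap.finrank_range_add_finrank_ker φ
  have e3 := Submodule.finrank_quotient_add_finrank S'
  rw [hsurj, finrank_top] at e2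
  rw [hker] at e1
  change _ + Module.finrank K S = _ at e3
  omega

set_option maxHeartbeats 2000000 in
theorem stmt0 (K : Type*) [Field K] [IsAlgClosed K] [CharP K 2]
    (V : Type*) [AddCommGroup V] [Module K V] [FiniteDimensional K V]
    (n : ℕ) (hn : 1 ≤ n) (hdim : Module.finrank K V = n)
    (u : Module.End K V)
    (hu1 : (u - 1) ^ (n - 1) ≠ 0) (hu2 : (u - 1) ^ n = 0)
    (w : Module.End K (ExtSq K V))
    (hw : ∀ x y : V, w (ExtSq.wedge x y) = ExtSq.wedge (u x) (u y)) :
    Module.finrank K ↥(LinearMap.ker (w - 1)) = n / 2 := by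
  classical
  obtain ⟨v, hv⟩ : ∃ v, ((u - 1) ^ (n - 1)) v ≠ 0 := by
    by_contra! h
    exact hu1 (LinearMap.ext h)
  let I : Ideal (Polynomial K) := Ideal.span {Polynomial.X ^ n}
  let A := Polynomial K ⧸ I
  let t : A := Ideal.Quotient.mk I Polynomial.X
  have hmk : ∀ p : Polynomial K, Ideal.Quotient.mk I p = Polynomial.aeval t p := by
    intro p
    have : (Ideal.Quotient.mkₐ K I) = Polynomial.aeval t := by
      apply Polynomial.algHom_ext
      simp [t]
    exact DFunLike.congr_fun this p
  have htk : ∀ k, t ^ k = 0 ↔ n ≤ k := by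
    intro k
    rw [← map_pow, Ideal.Quotient.eq_zero_iff_mem, Ideal.mem_span_singleton,
      pow_dvd_pow_iff Polynomial.X_ne_zero Polynomial.not_isUnit_X]
  have hfin : Module.finrank K A = n := by
    rw [finrank_quotient_span_eq_natDegree, Polynomial.natDegree_X_pow]
  have : FiniteDimensional K A := FiniteDimensional.of_finrank_pos (by omega)
  have hA2 : ∀ a : A, a + a = 0 := fun a => by
    have : (2 : K) = 0 := CharTwo.two_eq_zero
    rw [← two_smul K a, this, zero_smul]
  have hnil : IsNilpotent t := ⟨n, (htk n).2 le_rfl⟩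
  obtain ⟨q', hq⟩ : ∃ q', (1 + t) * q' = 1 := (hnil.isUnit_one_add).exists_right_inv
  let st : A →ₐ[K] A := Ideal.Quotient.liftₐ I (Polynomial.aeval (t * q')) (by
    intro a ha
    obtain ⟨b, rfl⟩ := Ideal.mem_span_singleton.1 ha
    simp [mul_pow, (htk n).2 le_rfl])
  have hstt : st t = t * q' := by
    have h : st t = Polynomial.aeval (t * q') (Polynomial.X : Polynomial K) := rfl
    rw [h, Polynomial.aeval_X]
  have hst : st (1 + t) = q' := by
    rw [map_add, map_one, hstt]
    linear_combination hA2 (t * q') - hq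
  have hst' : st q' = 1 + t := by
    have h := congrArg st hq
    rw [map_mul, hst, map_one] at h
    linear_combination (1 + t) * h - st q' * hq
  have hgen : Algebra.adjoin K {1 + t} = ⊤ := by
    rw [eq_top_iff]
    intro a _
    obtain ⟨p, rfl⟩ := Ideal.Quotient.mk_surjective a
    rw [hmk]
    have ht : t ∈ Algebra.adjoin K {1 + t} := by
      have h := Subalgebra.sub_mem _ (Algebra.subset_adjoin (R := K) (Set.mem_singleton (1 + t)))
        (Subalgebra.one_mem _)
      simpa using h
    rw [Polynomial.aeval_eq_sum_range]
    exact Subalgebra.sum_mem _ fun i _ => Subalgebra.smul_mem _ (Subalgebra.pow_mem _ ht i) _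
  have hs : ∀ k, (1 + t + q') ^ k = 0 ↔ n ≤ 2 * k := by
    intro k
    have h : 1 + t + q' = t ^ 2 * q' := by
      linear_combination (t - 1) * (-hq) + hA2 1
    rw [h, mul_pow, ← pow_mul, ← htk]
    constructor
    · intro h0
      have h1 : ((1 + t) * q') ^ k = 1 := by rw [hq, one_pow]
      rw [mul_pow] at h1
      linear_combination (1 + t) ^ k * h0 - t ^ (2 * k) * h1
    · intro h0
      rw [h0, zero_mul]
  have hS : Module.finrank K (Algebra.adjoin K {1 + t + q'}) = (n + 1) / 2 :=
    aux_adjoin _ _ ((hs _).2 (by omega)) (fun k hk h => by have := (hs k).1 h; omega)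
  let T : A →ₐ[K] Module.End K V := Ideal.Quotient.liftₐ I (Polynomial.aeval (u - 1)) (by
    intro a ha
    obtain ⟨b, rfl⟩ := Ideal.mem_span_singleton.1 ha
    simp [hu2])
  have hT : ∀ p, T (Ideal.Quotient.mk I p) = Polynomial.aeval (u - 1) p := fun p => rfl
  let e0 : A →ₗ[K] V := (LinearMap.applyₗ v) ∘ₗ T.toLinearMap
  have he0 : ∀ a, e0 a = T a v := fun a => rfl
  have hinj : Function.Injective e0 := by
    rw [injective_iff_map_eq_zero]
    intro a ha
    obtain ⟨p, rfl⟩ := Ideal.Quotient.mk_surjective a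
    rw [he0, hT] at ha
    obtain ⟨k, hk, hkk⟩ := (dvd_prime_pow Polynomial.prime_X n).1
      (EuclideanDomain.gcd_dvd_right p (Polynomial.X ^ n))
    have hg : Polynomial.aeval (u - 1) (EuclideanDomain.gcd p (Polynomial.X ^ n)) v = 0 := by
      rw [EuclideanDomain.gcd_eq_gcd_ab, mul_comm p, map_add, map_mul, map_mul]
      simp [ha, hu2]
    by_cases hkn : k = n
    · subst hkn
      rw [Ideal.Quotient.eq_zero_iff_mem, Ideal.mem_span_singleton]
      exact hkk.symm.dvd.trans (EuclideanDomain.gcd_dvd_left _ _)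
    · exfalso
      have hd : EuclideanDomain.gcd p (Polynomial.X ^ n) ∣ Polynomial.X ^ (n - 1) :=
        hkk.dvd.trans (pow_dvd_pow _ (by omega))
      obtain ⟨c, hc⟩ := hd
      apply hv
      have h2 : (u - 1) ^ (n - 1)
          = Polynomial.aeval (u - 1) (Polynomial.X ^ (n - 1) : Polynomial K) := by simp
      rw [h2, hc, mul_comm, map_mul, Module.End.mul_apply, hg, map_zero]
  let e : A ≃ₗ[K] V := LinearEquiv.ofInjectiveOfFinrankEq e0 hinj (by rw [hfin, hdim])
  have he : ∀ a, e ((1 + t) * a) = u (e a) := by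
    intro a
    change T ((1 + t) * a) v = u (T a v)
    rw [map_mul, map_add, map_one, hT]
    simp
  have hmain := aux_core (1 + t) q' hq hgen st hst hst' e u he w hw
  rw [hS, hfin] at hmain
  omega
end

section
/- Let K be an algebraically closed field of characteristic 2, let ℓ ≥ 1 be an integer and set α = ν₂(ℓ). Let V be a 2ℓ-dimensional K-vector space and u a unipotent endomorphism of V with a single Jordan block of size 2ℓ, and let ũ be the induced map on S²(V). Then the smallest Jordan block size of ũ on S²(V) is 2^α, and it occurs with multiplicity one; that is, for every 1 ≤ d < 2^α the multiplicity of Jordan blocks of size d of ũ is 0, and the multiplicity of Jordan blocks of size 2^α of ũ is 1. -/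
open scoped TensorProduct

/-- The symmetric square `S²(V)`: the quotient of `V ⊗ V` by the span of all
`x ⊗ y - y ⊗ x`. -/
noncomputable abbrev SymSq (K V : Type*) [Field K] [AddCommGroup V] [Module K V] : Type _ :=
  TensorProduct K V V ⧸
    Submodule.span K {z : TensorProduct K V V | ∃ x y : V, z = x ⊗ₜ[K] y - y ⊗ₜ[K] x}

/-- The product `xy` in the symmetric square, i.e. the image of `x ⊗ y`. -/
noncomputable def SymSq.mul {K V : Type*} [Field K] [AddCommGroup V] [Module K V]
    (x y : V) : SymSq K V :=
  Submodule.Quotient.mk (x ⊗ₜ[K] y)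

/-- For a (nilpotent) endomorphism `N` of a finite-dimensional space, the multiplicity of
Jordan blocks of size `d ≥ 1` is `rank N^(d-1) - 2 * rank N^d + rank N^(d+1)`. -/
noncomputable def blockMult {K M : Type*} [Field K] [AddCommGroup M] [Module K M]
    (N : Module.End K M) (d : ℕ) : ℤ :=
  (Module.finrank K ↥(LinearMap.range (N ^ (d - 1))) : ℤ)
    - 2 * (Module.finrank K ↥(LinearMap.range (N ^ d)) : ℤ)
    + (Module.finrank K ↥(LinearMap.range (N ^ (d + 1))) : ℤ)


section Ranks
variable {K : Type*} [Field K]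

lemma aux_conj {M M' : Type*} [AddCommGroup M] [Module K M] [AddCommGroup M'] [Module K M']
    (e : M ≃ₗ[K] M') (N : Module.End K M) (N' : Module.End K M')
    (h : ∀ x, e (N x) = N' (e x)) (d : ℕ) :
    Module.finrank K ↥(LinearMap.range (N ^ d)) = Module.finrank K ↥(LinearMap.range (N' ^ d)) := by
  have hp : ∀ d x, e ((N ^ d) x) = (N' ^ d) (e x) := by
    intro d
    induction d with
    | zero => intro x; simp
    | succ d ih => intro x; rw [pow_succ, pow_succ, Module.End.mul_apply, Module.End.mul_apply, ih, h]
  have : Submodule.map (e : M →ₗ[K] M') (LinearMap.range (N ^ d)) = LinearMap.range (N' ^ d) := by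
    ext y
    constructor
    · rintro ⟨_, ⟨x, rfl⟩, rfl⟩
      exact ⟨e x, (hp d x).symm⟩
    · rintro ⟨x, rfl⟩
      refine ⟨_, ⟨e.symm x, rfl⟩, ?_⟩
      simp [hp]
  rw [← LinearEquiv.finrank_map_eq e, this]

lemma blockMult_conj {M M' : Type*} [AddCommGroup M] [Module K M] [AddCommGroup M'] [Module K M']
    (e : M ≃ₗ[K] M') (N : Module.End K M) (N' : Module.End K M')
    (h : ∀ x, e (N x) = N' (e x)) (d : ℕ) : blockMult N d = blockMult N' d := by
  unfold blockMult
  rw [aux_conj e N N' h, aux_conj e N N' h, aux_conj e N N' h]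

lemma finrank_range_prodMap {M M' : Type*} [AddCommGroup M] [Module K M] [AddCommGroup M']
    [Module K M'] [FiniteDimensional K M] [FiniteDimensional K M']
    (f : Module.End K M) (g : Module.End K M') :
    Module.finrank K ↥(LinearMap.range (LinearMap.prodMap f g)) =
      Module.finrank K ↥(LinearMap.range f) + Module.finrank K ↥(LinearMap.range g) := by
  rw [LinearMap.range_prodMap, ← Module.finrank_prod]
  exact LinearEquiv.finrank_eq 
    { toFun := fun x => (⟨x.1.1, x.2.1⟩, ⟨x.1.2, x.2.2⟩)
      invFun := fun x => ⟨(x.1.1, x.2.1), x.1.2, x.2.2⟩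
      map_add' := fun _ _ => rfl
      map_smul' := fun _ _ => rfl
      left_inv := fun _ => rfl
      right_inv := fun _ => rfl }

lemma prodMap_pow' {M M' : Type*} [AddCommGroup M] [Module K M] [AddCommGroup M']
    [Module K M'] (f : Module.End K M) (g : Module.End K M') (d : ℕ) :
    (LinearMap.prodMap f g : Module.End K (M × M')) ^ d = LinearMap.prodMap (f ^ d) (g ^ d) := by
  induction d with
  | zero => ext <;> simp
  | succ d ih => rw [pow_succ, ih, LinearMap.prodMap_mul, ← pow_succ, ← pow_succ]

lemma blockMult_prodMap {M M' : Type*} [AddCommGroup M] [Module K M] [AddCommGroup M']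
    [Module K M'] [FiniteDimensional K M] [FiniteDimensional K M']
    (f : Module.End K M) (g : Module.End K M') (d : ℕ) :
    blockMult (LinearMap.prodMap f g : Module.End K (M × M')) d = blockMult f d + blockMult g d := by
  unfold blockMult
  rw [prodMap_pow', prodMap_pow', prodMap_pow', finrank_range_prodMap, finrank_range_prodMap,
    finrank_range_prodMap]
  push_cast
  ring

/-- companion -/
def comp' {M : Type*} [AddCommGroup M] [Module K M] (f : Module.End K M) :
    Module.End K (M × M) :=
  LinearMap.prod (f ∘ₗ LinearMap.snd K M M) (LinearMap.fst K M M)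

lemma comp'_apply {M : Type*} [AddCommGroup M] [Module K M] (f : Module.End K M) (x : M × M) :
    comp' f x = (f x.2, x.1) := rfl

lemma comp'_sq {M : Type*} [AddCommGroup M] [Module K M] (f : Module.End K M) :
    comp' f ^ 2 = LinearMap.prodMap f f := by
  rw [pow_two]; ext <;> simp [comp'_apply]

lemma comp'_even {M : Type*} [AddCommGroup M] [Module K M] [FiniteDimensional K M]
    (f : Module.End K M) (d : ℕ) :
    Module.finrank K ↥(LinearMap.range (comp' f ^ (2 * d))) =
      2 * Module.finrank K ↥(LinearMap.range (f ^ d)) := by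
  rw [pow_mul, comp'_sq, prodMap_pow', finrank_range_prodMap, two_mul]

lemma comp'_odd {M : Type*} [AddCommGroup M] [Module K M] [FiniteDimensional K M]
    (f : Module.End K M) (d : ℕ) :
    Module.finrank K ↥(LinearMap.range (comp' f ^ (2 * d + 1))) =
      Module.finrank K ↥(LinearMap.range (f ^ (d + 1))) +
      Module.finrank K ↥(LinearMap.range (f ^ d)) := by
  have : LinearMap.range (comp' f ^ (2 * d + 1)) =
      LinearMap.range (LinearMap.prodMap (f ^ (d + 1)) (f ^ d)) := by
    rw [pow_succ, pow_mul, comp'_sq, prodMap_pow']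
    ext ⟨a, b⟩
    constructor
    · rintro ⟨⟨x, y⟩, h⟩
      refine ⟨(y, x), ?_⟩
      rw [← h]
      simp [comp'_apply, pow_succ]
    · rintro ⟨⟨x, y⟩, h⟩
      refine ⟨(y, x), ?_⟩
      rw [← h]
      simp [comp'_apply, pow_succ]
  rw [this, finrank_range_prodMap]

lemma two_zero [CharP K 2] {M : Type*} [AddCommGroup M] [Module K M] (x : M) : x + x = 0 := by
  have : (2 : K) • x = 0 := by
    have h : (2 : K) = 0 := by exact_mod_cast CharP.cast_eq_zero K 2
    rw [h, zero_smul]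
  rwa [two_smul] at this

lemma end_pow [CharP K 2] {M : Type*} [AddCommGroup M] [Module K M] (a : Module.End K M) (k : ℕ) :
    (a - 1) ^ (2 ^ k) = a ^ (2 ^ k) - 1 := by
  induction k with
  | zero => simp
  | succ k ih =>
    rw [pow_succ, pow_mul, ih, pow_mul]
    generalize a ^ 2 ^ k = b
    have h := two_zero (K := K) b
    have h1 := two_zero (K := K) (1 : Module.End K M)
    have e : (b - 1) ^ 2 = b ^ 2 - 1 - (b + b) + (1 + 1) := by noncomm_ring
    rw [e, h, h1]
    simp

/-- the conjugate of `comp' f - 1` -/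
lemma conj_comp' [CharP K 2] {M : Type*} [AddCommGroup M] [Module K M] [FiniteDimensional K M]
    (f : Module.End K M) (d : ℕ) :
    blockMult (comp' f - 1) d = blockMult (comp' (f - 1)) d := by
  have hx := two_zero (K := K) (M := M)
  have hm : ∀ x : M, - x = x := fun x => (eq_neg_of_add_eq_zero_left (hx x)).symm
  let e : (M × M) ≃ₗ[K] (M × M) := LinearEquiv.ofInvolutive
    (LinearMap.prod (LinearMap.fst K M M + LinearMap.snd K M M) (LinearMap.snd K M M)) (by
      rintro ⟨a, b⟩
      simp [add_assoc, hx])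
  have he : ∀ x, e x = (x.1 + x.2, x.2) := fun _ => rfl
  apply blockMult_conj e
  rintro ⟨a, b⟩
  simp [he, comp'_apply, sub_eq_add_neg, hm]
  rw [show f b + a + (a + b) = f b + b + (a + a) by abel, hx, add_zero]

lemma blockMult_comp_even [CharP K 2] {M : Type*} [AddCommGroup M] [Module K M]
    [FiniteDimensional K M] (f : Module.End K M) (d : ℕ) (hd : 1 ≤ d) :
    blockMult (comp' f - 1) (2 * d) = blockMult (f - 1) d := by
  obtain ⟨d, rfl⟩ := Nat.exists_eq_add_of_le' hd
  rw [conj_comp']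
  unfold blockMult
  rw [show 2 * (d + 1) - 1 = 2 * d + 1 by omega, comp'_odd, comp'_odd, comp'_even]
  rw [Nat.add_sub_cancel]
  push_cast
  ring

lemma blockMult_comp_odd [CharP K 2] {M : Type*} [AddCommGroup M] [Module K M]
    [FiniteDimensional K M] (f : Module.End K M) (d : ℕ) :
    blockMult (comp' f - 1) (2 * d + 1) = 0 := by
  rw [conj_comp']
  unfold blockMult
  rw [Nat.add_sub_cancel, show 2 * d + 1 + 1 = 2 * (d + 1) by omega, comp'_odd, comp'_even,
    comp'_even]
  push_cast
  ring

lemma finrank_map_ker {M M' : Type*} [AddCommGroup M] [Module K M] [AddCommGroup M'] [Module K M']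
    [FiniteDimensional K M] (f : M →ₗ[K] M') (p : Submodule K M) :
    Module.finrank K ↥(Submodule.map f p) + Module.finrank K ↥(LinearMap.ker f ⊓ p) =
      Module.finrank K ↥p := by
  have h := LinearMap.finrank_range_add_finrank_ker (f.domRestrict p)
  rw [LinearMap.range_domRestrict, LinearMap.ker_domRestrict] at h
  rw [← h]
  congr 1
  rw [← Submodule.finrank_map_subtype_eq p, Submodule.map_comap_subtype, inf_comm]

/-- kernel increments -/
noncomputable def cc {M : Type*} [AddCommGroup M] [Module K M] (N : Module.End K M) (d : ℕ) : ℕ :=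
  Module.finrank K ↥(LinearMap.ker N ⊓ LinearMap.range (N ^ d))

lemma rank_succ {M : Type*} [AddCommGroup M] [Module K M] [FiniteDimensional K M]
    (N : Module.End K M) (d : ℕ) :
    Module.finrank K ↥(LinearMap.range (N ^ (d + 1))) + cc N d =
      Module.finrank K ↥(LinearMap.range (N ^ d)) := by
  rw [← finrank_map_ker N (LinearMap.range (N ^ d)), pow_succ', Module.End.mul_eq_comp,
    LinearMap.range_comp]
  rfl

lemma cc_anti {M : Type*} [AddCommGroup M] [Module K M] [FiniteDimensional K M]
    (N : Module.End K M) : Antitone (cc N) := by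
  apply antitone_nat_of_succ_le
  intro d
  apply Submodule.finrank_mono
  apply inf_le_inf_left
  rw [pow_succ, Module.End.mul_eq_comp]
  exact LinearMap.range_comp_le_range _ _

lemma ker_succ {M : Type*} [AddCommGroup M] [Module K M] [FiniteDimensional K M]
    (N : Module.End K M) (d : ℕ) :
    Module.finrank K ↥(LinearMap.ker (N ^ (d + 1))) =
      Module.finrank K ↥(LinearMap.ker (N ^ d)) + cc N d := by
  have h1 := LinearMap.finrank_range_add_finrank_ker (N ^ (d + 1))
  have h2 := LinearMap.finrank_range_add_finrank_ker (N ^ d)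
  have h3 := rank_succ N d
  omega

lemma ker_sum {M : Type*} [AddCommGroup M] [Module K M] [FiniteDimensional K M]
    (N : Module.End K M) (d : ℕ) :
    Module.finrank K ↥(LinearMap.ker (N ^ d)) = ∑ i ∈ Finset.range d, cc N i := by
  induction d with
  | zero =>
    have : LinearMap.ker (N ^ 0) = ⊥ := by
      rw [pow_zero, Module.End.one_eq_id, LinearMap.ker_id]
    rw [this]; simp
  | succ d ih => rw [ker_succ, ih, Finset.sum_range_succ]

lemma blockMult_cc {M : Type*} [AddCommGroup M] [Module K M] [FiniteDimensional K M]
    (N : Module.End K M) (d : ℕ) :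
    blockMult N (d + 1) = (cc N d : ℤ) - cc N (d + 1) := by
  unfold blockMult
  have h1 := rank_succ N d
  have h2 := rank_succ N (d + 1)
  rw [Nat.add_sub_cancel]
  omega

/-- numeric lemma -/
lemma anti_const (c : ℕ → ℕ) (hc : Antitone c) (q : ℕ) (hq : 2 ≤ q)
    (h : q * (c 0 + c 1) ≤ ∑ i ∈ Finset.range (2 * q), c i) :
    ∀ d, d < 2 * q → c d = c 0 := by
  have hs : ∀ k, ∑ i ∈ Finset.range (2 * k), c i ≤ k * (c 0 + c 1) := by
    intro k
    induction k with
    | zero => simp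
    | succ k ih =>
      rw [show 2 * (k + 1) = 2 * k + 1 + 1 by ring, Finset.sum_range_succ, Finset.sum_range_succ]
      have := hc (Nat.zero_le (2 * k))
      have := hc (show 1 ≤ 2 * k + 1 by omega)
      nlinarith
  obtain ⟨k, rfl⟩ := Nat.exists_eq_add_of_le' (show 1 ≤ q by omega)
  have h0 := hs k
  rw [show 2 * (k + 1) = 2 * k + 1 + 1 by ring, Finset.sum_range_succ, Finset.sum_range_succ] at h
  have e1 := hc (show 1 ≤ 2 * k by omega)
  have e2 := hc (show 2 * k ≤ 2 * k + 1 by omega)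
  have e3 := hc (show 0 ≤ 1 by omega)
  have e4 : c 0 + c 1 ≤ c (2 * k) + c (2 * k + 1) := by nlinarith
  intro d hd
  have e5 := hc (show d ≤ 2 * k + 1 by omega)
  have e6 := hc (show 0 ≤ d by omega)
  omega

end Ranks

section Sym
variable {K : Type*} [Field K]

/-- bilinear multiplication -/
noncomputable def SymSq.mulB (K V : Type*) [Field K] [AddCommGroup V] [Module K V] :
    V →ₗ[K] V →ₗ[K] SymSq K V :=
  (TensorProduct.mk K V V).compr₂ (Submodule.mkQ _)

lemma SymSq.mulB_apply {V : Type*} [AddCommGroup V] [Module K V] (x y : V) :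
    SymSq.mulB K V x y = SymSq.mul x y := rfl

lemma SymSq.mul_comm' {V : Type*} [AddCommGroup V] [Module K V] (x y : V) :
    (SymSq.mul x y : SymSq K V) = SymSq.mul y x := by
  unfold SymSq.mul
  rw [Submodule.Quotient.eq]
  exact Submodule.subset_span ⟨x, y, rfl⟩

/-- lift of symmetric bilinear maps -/
noncomputable def SymSq.lift {V W : Type*} [AddCommGroup V] [Module K V] [AddCommGroup W]
    [Module K W] (B : V →ₗ[K] V →ₗ[K] W) (hB : ∀ x y, B x y = B y x) : SymSq K V →ₗ[K] W :=
  Submodule.liftQ _ (TensorProduct.lift B) (by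
    rw [Submodule.span_le]
    rintro _ ⟨x, y, rfl⟩
    simp [hB x y])

lemma SymSq.lift_mul {V W : Type*} [AddCommGroup V] [Module K V] [AddCommGroup W]
    [Module K W] (B : V →ₗ[K] V →ₗ[K] W) (hB : ∀ x y, B x y = B y x) (x y : V) :
    SymSq.lift B hB (SymSq.mul x y) = B x y := by
  unfold SymSq.lift SymSq.mul
  rw [Submodule.liftQ_apply, TensorProduct.lift.tmul]

lemma SymSq.ext_mul {V W : Type*} [AddCommGroup V] [Module K V] [AddCommGroup W]
    [Module K W] (f g : SymSq K V →ₗ[K] W)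
    (h : ∀ x y : V, f (SymSq.mul x y) = g (SymSq.mul x y)) : f = g := by
  apply Submodule.linearMap_qext
  apply TensorProduct.ext'
  exact h

/-- functoriality -/
noncomputable def SymSq.map {V W : Type*} [AddCommGroup V] [Module K V] [AddCommGroup W]
    [Module K W] (f : V →ₗ[K] W) : SymSq K V →ₗ[K] SymSq K W :=
  SymSq.lift ((SymSq.mulB K W).compl₁₂ f f) (fun _ _ => by
    simp only [LinearMap.compl₁₂_apply, SymSq.mulB_apply]; exact SymSq.mul_comm' _ _)

lemma SymSq.map_mul {V W : Type*} [AddCommGroup V] [Module K V] [AddCommGroup W]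
    [Module K W] (f : V →ₗ[K] W) (x y : V) :
    SymSq.map f (SymSq.mul x y) = SymSq.mul (f x) (f y) := by
  unfold SymSq.map
  rw [SymSq.lift_mul, LinearMap.compl₁₂_apply, SymSq.mulB_apply]

/-- equivalences -/
noncomputable def SymSq.congr' {V W : Type*} [AddCommGroup V] [Module K V] [AddCommGroup W]
    [Module K W] (e : V ≃ₗ[K] W) : SymSq K V ≃ₗ[K] SymSq K W :=
  LinearEquiv.ofLinearMap (SymSq.map e.toLinearMap) (SymSq.map e.symm.toLinearMap)
    (SymSq.ext_mul _ _ fun x y => by simp [SymSq.map_mul])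
    (SymSq.ext_mul _ _ fun x y => by simp [SymSq.map_mul])

lemma SymSq.congr'_mul {V W : Type*} [AddCommGroup V] [Module K V] [AddCommGroup W]
    [Module K W] (e : V ≃ₗ[K] W) (x y : V) :
    SymSq.congr' e (SymSq.mul x y) = SymSq.mul (e x) (e y) :=
  SymSq.map_mul _ _ _

/-- cross term -/
noncomputable def crossB (K X : Type*) [Field K] [AddCommGroup X] [Module K X] :
    (X × X) →ₗ[K] (X × X) →ₗ[K] TensorProduct K X X :=
  (TensorProduct.mk K X X).compl₁₂ (LinearMap.fst K X X) (LinearMap.snd K X X) +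
  ((TensorProduct.mk K X X).compl₁₂ (LinearMap.fst K X X) (LinearMap.snd K X X)).flip

lemma crossB_apply {X : Type*} [AddCommGroup X] [Module K X] (x y : X × X) :
    crossB K X x y = x.1 ⊗ₜ[K] y.2 + y.1 ⊗ₜ[K] x.2 := rfl

/-- forward map -/
noncomputable def splitF (K X : Type*) [Field K] [AddCommGroup X] [Module K X] :
    SymSq K (X × X) →ₗ[K] (SymSq K X × SymSq K X) × TensorProduct K X X :=
  LinearMap.prod (LinearMap.prod (SymSq.map (LinearMap.fst K X X)) (SymSq.map (LinearMap.snd K X X)))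
    (SymSq.lift (crossB K X) (fun x y => by rw [crossB_apply, crossB_apply, add_comm]))

lemma splitF_mul {X : Type*} [AddCommGroup X] [Module K X] (x y : X × X) :
    splitF K X (SymSq.mul x y) =
      ((SymSq.mul x.1 y.1, SymSq.mul x.2 y.2), x.1 ⊗ₜ[K] y.2 + y.1 ⊗ₜ[K] x.2) := by
  have h1 := SymSq.map_mul (LinearMap.fst K X X) x y
  have h2 := SymSq.map_mul (LinearMap.snd K X X) x y
  have h3 := SymSq.lift_mul (crossB K X) (fun x y => by rw [crossB_apply, crossB_apply, add_comm]) x y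
  exact Prod.ext (Prod.ext h1 h2) h3

/-- backward map -/
noncomputable def splitG (K X : Type*) [Field K] [AddCommGroup X] [Module K X] :
    (SymSq K X × SymSq K X) × TensorProduct K X X →ₗ[K] SymSq K (X × X) :=
  LinearMap.coprod (LinearMap.coprod (SymSq.map (LinearMap.inl K X X))
    (SymSq.map (LinearMap.inr K X X)))
    (TensorProduct.lift ((SymSq.mulB K (X × X)).compl₁₂ (LinearMap.inl K X X)
      (LinearMap.inr K X X)))

lemma mul_zero_left' {X : Type*} [AddCommGroup X] [Module K X] (x : X) :
    (SymSq.mul 0 x : SymSq K X) = 0 := by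
  rw [← SymSq.mulB_apply, map_zero, LinearMap.zero_apply]

lemma mul_zero_right' {X : Type*} [AddCommGroup X] [Module K X] (x : X) :
    (SymSq.mul x 0 : SymSq K X) = 0 := by
  rw [← SymSq.mulB_apply, map_zero]

lemma splitG_apply {X : Type*} [AddCommGroup X] [Module K X] (a b : SymSq K X)
    (c : TensorProduct K X X) :
    splitG K X ((a, b), c) = SymSq.map (LinearMap.inl K X X) a + SymSq.map (LinearMap.inr K X X) b
     + (TensorProduct.lift ((SymSq.mulB K (X × X)).compl₁₂ (LinearMap.inl K X X)
      (LinearMap.inr K X X))) c := rfl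

/-- splitting -/
noncomputable def splitE (K X : Type*) [Field K] [AddCommGroup X] [Module K X] :
    SymSq K (X × X) ≃ₗ[K] (SymSq K X × SymSq K X) × TensorProduct K X X :=
  LinearEquiv.ofLinearMap (splitF K X) (splitG K X)
    (by
      apply LinearMap.prod_ext
      · apply LinearMap.prod_ext
        · apply SymSq.ext_mul
          intro x y
          simp [splitG_apply, SymSq.map_mul, splitF_mul, mul_zero_left']
        · apply SymSq.ext_mul
          intro x y
          simp [splitG_apply, SymSq.map_mul, splitF_mul, mul_zero_left']
      · apply TensorProduct.ext'
        intro x y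
        have h0 : splitG K X (0, x ⊗ₜ[K] y) =
            SymSq.mul (LinearMap.inl K X X x) (LinearMap.inr K X X y) := by
          rw [← Prod.mk_zero_zero, splitG_apply, map_zero, map_zero, zero_add, zero_add,
            TensorProduct.lift.tmul, LinearMap.compl₁₂_apply, SymSq.mulB_apply]
        simp [h0, splitF_mul, mul_zero_left', mul_zero_right'])
    (by
      apply SymSq.ext_mul
      rintro ⟨a, b⟩ ⟨c, d⟩
      simp only [LinearMap.comp_apply, splitF_mul, splitG_apply, SymSq.map_mul, map_add,
        TensorProduct.lift.tmul, LinearMap.compl₁₂_apply, LinearMap.id_apply]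
      have h1 : ((a, b) : X × X) = LinearMap.inl K X X a + LinearMap.inr K X X b := by simp
      have h2 : ((c, d) : X × X) = LinearMap.inl K X X c + LinearMap.inr K X X d := by simp
      rw [h1, h2, ← SymSq.mulB_apply, ← SymSq.mulB_apply, ← SymSq.mulB_apply, map_add, map_add,
        LinearMap.add_apply, LinearMap.add_apply]
      have := SymSq.mul_comm' (K := K) (LinearMap.inl K X X c) (LinearMap.inr K X X b)
      rw [← SymSq.mulB_apply, ← SymSq.mulB_apply] at this
      rw [this]
      abel)

/-- twisted swap -/
noncomputable def Pm {X : Type*} [AddCommGroup X] [Module K X] (v : Module.End K X) :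
    Module.End K (TensorProduct K X X) :=
  (TensorProduct.map v 1) ∘ₗ (TensorProduct.comm K X X).toLinearMap

lemma Pm_tmul {X : Type*} [AddCommGroup X] [Module K X] (v : Module.End K X) (a b : X) :
    Pm v (a ⊗ₜ[K] b) = v b ⊗ₜ[K] a := by
  simp [Pm]

lemma sym_conj {V V' : Type*} [AddCommGroup V] [Module K V] [AddCommGroup V'] [Module K V']
    (u : Module.End K V) (u' : Module.End K V') (e : V ≃ₗ[K] V') (he : ∀ x, e (u x) = u' (e x))
    (ut : Module.End K (SymSq K V)) (ut' : Module.End K (SymSq K V'))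
    (hut : ∀ x y : V, ut (SymSq.mul x y) = SymSq.mul (u x) (u y))
    (hut' : ∀ x y : V', ut' (SymSq.mul x y) = SymSq.mul (u' x) (u' y)) (z : SymSq K V) :
    SymSq.congr' e (ut z) = ut' (SymSq.congr' e z) := by
  have : (SymSq.congr' e).toLinearMap ∘ₗ ut = ut' ∘ₗ (SymSq.congr' e).toLinearMap := by
    apply SymSq.ext_mul
    intro x y
    simp [hut, hut', SymSq.congr'_mul, he]
  exact LinearMap.congr_fun this z

lemma step_block [CharP K 2] {V X : Type*} [AddCommGroup V] [Module K V] [AddCommGroup X]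
    [Module K X] [FiniteDimensional K X]
    (u : Module.End K V) (v : Module.End K X) (e : V ≃ₗ[K] X × X)
    (he : ∀ x, e (u x) = comp' v (e x))
    (ut : Module.End K (SymSq K V)) (hut : ∀ x y : V, ut (SymSq.mul x y) = SymSq.mul (u x) (u y))
    (vt : Module.End K (SymSq K X)) (hvt : ∀ x y : X, vt (SymSq.mul x y) = SymSq.mul (v x) (v y))
    (d : ℕ) :
    blockMult (ut - 1) d = blockMult (comp' vt - 1) d + blockMult (Pm v - 1) d := by
  rw [← blockMult_prodMap]
  let wt : Module.End K (SymSq K (X × X)) := SymSq.map (comp' v)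
  have h1 := sym_conj u (comp' v) e he ut wt hut (SymSq.map_mul _)
  have h2 : (splitE K X).toLinearMap ∘ₗ wt =
      (LinearMap.prodMap (comp' vt) (Pm v)) ∘ₗ (splitE K X).toLinearMap := by
    apply SymSq.ext_mul
    rintro ⟨a, b⟩ ⟨c, d⟩
    have hs : ∀ z, splitE K X z = splitF K X z := fun _ => rfl
    simp [wt, SymSq.map_mul, hs, splitF_mul, comp'_apply, Pm_tmul, hvt]
    abel
  apply blockMult_conj ((SymSq.congr' e).trans (splitE K X))
  intro z
  have h3 := LinearMap.congr_fun h2 (SymSq.congr' e z)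
  simp only [LinearMap.comp_apply, LinearEquiv.coe_coe] at h3
  have h4 : ∀ w, (LinearMap.prodMap (comp' vt - 1) (Pm v - 1)) w =
    (LinearMap.prodMap (comp' vt) (Pm v)) w - w := fun _ => rfl
  rw [h4, LinearEquiv.trans_apply, LinearEquiv.trans_apply, LinearMap.sub_apply, map_sub, map_sub,
    h1, h3]
  rfl

end Sym

section Model
variable {K : Type*} [Field K]

/-- shift -/
def sh (K : Type*) [Field K] (n : ℕ) : Module.End K (Fin n → K) where
  toFun f i := if h : i.1 + 1 < n then f ⟨i.1 + 1, h⟩ else 0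
  map_add' f g := by
    ext i; by_cases h : i.1 + 1 < n <;> simp [h]
  map_smul' c f := by
    ext i; by_cases h : i.1 + 1 < n <;> simp [h]

lemma sh_apply (n : ℕ) (f : Fin n → K) (i : Fin n) :
    sh K n f i = if h : i.1 + 1 < n then f ⟨i.1 + 1, h⟩ else 0 := rfl

lemma sh_pow (n q : ℕ) (f : Fin n → K) (i : Fin n) :
    (sh K n ^ q) f i = if h : i.1 + q < n then f ⟨i.1 + q, h⟩ else 0 := by
  induction q generalizing f with
  | zero => simp
  | succ q ih =>
    rw [pow_succ, Module.End.mul_apply, ih]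
    by_cases h : i.1 + (q + 1) < n
    · have h' : i.1 + q < n := by omega
      rw [dif_pos h, dif_pos h', sh_apply, dif_pos (show i.1 + q + 1 < n by omega)]
      rfl
    · rw [dif_neg h]
      by_cases h' : i.1 + q < n
      · rw [dif_pos h', sh_apply, dif_neg (show ¬ (i.1 + q + 1 < n) by omega)]
      · rw [dif_neg h']

lemma sh_nil (n q : ℕ) (hq : n ≤ q) : sh K n ^ q = 0 := by
  refine LinearMap.ext fun x => ?_
  funext y
  rw [sh_pow, dif_neg (by omega)]
  rfl

lemma iso_model {V : Type*} [AddCommGroup V] [Module K V] [FiniteDimensional K V]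
    (n : ℕ) (hn : 1 ≤ n) (hdim : Module.finrank K V = n) (u : Module.End K V)
    (hu1 : (u - 1) ^ (n - 1) ≠ 0) (hu2 : (u - 1) ^ n = 0) :
    ∃ e : V ≃ₗ[K] (Fin n → K), ∀ x, e (u x) = (1 + sh K n) (e x) := by
  set t := u - 1 with ht
  obtain ⟨x0, hx0⟩ : ∃ x, (t ^ (n - 1)) x ≠ 0 := by
    by_contra! h
    exact hu1 (LinearMap.ext h)
  obtain ⟨lam, hlam⟩ : ∃ lam : Module.Dual K V, lam ((t ^ (n - 1)) x0) ≠ 0 := by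
    by_contra! h
    exact hx0 ((Module.forall_dual_apply_eq_zero_iff K _).1 h)
  let E : V →ₗ[K] (Fin n → K) := LinearMap.pi fun i => lam ∘ₗ (t ^ i.1)
  have hE : ∀ x i, E x i = lam ((t ^ i.1) x) := fun _ _ => rfl
  have hEt : ∀ x, E (t x) = sh K n (E x) := by
    intro x
    ext i
    rw [hE, sh_apply, ← Module.End.mul_apply, ← pow_succ]
    split_ifs with h
    · rfl
    · have : i.1 + 1 = n := by omega
      rw [this, hu2]; simp
  have hEp : ∀ k x, E ((t ^ k) x) = (sh K n ^ k) (E x) := by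
    intro k
    induction k with
    | zero => intro x; simp
    | succ k ih =>
      intro x; rw [pow_succ, pow_succ, Module.End.mul_apply, Module.End.mul_apply, ih, hEt]
  have hs : ∀ k, ∀ g : Fin n → K, (∀ i : Fin n, k ≤ i.1 → g i = 0) → g ∈ LinearMap.range E := by
    intro k
    induction k with
    | zero =>
      intro g hg
      have : g = 0 := funext fun i => hg i (Nat.zero_le _)
      rw [this]; exact Submodule.zero_mem _
    | succ k ih =>
      intro g hg
      by_cases hk : k < n
      · set c := lam ((t ^ (n - 1)) x0) with hc
        have key := ih (g - (g ⟨k, hk⟩ / c) • E ((t ^ (n - 1 - k)) x0)) (by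
          intro i hi
          rw [hEp, Pi.sub_apply, Pi.smul_apply, sh_pow]
          rcases Nat.eq_or_lt_of_le hi with h | h
          · have hi' : i = ⟨k, hk⟩ := Fin.ext h.symm
            subst hi'
            rw [dif_pos (show k + (n - 1 - k) < n by omega), hE]
            have : k + (n - 1 - k) = n - 1 := by omega
            simp only [this]
            rw [← hc, smul_eq_mul, div_mul_cancel₀ _ hlam, sub_self]
          · rw [dif_neg (by omega), hg i h]; simp)
        have := Submodule.add_mem _ key (Submodule.smul_mem _ (g ⟨k, hk⟩ / c)
          (LinearMap.mem_range_self E ((t ^ (n - 1 - k)) x0)))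
        rwa [sub_add_cancel] at this
      · exact ih g fun i hi => by omega
  have hsurj : Function.Surjective E := by
    rw [← LinearMap.range_eq_top, eq_top_iff]
    intro g _
    exact hs n g fun i hi => by omega
  have hinj : Function.Injective E :=
    (LinearMap.injective_iff_surjective_of_finrank_eq_finrank (by simp [hdim])).2 hsurj
  refine ⟨LinearEquiv.ofBijective E ⟨hinj, hsurj⟩, fun x => ?_⟩
  have hu : u x = x + t x := by simp [ht]
  rw [hu, map_add]
  change E x + E (t x) = (1 + sh K n) (E x)
  rw [hEt]; rfl

lemma comp_block [CharP K 2] {X : Type*} [AddCommGroup X] [Module K X] (n : ℕ) (hn : 1 ≤ n)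
    (v : Module.End K X) (hv1 : (v - 1) ^ (n - 1) ≠ 0) (hv2 : (v - 1) ^ n = 0) :
    (comp' v - 1) ^ (2 * n - 1) ≠ 0 ∧ (comp' v - 1) ^ (2 * n) = 0 := by
  have h2 : (comp' v - 1) ^ 2 = LinearMap.prodMap (v - 1) (v - 1) := by
    have := end_pow (comp' v) 1
    rw [pow_one] at this
    rw [this, comp'_sq]
    ext <;> simp
  constructor
  · intro h
    rw [show 2 * n - 1 = 2 * (n - 1) + 1 by omega, pow_succ, pow_mul, h2, prodMap_pow'] at h
    apply hv1
    ext x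
    have := LinearMap.congr_fun h (x, 0)
    simpa [comp'_apply] using congrArg Prod.snd this
  · rw [pow_mul, h2, prodMap_pow', hv2]
    ext <;> simp

lemma model_block (n : ℕ) (hn : 1 ≤ n) :
    (1 + sh K n - 1) ^ (n - 1) ≠ 0 ∧ (1 + sh K n - 1) ^ n = 0 := by
  rw [add_sub_cancel_left]
  refine ⟨fun h => ?_, sh_nil _ _ le_rfl⟩
  have := congrFun (LinearMap.congr_fun h (fun _ => 1)) ⟨0, by omega⟩
  rw [sh_pow, dif_pos (by simp; omega)] at this
  simp at this

lemma model_double [CharP K 2] {V : Type*} [AddCommGroup V] [Module K V] [FiniteDimensional K V]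
    (n : ℕ) (hn : 1 ≤ n) (hdim : Module.finrank K V = 2 * n) (u : Module.End K V)
    (hu1 : (u - 1) ^ (2 * n - 1) ≠ 0) (hu2 : (u - 1) ^ (2 * n) = 0) :
    ∃ e : V ≃ₗ[K] (Fin n → K) × (Fin n → K), ∀ x, e (u x) = comp' (1 + sh K n) (e x) := by
  obtain ⟨e1, h1⟩ := iso_model (2 * n) (by omega) hdim u hu1 hu2
  obtain ⟨a, b⟩ := comp_block n hn (1 + sh K n) (model_block n hn).1 (model_block n hn).2
  obtain ⟨e2, h2⟩ := iso_model (2 * n) (by omega) (by simp [two_mul]) (comp' (1 + sh K n)) a b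
  refine ⟨e1.trans e2.symm, fun x => ?_⟩
  rw [LinearEquiv.trans_apply, LinearEquiv.trans_apply, LinearEquiv.symm_apply_eq, h2, h1]
  simp

end Model

section Tens
variable {K : Type*} [Field K]

/-- coordinate -/
noncomputable def co (K : Type*) [Field K] (n : ℕ) (i : Fin n) :
    TensorProduct K (Fin n → K) (Fin n → K) →ₗ[K] (Fin n → K) :=
  LinearMap.proj i ∘ₗ (TensorProduct.piScalarRight K K (Fin n → K) (Fin n)).toLinearMap

lemma co_apply (n : ℕ) (i : Fin n) (z) :
    co K n i z = TensorProduct.piScalarRight K K (Fin n → K) (Fin n) z i := rfl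

lemma co_tmul (n : ℕ) (i : Fin n) (x y : Fin n → K) : co K n i (x ⊗ₜ[K] y) = y i • x := by
  rw [co_apply, TensorProduct.piScalarRight_apply, TensorProduct.piScalarRightHom_tmul]

lemma co_ext (n : ℕ) (z z' : TensorProduct K (Fin n → K) (Fin n → K))
    (h : ∀ i, co K n i z = co K n i z') : z = z' :=
  (TensorProduct.piScalarRight K K (Fin n → K) (Fin n)).injective (funext h)

lemma co_left (n : ℕ) (i : Fin n) (f : Module.End K (Fin n → K)) (z) :
    co K n i (TensorProduct.map f 1 z) = f (co K n i z) := by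
  induction z using TensorProduct.induction_on with
  | zero => simp
  | tmul x y => rw [TensorProduct.map_tmul, co_tmul, co_tmul, map_smul]; rfl
  | add x y hx hy => simp only [map_add, hx, hy]

lemma co_right (n q : ℕ) (i : Fin n) (z) :
    co K n i (TensorProduct.map 1 (sh K n ^ q) z) =
      if h : i.1 + q < n then co K n ⟨i.1 + q, h⟩ z else 0 := by
  induction z using TensorProduct.induction_on with
  | zero => simp
  | tmul x y =>
    rw [TensorProduct.map_tmul, co_tmul, sh_pow]
    split_ifs with h
    · rw [co_tmul]; rfl
    · simp
  | add x y hx hy =>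
    simp only [map_add, hx, hy]
    split_ifs <;> simp

lemma map_sub_left' {X : Type*} [AddCommGroup X] [Module K X] (f g h : Module.End K X) :
    TensorProduct.map (f - g) h = TensorProduct.map f h - TensorProduct.map g h := by
  apply TensorProduct.ext'
  intro x y
  simp [TensorProduct.sub_tmul]

lemma map_sub_right' {X : Type*} [AddCommGroup X] [Module K X] (f g h : Module.End K X) :
    TensorProduct.map h (f - g) = TensorProduct.map h f - TensorProduct.map h g := by
  apply TensorProduct.ext'
  intro x y
  simp [TensorProduct.tmul_sub]

lemma Pm_sq {X : Type*} [AddCommGroup X] [Module K X] (v : Module.End K X) :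
    Pm v ^ 2 = TensorProduct.map v v := by
  rw [pow_two]
  apply TensorProduct.ext'
  intro x y
  rw [Module.End.mul_apply, Pm_tmul, Pm_tmul, TensorProduct.map_tmul]

lemma Pm_pow [CharP K 2] {X : Type*} [AddCommGroup X] [Module K X] (v : Module.End K X) (k : ℕ) :
    (Pm v - 1) ^ (2 * 2 ^ k) = TensorProduct.map (v ^ 2 ^ k) (v ^ 2 ^ k) - 1 := by
  rw [← pow_succ', end_pow, pow_succ', pow_mul, Pm_sq, TensorProduct.map_pow]

lemma exists_inv (n : ℕ) : ∃ w : Module.End K (Fin n → K),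
    w * (1 + sh K n) = 1 ∧ (1 + sh K n) * w = 1 := by
  have h : IsNilpotent (sh K n) := ⟨n, sh_nil n n le_rfl⟩
  obtain ⟨U, hU⟩ := h.isUnit_one_add
  exact ⟨↑U⁻¹, by rw [← hU]; simp, by rw [← hU]; simp⟩

lemma ker_iff [CharP K 2] (n k : ℕ) (w : Module.End K (Fin n → K))
    (h1 : w * (1 + sh K n) = 1) (h2 : (1 + sh K n) * w = 1) (z) :
    z ∈ LinearMap.ker ((Pm (1 + sh K n) - 1) ^ (2 * 2 ^ k)) ↔
      TensorProduct.map 1 (sh K n ^ 2 ^ k) z = TensorProduct.map (w ^ 2 ^ k - 1) 1 z := by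
  rw [Pm_pow, LinearMap.mem_ker, LinearMap.sub_apply, sub_eq_zero]
  have hc : Commute w (1 + sh K n) := h1.trans h2.symm
  have e1 : w ^ 2 ^ k * (1 + sh K n) ^ 2 ^ k = 1 := by rw [← hc.mul_pow, h1, one_pow]
  have e2 : (1 + sh K n) ^ 2 ^ k * w ^ 2 ^ k = 1 := by rw [← hc.symm.mul_pow, h2, one_pow]
  have e3 : sh K n ^ 2 ^ k = (1 + sh K n) ^ 2 ^ k - 1 := by rw [← end_pow, add_sub_cancel_left]
  rw [e3]
  generalize (1 + sh K n) ^ 2 ^ k = h at *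
  generalize w ^ 2 ^ k = g at *
  rw [map_sub_left', map_sub_right', LinearMap.sub_apply,
    LinearMap.sub_apply, sub_left_inj]
  have f1 : TensorProduct.map h h z = TensorProduct.map h (1 : Module.End K (Fin n → K))
      (TensorProduct.map (1 : Module.End K (Fin n → K)) h z) := by
    rw [← LinearMap.comp_apply, ← TensorProduct.map_comp]; rfl
  have f2 : TensorProduct.map (1 : Module.End K (Fin n → K)) h z =
      TensorProduct.map g (1 : Module.End K (Fin n → K)) (TensorProduct.map h h z) := by
    rw [← LinearMap.comp_apply, ← TensorProduct.map_comp, ← Module.End.mul_eq_comp, e1]; rfl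
  have f3 : TensorProduct.map h (1 : Module.End K (Fin n → K))
      (TensorProduct.map g (1 : Module.End K (Fin n → K)) z) = z := by
    rw [← LinearMap.comp_apply, ← TensorProduct.map_comp, ← Module.End.mul_eq_comp, e2]
    exact LinearMap.congr_fun TensorProduct.map_one z
  constructor
  · intro H
    rw [f2, H]; rfl
  · intro H
    rw [f1, H, f3]; rfl

lemma inv_nil [CharP K 2] (n k m : ℕ) (hm : n ≤ 2 ^ k * m) (w : Module.End K (Fin n → K))
    (h1 : w * (1 + sh K n) = 1) (h2 : (1 + sh K n) * w = 1) : (w ^ 2 ^ k - 1) ^ m = 0 := by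
  have hc : Commute w (sh K n) := by
    have : Commute w (1 + sh K n) := h1.trans h2.symm
    have h3 := this.sub_right (Commute.one_right w)
    rwa [add_sub_cancel_left] at h3
  have e : w - 1 = w * sh K n := by
    rw [mul_add, mul_one] at h1
    rw [eq_neg_of_add_eq_zero_left (two_zero (K := K) (w * sh K n)), ← h1]; abel
  rw [← end_pow, e, ← pow_mul, hc.mul_pow, sh_nil n _ hm]
  simp

lemma ker_lower [CharP K 2] (n k m : ℕ) (hn : n = 2 ^ k * m) (hm : 1 ≤ m) :
    2 ^ k * n ≤ Module.finrank K ↥(LinearMap.ker ((Pm (1 + sh K n) - 1) ^ (2 * 2 ^ k))) := by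
  obtain ⟨w, h1, h2⟩ := exists_inv (K := K) n
  have hnil := inv_nil n k m hn.le w h1 h2
  set s := w ^ 2 ^ k - 1 with hs
  have hq : 0 < 2 ^ k := by positivity
  have hqn : 2 ^ k ≤ n := by rw [hn]; exact Nat.le_mul_of_pos_right _ hm
  set q := 2 ^ k with hqd
  let F : (Fin q → Fin n → K) →ₗ[K] (Fin n → Fin n → K) :=
    LinearMap.pi fun i : Fin n => (s ^ (i.1 / q)) ∘ₗ
      (LinearMap.proj (⟨i.1 % q, Nat.mod_lt _ hq⟩ : Fin q))
  let G := (TensorProduct.piScalarRight K K (Fin n → K) (Fin n)).symm.toLinearMap ∘ₗ F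
  have hG : ∀ x i, co K n i (G x) = (s ^ (i.1 / q)) (x ⟨i.1 % q, Nat.mod_lt _ hq⟩) := by
    intro x i
    rw [co_apply]
    simp only [G, LinearMap.comp_apply, LinearEquiv.coe_coe, LinearEquiv.apply_symm_apply]
    rfl
  have hinj : Function.Injective G := by
    intro x y hxy
    funext j
    have := congrArg (co K n ⟨j.1, by omega⟩) hxy
    rw [hG, hG] at this
    simpa [Nat.div_eq_of_lt j.2, Nat.mod_eq_of_lt j.2] using this
  have hr : LinearMap.range G ≤ LinearMap.ker ((Pm (1 + sh K n) - 1) ^ (2 * q)) := by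
    rintro _ ⟨x, rfl⟩
    refine (ker_iff n k w h1 h2 _).2 ?_
    apply co_ext
    intro i
    rw [co_right, co_left, ← hqd, ← hs, hG, ← Module.End.mul_apply, ← pow_succ']
    split_ifs with h
    · rw [hG]
      simp only [Nat.add_mod_right, Nat.add_div_right _ hq]
    · have : m ≤ i.1 / q + 1 := by
        rw [← Nat.add_div_right _ hq, Nat.le_div_iff_mul_le hq, mul_comm, ← hn]
        omega
      rw [pow_eq_zero_of_le this hnil]; rfl
  calc q * n = Module.finrank K (Fin q → Fin n → K) := by
        rw [Module.finrank_pi_fintype]; simp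
    _ = Module.finrank K ↥(LinearMap.range G) := (LinearMap.finrank_range_of_inj hinj).symm
    _ ≤ _ := Submodule.finrank_mono hr

lemma ker_inj [CharP K 2] (n : ℕ) (hn : 1 ≤ n) (z)
    (hz : z ∈ LinearMap.ker ((Pm (1 + sh K n) - 1) ^ 2)) (h0 : co K n ⟨0, hn⟩ z = 0) : z = 0 := by
  obtain ⟨w, h1, h2⟩ := exists_inv (K := K) n
  have hk := ker_iff n 0 w h1 h2 z
  rw [pow_zero, mul_one, pow_one, pow_one] at hk
  rw [hk] at hz
  have hco : ∀ i (hi : i < n), co K n ⟨i, hi⟩ z = 0 := by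
    intro i
    induction i with
    | zero => intro _; exact h0
    | succ i ih =>
      intro hi
      have e := congrArg (co K n ⟨i, by omega⟩) hz
      have e2 := co_right n 1 ⟨i, by omega⟩ z
      rw [pow_one] at e2
      rw [e2, co_left, dif_pos hi, ih, map_zero] at e
      exact e
  apply co_ext
  intro i
  rw [hco i.1 i.2, map_zero]

lemma ker_two [CharP K 2] (n : ℕ) (hn : 1 ≤ n) :
    Module.finrank K ↥(LinearMap.ker ((Pm (1 + sh K n) - 1) ^ 2)) = n := by
  apply le_antisymm
  · have := LinearMap.finrank_le_finrank_of_injective (f := (co K n ⟨0, hn⟩).domRestrict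
      (LinearMap.ker ((Pm (1 + sh K n) - 1) ^ 2))) (by
        rw [injective_iff_map_eq_zero]
        rintro ⟨z, hz⟩ h
        exact Subtype.ext (ker_inj n hn z hz h))
    simpa using this
  · simpa using ker_lower (K := K) n 0 n (by simp) hn

lemma even_case [CharP K 2] (n k m : ℕ) (hk : 1 ≤ k) (hn : n = 2 ^ k * m) (hm : 1 ≤ m) (d : ℕ)
    (hd : 1 ≤ d) (hd2 : d ≤ 2 ^ k) : blockMult (Pm (1 + sh K n) - 1) d = 0 := by
  have hq : 2 ≤ 2 ^ k := by
    calc 2 = 2 ^ 1 := rfl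
      _ ≤ 2 ^ k := Nat.pow_le_pow_right (by omega) hk
  have hn1 : 1 ≤ n := by rw [hn]; exact Nat.mul_pos (by omega) hm
  have hl := ker_lower (K := K) n k m hn hm
  have h2 := ker_two (K := K) n hn1
  generalize Pm (1 + sh K n) - 1 = N at *
  rw [ker_sum] at hl h2
  have h2' : cc N 0 + cc N 1 = n := by simpa [Finset.sum_range_succ] using h2
  have hl' : 2 ^ k * (cc N 0 + cc N 1) ≤ ∑ i ∈ Finset.range (2 * 2 ^ k), cc N i := by
    rw [h2']; exact hl
  have := anti_const _ (cc_anti N) _ hq hl'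
  obtain ⟨d, rfl⟩ := Nat.exists_eq_add_of_le' hd
  rw [blockMult_cc, this d (by omega), this (d + 1) (by omega), sub_self]

lemma odd_case [CharP K 2] (n : ℕ) (hn : Odd n) :
    blockMult (Pm (1 + sh K n) - 1) 1 = 1 := by
  have hn1 : 1 ≤ n := hn.pos
  have h2 := ker_two (K := K) n hn1
  have hsum := h2
  rw [ker_sum] at hsum
  have hsum' : cc (Pm (1 + sh K n) - 1) 0 + cc (Pm (1 + sh K n) - 1) 1 = n := by
    simpa [Finset.sum_range_succ] using hsum
  have hanti := cc_anti (Pm (1 + sh K n) - 1) (show 0 ≤ 1 by omega)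
  have hD : Module.finrank K ↥(LinearMap.ker (Pm (1 + sh K n) - 1)) =
      cc (Pm (1 + sh K n) - 1) 0 := by
    have := ker_sum (Pm (1 + sh K n) - 1) 1
    rwa [pow_one, Finset.sum_range_one] at this
  rw [show (1 : ℕ) = 0 + 1 from rfl, blockMult_cc, Nat.zero_add]
  suffices 2 * cc (Pm (1 + sh K n) - 1) 0 ≤ n + 2 by
    obtain ⟨r, hr⟩ := hn
    omega
  rw [← hD]
  set D := LinearMap.ker (Pm (1 + sh K n) - 1) with hDd
  set k := LinearMap.ker ((Pm (1 + sh K n) - 1) ^ 2) with hkd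
  let s : Module.End K (TensorProduct K (Fin n → K) (Fin n → K)) := TensorProduct.map (sh K n) 1
  obtain ⟨w, w1, w2⟩ := exists_inv (K := K) n
  have hk : ∀ z, z ∈ k ↔ TensorProduct.map 1 (sh K n) z = TensorProduct.map (w - 1) 1 z := by
    intro z
    have := ker_iff n 0 w w1 w2 z
    rwa [pow_zero, mul_one, pow_one, pow_one] at this
  have hDk : D ≤ k := by
    intro z hz
    rw [hkd, LinearMap.mem_ker, pow_two, Module.End.mul_apply, LinearMap.mem_ker.1 hz, map_zero]
  have hcomm : ∀ (f : Module.End K (Fin n → K)), f * sh K n = sh K n * f → ∀ z,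
      TensorProduct.map f 1 (s z) = s (TensorProduct.map f 1 z) := by
    intro f hf z
    simp only [s]
    rw [← LinearMap.comp_apply, ← TensorProduct.map_comp, ← LinearMap.comp_apply,
      ← TensorProduct.map_comp, ← Module.End.mul_eq_comp, hf]
    rfl
  have hwS : w * sh K n = sh K n * w := by
    rw [mul_add, mul_one] at w1
    rw [add_mul, one_mul] at w2
    exact add_left_cancel (w1.trans w2.symm)
  -- s preserves k
  have hsk : ∀ z ∈ k, s z ∈ k := by
    intro z hz
    rw [hk] at hz ⊢
    rw [hcomm _ (by rw [sub_mul, mul_sub, hwS, one_mul, mul_one]), ← hz]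
    simp only [s]
    rw [← LinearMap.comp_apply, ← TensorProduct.map_comp, ← LinearMap.comp_apply,
      ← TensorProduct.map_comp]
    rfl
  -- P s = (1 ⊗ S) P
  have hPs : ∀ z, Pm (1 + sh K n) (s z) = TensorProduct.map 1 (sh K n) (Pm (1 + sh K n) z) := by
    intro z
    have : Pm (1 + sh K n) ∘ₗ s = TensorProduct.map 1 (sh K n) ∘ₗ Pm (1 + sh K n) := by
      apply TensorProduct.ext'
      intro x y
      simp only [LinearMap.comp_apply, s, TensorProduct.map_tmul, Pm_tmul]
      rfl
    exact LinearMap.congr_fun this z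
  have hfix : ∀ z ∈ D, Pm (1 + sh K n) z = z := by
    intro z hz
    rw [hDd, LinearMap.mem_ker, LinearMap.sub_apply, sub_eq_zero] at hz
    exact hz
  have hss : ∀ z ∈ D, s z ∈ D → s (s z) = 0 := by
    intro z hz hz'
    have e1 := hfix _ hz'
    rw [hPs, hfix z hz, (hk z).1 (hDk hz)] at e1
    have e2 := congrArg (TensorProduct.map (1 + sh K n) (1 : Module.End K (Fin n → K))) e1
    rw [← LinearMap.comp_apply, ← TensorProduct.map_comp, ← Module.End.mul_eq_comp, mul_sub, w2,
      mul_one, sub_add_cancel_left] at e2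
    have e3 : TensorProduct.map (1 + sh K n) 1 (s z) = s z + s (s z) := by
      rw [TensorProduct.map_add_left, LinearMap.add_apply]
      congr 1
      exact LinearMap.congr_fun TensorProduct.map_one (s z)
    have e4 : TensorProduct.map (-sh K n) (1 * 1 : Module.End K (Fin n → K)) z = - s z := by
      have : (-sh K n) = 0 - sh K n := by abel
      rw [this, map_sub_left', LinearMap.sub_apply, TensorProduct.map_zero_left]
      simp [s]
    have e5 := e4.symm.trans (e2.trans e3)
    have e6 := two_zero (K := K) (s z)
    rw [(eq_neg_of_add_eq_zero_left e6).symm] at e5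
    simpa using e5
  -- k ⊓ ker s is at most one-dimensional
  have h1 : Module.finrank K ↥(LinearMap.ker s ⊓ k) ≤ 1 := by
    have hm : ∀ z ∈ LinearMap.ker s ⊓ k, sh K n (co K n ⟨0, hn1⟩ z) = 0 := by
      rintro z ⟨hz, -⟩
      rw [← co_left]
      have : s z = 0 := hz
      rw [show TensorProduct.map (sh K n) 1 z = s z from rfl, this, map_zero]
    let φ : ↥(LinearMap.ker s ⊓ k) →ₗ[K] K :=
      (LinearMap.proj ⟨0, hn1⟩ ∘ₗ co K n ⟨0, hn1⟩).domRestrict _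
    have hφ : Function.Injective φ := by
      rw [injective_iff_map_eq_zero]
      rintro ⟨z, hz⟩ h
      apply Subtype.ext
      refine ker_inj n hn1 z hz.2 ?_
      have h3 : co K n ⟨0, hn1⟩ z ⟨0, hn1⟩ = 0 := h
      funext ⟨i, hi⟩
      cases i with
      | zero => exact h3
      | succ i =>
        have := congrFun (hm z hz) ⟨i, by omega⟩
        rw [sh_apply, dif_pos hi] at this
        exact this
    simpa using LinearMap.finrank_le_finrank_of_injective hφ
  have hA := finrank_map_ker s D
  have hB := Submodule.finrank_sup_add_finrank_inf_eq D (Submodule.map s D)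
  have hC : Module.finrank K ↥(D ⊔ Submodule.map s D) ≤ n := by
    refine le_trans (Submodule.finrank_mono ?_) h2.le
    apply sup_le hDk
    rintro _ ⟨z, hz, rfl⟩
    exact hsk z (hDk hz)
  have hE : Module.finrank K ↥(D ⊓ Submodule.map s D) ≤ 1 := by
    refine le_trans (Submodule.finrank_mono ?_) h1
    rintro _ ⟨hz1, ⟨z, hz, rfl⟩⟩
    exact ⟨hss z hz hz1, hDk hz1⟩
  have hF : Module.finrank K ↥(LinearMap.ker s ⊓ D) ≤ 1 :=
    le_trans (Submodule.finrank_mono (inf_le_inf_left _ hDk)) h1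
  omega

end Tens

lemma main_model (K : Type*) [Field K] [CharP K 2] (ℓ : ℕ) : 1 ≤ ℓ →
    ∀ ut : Module.End K (SymSq K (Fin (2 * ℓ) → K)),
    (∀ x y, ut (SymSq.mul x y) =
      SymSq.mul ((1 + sh K (2 * ℓ)) x) ((1 + sh K (2 * ℓ)) y)) →
    (∀ d : ℕ, 1 ≤ d → d < 2 ^ padicValNat 2 ℓ → blockMult (ut - 1) d = 0) ∧
      blockMult (ut - 1) (2 ^ padicValNat 2 ℓ) = 1 := by
  induction ℓ using Nat.strong_induction_on with
  | _ ℓ ih =>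
  intro hl ut hut
  obtain ⟨b1, b2⟩ := model_block (K := K) (2 * ℓ) (by omega)
  obtain ⟨e, he⟩ := model_double ℓ hl (by simp) (1 + sh K (2 * ℓ)) b1 b2
  have hstep := step_block (1 + sh K (2 * ℓ)) (1 + sh K ℓ) e he ut hut
    (SymSq.map (1 + sh K ℓ)) (SymSq.map_mul _)
  rcases Nat.even_or_odd ℓ with hev | hodd
  · obtain ⟨r, hr⟩ := hev
    have hr' : ℓ = 2 * r := by omega
    subst hr'
    have hr1 : 1 ≤ r := by omega
    obtain ⟨i1, i2⟩ := ih r (by omega) hr1 (SymSq.map (1 + sh K (2 * r))) (SymSq.map_mul _)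
    have hv : padicValNat 2 (2 * r) = padicValNat 2 r + 1 := by
      rw [padicValNat.mul (by norm_num) (by omega), padicValNat_self, add_comm]
    obtain ⟨m, hm⟩ : 2 ^ padicValNat 2 (2 * r) ∣ 2 * r := pow_padicValNat_dvd
    have hm1 : 1 ≤ m := by
      rcases Nat.eq_zero_or_pos m with h | h
      · rw [h] at hm; omega
      · exact h
    have hP := even_case (K := K) (2 * r) (padicValNat 2 (2 * r)) m (by omega) hm hm1
    have hpow : 2 ^ padicValNat 2 (2 * r) = 2 * 2 ^ padicValNat 2 r := by
      rw [hv, pow_succ, mul_comm]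
    rw [hpow] at hP ⊢
    have hpos : 1 ≤ 2 ^ padicValNat 2 r := Nat.one_le_two_pow
    constructor
    · intro d hd hd2
      rw [hstep, hP d hd hd2.le, add_zero]
      rcases Nat.even_or_odd' d with ⟨j, rfl | rfl⟩
      · rw [blockMult_comp_even _ _ (by omega)]
        exact i1 j (by omega) (by omega)
      · exact blockMult_comp_odd _ _
    · rw [hstep, hP _ (by omega) le_rfl, add_zero, blockMult_comp_even _ _ hpos, i2]
  · have hv : padicValNat 2 ℓ = 0 := by
      apply padicValNat.eq_zero_of_not_dvd
      rw [← even_iff_two_dvd, Nat.not_even_iff_odd]; exact hodd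
    rw [hv, pow_zero]
    refine ⟨fun d h1 h2 => by omega, ?_⟩
    rw [hstep, odd_case ℓ hodd, show (1 : ℕ) = 2 * 0 + 1 from rfl, blockMult_comp_odd]
    rfl

/-- Let `u` be unipotent with a single Jordan block of size `2ℓ` on `V` over an algebraically
closed field of characteristic two, and let `α = ν₂(ℓ)`. Then the smallest Jordan block size
of the induced map `ũ` on `S²(V)` is `2^α`, occurring with multiplicity one. -/
theorem stmt2 (K : Type*) [Field K] [IsAlgClosed K] [CharP K 2]
    (V : Type*) [AddCommGroup V] [Module K V] [FiniteDimensional K V]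
    (ℓ : ℕ) (hl : 1 ≤ ℓ) (hdim : Module.finrank K V = 2 * ℓ)
    (u : Module.End K V)
    (hu1 : (u - 1) ^ (2 * ℓ - 1) ≠ 0) (hu2 : (u - 1) ^ (2 * ℓ) = 0)
    (ut : Module.End K (SymSq K V))
    (hut : ∀ x y : V, ut (SymSq.mul x y) = SymSq.mul (u x) (u y)) :
    (∀ d : ℕ, 1 ≤ d → d < 2 ^ padicValNat 2 ℓ → blockMult (ut - 1) d = 0) ∧
      blockMult (ut - 1) (2 ^ padicValNat 2 ℓ) = 1 := by
  obtain ⟨e, he⟩ := iso_model (2 * ℓ) (by omega) hdim u hu1 hu2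
  have hm := main_model K ℓ hl (SymSq.map (1 + sh K (2 * ℓ))) (SymSq.map_mul _)
  have hb : ∀ d, blockMult (ut - 1) d = blockMult (SymSq.map (1 + sh K (2 * ℓ)) - 1) d := by
    intro d
    apply blockMult_conj (SymSq.congr' e)
    intro z
    rw [LinearMap.sub_apply, map_sub, sym_conj u (1 + sh K (2 * ℓ)) e he ut
      (SymSq.map (1 + sh K (2 * ℓ))) hut (SymSq.map_mul _) z]
    rfl
  simp only [hb]
  exact hm
end

section
/- Let (V, b) be a symplectic vector space of dimension 2ℓ (ℓ ≥ 1) over an algebraically closed field K of characteristic 2, and let u ∈ Sp(V) be unipotent with a single Jordan block of size 2ℓ on V. Let ũ be the map induced by u on S²(V), let φ : S²(V) → K be determined by φ(xy) = b(x, y), and set α = ν₂(ℓ). Then ker(ũ − 1)^{2^α − 1} ⊆ ker φ, and ker(ũ − 1)^{2^α} ⊄ ker φ. -/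
open scoped TensorProduct

section Aux9

theorem aux9_two {S : Type*} [CommRing S] (h2 : (2 : S) = 0) (a b : S) (n : ℕ) :
    (a + b) ^ (2 ^ n) = a ^ (2 ^ n) + b ^ (2 ^ n) := by
  induction n with
  | zero => simp
  | succ n ih =>
    rw [pow_succ, pow_mul, ih, pow_mul, pow_mul]
    linear_combination (a ^ 2 ^ n * b ^ 2 ^ n) * h2

theorem aux9_kill {S : Type*} [CommRing S] (c a b : S) (h : c * a = 0) (m : ℕ) :
    c * (a + b) ^ m = c * b ^ m := by
  induction m with
  | zero => simp
  | succ m ih =>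
    rw [pow_succ, pow_succ, ← mul_assoc, ih]
    linear_combination b ^ m * h

theorem aux9_zero {S : Type*} [CommRing S] (h2 : (2 : S) = 0) (x x' y y' : S)
    (hx : x * x' = 1) (hy : y * y' = 1) (n k : ℕ)
    (ha : (x + x') ^ (2 ^ n * k) = 0) (hb : (y + y') ^ (2 ^ n * k) = 0) :
    (∑ i ∈ Finset.range k, ((x + x') ^ (2 ^ n)) ^ i * ((y + y') ^ (2 ^ n)) ^ (k - 1 - i)) *
      (x + y) ^ (2 ^ n) * (x * y - 1) ^ (2 ^ n) = 0 := by
  have e : (x + y) * (x * y - 1) = x * y * ((x + x') + (y + y')) := by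
    linear_combination (-y) * hx - x * hy - (x + y) * h2
  rw [mul_assoc, ← mul_pow, e, mul_pow, aux9_two h2 (x + x') (y + y'), mul_left_comm]
  have e2 : (x + x') ^ 2 ^ n + (y + y') ^ 2 ^ n = (x + x') ^ 2 ^ n - (y + y') ^ 2 ^ n := by
    linear_combination (y + y') ^ 2 ^ n * h2
  rw [e2, geom_sum₂_mul, ← pow_mul, ← pow_mul, ha, hb]
  simp

theorem aux9_top {S : Type*} [CommRing S] (h2 : (2 : S) = 0) (x x' y y' : S)
    (hx : x * x' = 1) (hy : y * y' = 1) (n k l : ℕ) (hl : l + 1 = 2 ^ n * k)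
    (ha : (x + x') ^ (l + 1) = 0) (hb : (y + y') ^ (l + 1) = 0) :
    (∑ i ∈ Finset.range k, ((x + x') ^ (2 ^ n)) ^ i * ((y + y') ^ (2 ^ n)) ^ (k - 1 - i)) *
      (x + y) ^ (2 ^ n) * (x * y - 1) ^ (2 ^ n - 1) * ((x + x') ^ l * x) =
    (1 + x * y) * ((x + x') ^ l * (y + y') ^ l) := by
  obtain ⟨q, hq⟩ : ∃ q, 2 ^ n = q + 1 := ⟨2 ^ n - 1, (Nat.sub_add_cancel Nat.one_le_two_pow).symm⟩
  obtain ⟨k, rfl⟩ : ∃ k', k = k' + 1 := by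
    cases k with
    | zero => simp at hl
    | succ k => exact ⟨k, rfl⟩
  rw [hq] at *
  set a := x + x' with haa
  set b := y + y' with hbb
  have e : (x + y) * (x * y - 1) = x * y * (a + b) := by
    linear_combination (-y) * hx - x * hy - (x + y) * h2
  have hx2 : x * x = 1 + a * x := by linear_combination -hx - h2
  have hy2 : y * y = 1 + b * y := by linear_combination -hy - h2
  have hal : a ^ l * a = 0 := by rw [← pow_succ, ha]
  have hbl : b ^ l * b = 0 := by rw [← pow_succ, hb]
  have hsum : a ^ l * (∑ i ∈ Finset.range (k + 1), (a ^ (q + 1)) ^ i *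
      (b ^ (q + 1)) ^ (k + 1 - 1 - i)) = a ^ l * b ^ ((q + 1) * k) := by
    rw [Finset.mul_sum, Finset.sum_range_succ', Finset.sum_eq_zero]
    · simp [pow_mul]
    · intro i _
      have : (a ^ (q + 1)) ^ (i + 1) = a * a ^ ((q + 1) * (i + 1) - 1) := by
        rw [← pow_mul, ← pow_succ', Nat.sub_add_cancel (by nlinarith)]
      rw [this]
      linear_combination (a ^ ((q + 1) * (i + 1) - 1) * (b ^ (q + 1)) ^ (k + 1 - 1 - (i + 1))) * hal
  have hpow : (x + y) ^ (q + 1) * (x * y - 1) ^ (q + 1 - 1) =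
      (x + y) * (x * y) ^ q * (a + b) ^ q := by
    rw [Nat.add_sub_cancel, pow_succ', mul_assoc, ← mul_pow, e, mul_pow, mul_assoc]
  have hk := aux9_kill (a ^ l) a b hal q
  have hl' : l = (q + 1) * k + q := by
    have : (q + 1) * (k + 1) = (q + 1) * k + q + 1 := by ring
    omega
  have hbb2 : b ^ l = b ^ ((q + 1) * k) * b ^ q := by rw [← pow_add, ← hl']
  have hxy : ∀ m : ℕ, (1 + x * y) * (x * y) ^ m * (a ^ l * b ^ l) =
      (1 + x * y) * (a ^ l * b ^ l) := by
    intro m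
    induction m with
    | zero => simp
    | succ m ih =>
      have h1 : a ^ l * b ^ l * ((x * y) * (x * y)) = a ^ l * b ^ l := by
        have : (x * y) * (x * y) = (x * x) * (y * y) := by ring
        rw [this, hx2, hy2]
        linear_combination (x * b ^ l * (1 + b * y)) * hal + y * a ^ l * hbl
      rw [pow_succ]
      linear_combination (x * y) * ih + h1
  calc _ = (a ^ l * (∑ i ∈ Finset.range (k + 1), (a ^ (q + 1)) ^ i *
      (b ^ (q + 1)) ^ (k + 1 - 1 - i))) * ((x + y) ^ (q + 1) * (x * y - 1) ^ (q + 1 - 1)) * x := by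
        ring
    _ = (a ^ l * (a + b) ^ q) * b ^ ((q + 1) * k) * ((x + y) * (x * y) ^ q) * x := by
        rw [hsum, hpow]; ring
    _ = (1 + x * y) * (x * y) ^ q * (a ^ l * b ^ l) := by
        rw [hk, hbb2]
        linear_combination (b ^ ((q + 1) * k) * b ^ q * (x * y) ^ q * a ^ l) * hx2 +
          (b ^ ((q + 1) * k) * b ^ q * (x * y) ^ q * x) * hal
    _ = _ := hxy q

theorem aux9_nc {E : Type*} [Ring E] (h2 : (2 : E) = 0) (x x' y y' : E)
    (hx : x * x' = 1) (hx' : x' * x = 1) (hy : y * y' = 1) (hy' : y' * y = 1)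
    (c1 : x * y = y * x) (c2 : x * y' = y' * x) (c3 : x' * y = y * x') (c4 : x' * y' = y' * x')
    (n k l : ℕ) (hl : l + 1 = 2 ^ n * k)
    (ha : (x + x') ^ (l + 1) = 0) (hb : (y + y') ^ (l + 1) = 0) :
    (∑ i ∈ Finset.range k, ((x + x') ^ (2 ^ n)) ^ i * ((y + y') ^ (2 ^ n)) ^ (k - 1 - i)) *
      (x + y) ^ (2 ^ n) * (x * y - 1) ^ (2 ^ n) = 0 ∧
    (∑ i ∈ Finset.range k, ((x + x') ^ (2 ^ n)) ^ i * ((y + y') ^ (2 ^ n)) ^ (k - 1 - i)) *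
      (x + y) ^ (2 ^ n) * (x * y - 1) ^ (2 ^ n - 1) * ((x + x') ^ l * x) =
    (1 + x * y) * ((x + x') ^ l * (y + y') ^ l) := by
  have hcomm : ∀ a ∈ ({x, x', y, y'} : Set E), ∀ b ∈ ({x, x', y, y'} : Set E), a * b = b * a := by
    simp only [Set.mem_insert_iff, Set.mem_singleton_iff]
    rintro a (rfl | rfl | rfl | rfl) b (rfl | rfl | rfl | rfl) <;> simp_all
  letI : CommRing (Algebra.adjoin ℤ ({x, x', y, y'} : Set E)) :=
    Algebra.adjoinCommRingOfComm ℤ hcomm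
  let X : Algebra.adjoin ℤ ({x, x', y, y'} : Set E) := ⟨x, Algebra.subset_adjoin (by simp)⟩
  let X' : Algebra.adjoin ℤ ({x, x', y, y'} : Set E) := ⟨x', Algebra.subset_adjoin (by simp)⟩
  let Y : Algebra.adjoin ℤ ({x, x', y, y'} : Set E) := ⟨y, Algebra.subset_adjoin (by simp)⟩
  let Y' : Algebra.adjoin ℤ ({x, x', y, y'} : Set E) := ⟨y', Algebra.subset_adjoin (by simp)⟩
  have k2 : (2 : Algebra.adjoin ℤ ({x, x', y, y'} : Set E)) = 0 := Subtype.ext h2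
  have kx : X * X' = 1 := Subtype.ext hx
  have ky : Y * Y' = 1 := Subtype.ext hy
  have ka : (X + X') ^ (l + 1) = 0 := Subtype.ext (by simpa [X, X'] using ha)
  have kb : (Y + Y') ^ (l + 1) = 0 := Subtype.ext (by simpa [Y, Y'] using hb)
  constructor
  · have := congrArg Subtype.val (aux9_zero k2 X X' Y Y' kx ky n k (hl ▸ ka) (hl ▸ kb))
    simpa [X, X', Y, Y'] using this
  · have := congrArg Subtype.val (aux9_top k2 X X' Y Y' kx ky n k l hl ka kb)
    simpa [X, X', Y, Y'] using this

end Aux9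

section Aux9b

variable {K V : Type*} [Field K] [AddCommGroup V] [Module K V]

/-- the relations defining the symmetric square -/
abbrev aux9Rel (K V : Type*) [Field K] [AddCommGroup V] [Module K V] :
    Submodule K (TensorProduct K V V) :=
  Submodule.span K {z : TensorProduct K V V | ∃ x y : V, z = x ⊗ₜ[K] y - y ⊗ₜ[K] x}

theorem aux9_rel_le (f : TensorProduct K V V →ₗ[K] K)
    (hf : ∀ x y, f (x ⊗ₜ y) = f (y ⊗ₜ x)) : ∀ z ∈ aux9Rel K V, f z = 0 := by
  intro z hz
  have : aux9Rel K V ≤ LinearMap.ker f := by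
    rw [Submodule.span_le]
    rintro _ ⟨x, y, rfl⟩
    simp [hf x y]
  exact this hz

/-- left action -/
noncomputable abbrev aux9X (f : Module.End K V) : Module.End K (TensorProduct K V V) :=
  TensorProduct.map f 1

/-- right action -/
noncomputable abbrev aux9Y (f : Module.End K V) : Module.End K (TensorProduct K V V) :=
  TensorProduct.map 1 f

theorem aux9X_mul (f g : Module.End K V) : aux9X (f * g) = aux9X f * aux9X g := by
  ext; simp
theorem aux9Y_mul (f g : Module.End K V) : aux9Y (f * g) = aux9Y f * aux9Y g := by
  ext; simp
theorem aux9XY (f g : Module.End K V) : aux9X f * aux9Y g = aux9Y g * aux9X f := by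
  ext; simp
theorem aux9X_add (f g : Module.End K V) : aux9X (f + g) = aux9X f + aux9X g := by
  ext; simp [TensorProduct.add_tmul]
theorem aux9Y_add (f g : Module.End K V) : aux9Y (f + g) = aux9Y f + aux9Y g := by
  ext; simp [TensorProduct.tmul_add]
theorem aux9X_one : aux9X (1 : Module.End K V) = 1 := by
  ext; simp
theorem aux9Y_one : aux9Y (1 : Module.End K V) = 1 := by
  ext; simp
theorem aux9X_pow (f : Module.End K V) (n : ℕ) : aux9X (f ^ n) = aux9X f ^ n := by
  induction n with
  | zero => simp [aux9X_one]
  | succ n ih => rw [pow_succ, pow_succ, aux9X_mul, ih]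
theorem aux9Y_pow (f : Module.End K V) (n : ℕ) : aux9Y (f ^ n) = aux9Y f ^ n := by
  induction n with
  | zero => simp [aux9Y_one]
  | succ n ih => rw [pow_succ, pow_succ, aux9Y_mul, ih]
theorem aux9X_zero : aux9X (0 : Module.End K V) = 0 := by
  ext; simp
theorem aux9Y_zero : aux9Y (0 : Module.End K V) = 0 := by
  ext; simp

theorem aux9_rel_stable (u : Module.End K V) :
    ∀ z ∈ aux9Rel K V, (aux9X u + aux9Y u) z ∈ aux9Rel K V := by
  intro z hz
  have : aux9Rel K V ≤ (aux9Rel K V).comap (aux9X u + aux9Y u) := by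
    rw [Submodule.span_le]
    rintro _ ⟨x, y, rfl⟩
    have e : (aux9X u + aux9Y u) (x ⊗ₜ[K] y - y ⊗ₜ[K] x) =
      (u x ⊗ₜ[K] y - y ⊗ₜ[K] u x) + (x ⊗ₜ[K] u y - u y ⊗ₜ[K] x) := by
      simp [aux9X, aux9Y]; abel
    show (aux9X u + aux9Y u) (x ⊗ₜ[K] y - y ⊗ₜ[K] x) ∈ aux9Rel K V
    rw [e]
    exact add_mem (Submodule.subset_span ⟨_, _, rfl⟩) (Submodule.subset_span ⟨_, _, rfl⟩)
  exact this hz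

/-- alternating, invariant, and killing the `m`-th kernel -/
def aux9Good (u : Module.End K V) (m : ℕ) (B : V →ₗ[K] V →ₗ[K] K) : Prop :=
  (∀ f, B f f = 0) ∧ (∀ f g, B (u f) (u g) = B f g) ∧
    ∀ z, ((aux9X u * aux9Y u - 1) ^ m) z ∈ aux9Rel K V → TensorProduct.lift B z = 0

theorem aux9_symm (h2 : (2 : K) = 0) (B : V →ₗ[K] V →ₗ[K] K) (hB : ∀ f, B f f = 0) (f g : V) :
    B f g = B g f := by
  have := hB (f + g)
  simp only [map_add, LinearMap.add_apply, hB] at this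
  linear_combination this - B g f * h2

theorem aux9_adj (u w : Module.End K V) (huw : u * w = 1) (B : V →ₗ[K] V →ₗ[K] K)
    (hB : ∀ f g, B (u f) (u g) = B f g) (f g : V) : B (w f) g = B f (u g) := by
  rw [← hB (w f) g, ← Module.End.mul_apply, huw, Module.End.one_apply]

theorem aux9_twist_alt (h2 : (2 : K) = 0) (u w : Module.End K V) (huw : u * w = 1)
    (B : V →ₗ[K] V →ₗ[K] K)
    (hA : ∀ f, B f f = 0) (hB : ∀ f g, B (u f) (u g) = B f g) (f : V) : B ((u + w) f) f = 0 := by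
  rw [LinearMap.add_apply, map_add, LinearMap.add_apply, aux9_adj u w huw B hB,
    aux9_symm h2 B hA f (u f)]
  linear_combination B (u f) f * h2

theorem aux9Good_twist (h2 : (2 : K) = 0) (u w : Module.End K V) (huw : u * w = 1)
    (hwu : w * u = 1) (m : ℕ)
    (B : V →ₗ[K] V →ₗ[K] K) (h : aux9Good u m B) : aux9Good u m (B.comp (u + w)) := by
  obtain ⟨hA, hB, hz⟩ := h
  refine ⟨fun f => aux9_twist_alt h2 u w huw B hA hB f, ?_, ?_⟩
  · intro f g
    have : (u + w) (u f) = u ((u + w) f) := by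
      rw [← Module.End.mul_apply, ← Module.End.mul_apply, add_mul, mul_add, huw, hwu]
    rw [LinearMap.comp_apply, this, hB, LinearMap.comp_apply]
  · intro z h
    have e : TensorProduct.lift (B.comp (u + w)) =
        (TensorProduct.lift B).comp (aux9X u + aux9Y u) := by
      ext f g
      simp [aux9_adj u w huw B hB]
    rw [e, LinearMap.comp_apply]
    apply hz
    have hc : Commute (aux9X u + aux9Y u) ((aux9X u * aux9Y u - 1) ^ m) := by
      apply Commute.pow_right
      apply Commute.sub_right _ (Commute.one_right _)
      have c : Commute (aux9X u) (aux9Y u) := aux9XY u u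
      exact ((Commute.refl _).mul_right c).add_left (c.symm.mul_right (Commute.refl _))
    rw [← Module.End.mul_apply, ← hc.eq, Module.End.mul_apply]
    exact aux9_rel_stable u _ h

theorem aux9Good_twist_pow (h2 : (2 : K) = 0) (u w : Module.End K V) (huw : u * w = 1)
    (hwu : w * u = 1) (m : ℕ)
    (B : V →ₗ[K] V →ₗ[K] K) (h : aux9Good u m B) (j : ℕ) :
    aux9Good u m (B.comp ((u + w) ^ j)) := by
  induction j with
  | zero => exact h
  | succ j ih =>
    rw [pow_succ]
    exact aux9Good_twist h2 u w huw hwu m _ ih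

theorem aux9_vanish (h2 : (2 : K) = 0) (u w : Module.End K V) (huw : u * w = 1) (hwu : w * u = 1)
    (v : V)
    (hcyc : ∀ M : Submodule K V, v ∈ M → (∀ m ∈ M, u m ∈ M) → M = ⊤)
    (B : V →ₗ[K] V →ₗ[K] K)
    (hA : ∀ f, B f f = 0) (hB : ∀ f g, B (u f) (u g) = B f g)
    (hT : ∀ i, B (((u + w) ^ i) v) v = 0)
    (h0 : ∀ i, B (((u + w) ^ i) (u v)) v = 0) : B = 0 := by
  have hspan : Submodule.span K (Set.range (fun i : ℕ => ((u + w) ^ i) v) ∪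
      Set.range (fun i : ℕ => ((u + w) ^ i) (u v))) = ⊤ := by
    apply hcyc
    · exact Submodule.subset_span (Or.inl ⟨0, rfl⟩)
    · intro m hm
      have hc : Commute u (u + w) := by
        show u * (u + w) = (u + w) * u
        rw [add_mul, mul_add, huw, hwu]
      have key : ∀ (i : ℕ) (x : V), u (((u + w) ^ i) x) = ((u + w) ^ i) (u x) := by
        intro i x
        rw [← Module.End.mul_apply, (hc.pow_right i).eq, Module.End.mul_apply]
      induction hm using Submodule.span_induction with
      | zero => simp
      | add x y _ _ hx hy => rw [map_add]; exact add_mem hx hy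
      | smul a x _ hx => rw [map_smul]; exact Submodule.smul_mem _ _ hx
      | mem x hx =>
        rcases hx with ⟨i, rfl⟩ | ⟨i, rfl⟩
        · exact Submodule.subset_span (Or.inr ⟨i, (key i v).symm⟩)
        · show u (((u + w) ^ i) (u v)) ∈ _
          have e : u (((u + w) ^ i) (u v)) = ((u + w) ^ (i + 1)) (u v) - ((u + w) ^ i) v := by
            rw [key, pow_succ, Module.End.mul_apply, ← map_sub]
            congr 1
            rw [LinearMap.add_apply, ← Module.End.mul_apply w u, hwu]
            simp
          rw [e]
          exact sub_mem (Submodule.subset_span (Or.inr ⟨_, rfl⟩))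
            (Submodule.subset_span (Or.inl ⟨_, rfl⟩))
  have h1 : ∀ f, B f v = 0 := by
    intro f
    have hf : f ∈ (⊤ : Submodule K V) := trivial
    rw [← hspan] at hf
    induction hf using Submodule.span_induction with
    | zero => simp
    | add x y _ _ hx hy => simp [hx, hy]
    | smul a x _ hx => simp [hx]
    | mem x hx =>
      rcases hx with ⟨i, rfl⟩ | ⟨i, rfl⟩
      · exact hT i
      · exact h0 i
  have h3 := hcyc (LinearMap.ker B.flip) (by ext f; simpa using h1 f) (by
    intro g hg
    ext f
    have := LinearMap.congr_fun (LinearMap.mem_ker.1 hg) (w f)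
    simp only [LinearMap.flip_apply, LinearMap.zero_apply] at this ⊢
    rw [← aux9_adj u w huw B hB, this])
  ext f g
  have : g ∈ LinearMap.ker B.flip := h3 ▸ trivial
  exact LinearMap.congr_fun (LinearMap.mem_ker.1 this) f

theorem aux9_T (h2 : (2 : K) = 0) (u w : Module.End K V) (huw : u * w = 1) (hwu : w * u = 1)
    (B : V →ₗ[K] V →ₗ[K] K)
    (hA : ∀ f, B f f = 0) (hB : ∀ f g, B (u f) (u g) = B f g) (i : ℕ) :
    ∀ v, B (((u + w) ^ i) v) v = 0 := by
  -- alternating twist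
  have : (∀ f, B.comp ((u + w) ^ i) f f = 0) ∧
      (∀ f g, B.comp ((u + w) ^ i) (u f) (u g) = B.comp ((u + w) ^ i) f g) := by
    induction i with
    | zero => exact ⟨hA, hB⟩
    | succ i ih =>
      rw [pow_succ]
      refine ⟨fun f => aux9_twist_alt h2 u w huw _ ih.1 ih.2 f, ?_⟩
      intro f g
      have e : (u + w) (u f) = u ((u + w) f) := by
        rw [← Module.End.mul_apply, ← Module.End.mul_apply, add_mul, mul_add, huw, hwu]
      have := ih.2 ((u + w) f) g
      rw [LinearMap.comp_apply, Module.End.mul_apply, e]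
      exact this
  exact this.1

theorem aux9_all (h2 : (2 : K) = 0) (u w : Module.End K V) (huw : u * w = 1) (hwu : w * u = 1)
    (v : V) (hcyc : ∀ M : Submodule K V, v ∈ M → (∀ m ∈ M, u m ∈ M) → M = ⊤)
    (m l : ℕ) (ht : (u + w) ^ (l + 1) = 0)
    (P : V →ₗ[K] V →ₗ[K] K) (hP : aux9Good u m P) (hPl : P (((u + w) ^ l) (u v)) v ≠ 0)
    (j : ℕ) (hj : j ≤ l + 1) : ∀ (B : V →ₗ[K] V →ₗ[K] K)
    (_ : ∀ f, B f f = 0) (_ : ∀ f g, B (u f) (u g) = B f g)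
    (_ : ∀ i, j ≤ i → B (((u + w) ^ i) (u v)) v = 0), aux9Good u m B := by
  induction j with
  | zero =>
    intro B hA hB h
    have : B = 0 := aux9_vanish h2 u w huw hwu v hcyc B hA hB
      (fun i => aux9_T h2 u w huw hwu B hA hB i v) (fun i => h i (Nat.zero_le _))
    subst this
    refine ⟨by simp, by simp, ?_⟩
    intro z _
    rw [show TensorProduct.lift (0 : V →ₗ[K] V →ₗ[K] K) = 0 by ext; simp]
    simp
  | succ j ih =>
    intro B hA hB h
    have hG := aux9Good_twist_pow h2 u w huw hwu m P hP (l - j)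
    set Q := P.comp ((u + w) ^ (l - j)) with hQ
    set c := B (((u + w) ^ j) (u v)) v / P (((u + w) ^ l) (u v)) v with hc
    have hQi : ∀ i, Q (((u + w) ^ i) (u v)) v = P (((u + w) ^ (l - j + i)) (u v)) v := by
      intro i
      rw [hQ, LinearMap.comp_apply, ← Module.End.mul_apply, ← pow_add]
    have := ih (by omega) (B - c • Q) (by intro f; simp [hA, hG.1])
      (by intro f g; simp [hB, hG.2.1]) (by
        intro i hi
        rcases Nat.eq_or_lt_of_le hi with rfl | hi
        · simp only [LinearMap.sub_apply, LinearMap.smul_apply, hQi]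
          rw [Nat.sub_add_cancel (by omega), hc, smul_eq_mul, div_mul_cancel₀ _ hPl, sub_self]
        · simp only [LinearMap.sub_apply, LinearMap.smul_apply, hQi]
          rw [h i hi, show l - j + i = (l + 1) + (i - j - 1) by omega, pow_add, ht]
          simp)
    refine ⟨hA, hB, fun z hz => ?_⟩
    have h1 := this.2.2 z hz
    have h3 := hG.2.2 z hz
    have e : TensorProduct.lift (B - c • Q) = TensorProduct.lift B - c • TensorProduct.lift Q := by
      ext; simp
    rw [e, LinearMap.sub_apply, LinearMap.smul_apply, h3] at h1
    simpa using h1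

end Aux9b

section Aux9c

variable {K V : Type*} [Field K] [AddCommGroup V] [Module K V]

theorem aux9_two_nc {S : Type*} [Ring S] (h2 : (2 : S) = 0) (a b : S) (hab : a * b = b * a)
    (n : ℕ) : (a + b) ^ (2 ^ n) = a ^ (2 ^ n) + b ^ (2 ^ n) := by
  induction n with
  | zero => simp
  | succ n ih =>
    have hc : Commute (a ^ 2 ^ n) (b ^ 2 ^ n) := Commute.pow_pow hab _ _
    rw [pow_succ, pow_mul, ih, pow_mul, pow_mul, sq, sq, sq, add_mul, mul_add, mul_add, ← hc.eq]
    have : a ^ 2 ^ n * b ^ 2 ^ n + a ^ 2 ^ n * b ^ 2 ^ n = 0 := by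
      rw [← two_mul, h2, zero_mul]
    calc _ = a ^ 2 ^ n * a ^ 2 ^ n + (a ^ 2 ^ n * b ^ 2 ^ n + a ^ 2 ^ n * b ^ 2 ^ n)
        + b ^ 2 ^ n * b ^ 2 ^ n := by abel
      _ = _ := by rw [this, add_zero]

theorem aux9_end2 (h2 : (2 : K) = 0) (W : Type*) [AddCommGroup W] [Module K W] :
    (2 : Module.End K W) = 0 := by
  ext x
  have : (2 : Module.End K W) x = (2 : K) • x := by
    rw [← one_add_one_eq_two, ← one_add_one_eq_two, add_smul]; simp
  rw [this, h2]; simp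

/-- rank one symmetric functional -/
noncomputable def aux9Del (lam : V →ₗ[K] K) : TensorProduct K V V →ₗ[K] K :=
  TensorProduct.lift ((LinearMap.mul K K).compl₁₂ lam lam)

theorem aux9Del_tmul (lam : V →ₗ[K] K) (f g : V) : aux9Del lam (f ⊗ₜ g) = lam f * lam g := by
  simp [aux9Del]

/-- the element `D` -/
noncomputable def aux9D (t : Module.End K V) (q k : ℕ) : Module.End K (TensorProduct K V V) :=
  ∑ i ∈ Finset.range k, (aux9X t ^ q) ^ i * (aux9Y t ^ q) ^ (k - 1 - i)

theorem aux9D_tmul (t : Module.End K V) (q k : ℕ) (f g : V) :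
    aux9D t q k (f ⊗ₜ g) = ∑ i ∈ Finset.range k,
      ((t ^ (q * i)) f) ⊗ₜ[K] ((t ^ (q * (k - 1 - i))) g) := by
  rw [aux9D, LinearMap.sum_apply]
  refine Finset.sum_congr rfl fun i _ => ?_
  rw [← pow_mul, ← pow_mul, ← aux9X_pow, ← aux9Y_pow]
  simp

theorem aux9_DelD (lam : V →ₗ[K] K) (t : Module.End K V) (q k : ℕ) (f g : V) :
    aux9Del lam (aux9D t q k (f ⊗ₜ g)) = aux9Del lam (aux9D t q k (g ⊗ₜ f)) := by
  rw [aux9D_tmul, aux9D_tmul, map_sum, map_sum,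
    ← Finset.sum_range_reflect _ k]
  refine Finset.sum_congr rfl fun i hi => ?_
  have := Finset.mem_range.1 hi
  rw [aux9Del_tmul, aux9Del_tmul, mul_comm, show k - 1 - (k - 1 - i) = i by omega]

theorem aux9_c_tmul (h2 : (2 : K) = 0) (lam : V →ₗ[K] K) (u t : Module.End K V) (n k : ℕ)
    (f g : V) :
    aux9Del lam ((aux9D t (2 ^ n) k * (aux9X u + aux9Y u) ^ (2 ^ n)) (f ⊗ₜ g)) =
      aux9Del lam (aux9D t (2 ^ n) k ((u ^ 2 ^ n) f ⊗ₜ g)) +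
      aux9Del lam (aux9D t (2 ^ n) k (f ⊗ₜ (u ^ 2 ^ n) g)) := by
  rw [aux9_two_nc (aux9_end2 h2 _) _ _ (aux9XY u u), ← aux9X_pow, ← aux9Y_pow]
  simp

theorem aux9_alt_pow (u : Module.End K V) (m : ℕ) (c : TensorProduct K V V →ₗ[K] K)
    (hc : ∀ f, c (f ⊗ₜ f) = 0) : ∀ f, c (((aux9X u * aux9Y u - 1) ^ m) (f ⊗ₜ f)) = 0 := by
  induction m generalizing c with
  | zero => simpa using hc
  | succ m ih =>
    intro f
    rw [pow_succ']
    exact ih (c.comp (aux9X u * aux9Y u - 1)) (by intro f; simp [hc]) f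

theorem aux9_exP (h2 : (2 : K) = 0) (u w : Module.End K V) (huw : u * w = 1) (hwu : w * u = 1)
    (v : V) (n k l : ℕ) (hl : l + 1 = 2 ^ n * k) (ht : (u + w) ^ (l + 1) = 0)
    (lam : V →ₗ[K] K) (hlam : lam (((u + w) ^ l) v) + lam (u (((u + w) ^ l) v)) ≠ 0) :
    ∃ P : V →ₗ[K] V →ₗ[K] K, aux9Good u (2 ^ n - 1) P ∧ P (((u + w) ^ l) (u v)) v ≠ 0 := by
  obtain ⟨r1, r2⟩ := aux9_nc (aux9_end2 h2 (TensorProduct K V V)) (aux9X u) (aux9X w) (aux9Y u)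
    (aux9Y w) (by rw [← aux9X_mul, huw, aux9X_one]) (by rw [← aux9X_mul, hwu, aux9X_one])
    (by rw [← aux9Y_mul, huw, aux9Y_one]) (by rw [← aux9Y_mul, hwu, aux9Y_one])
    (aux9XY _ _) (aux9XY _ _) (aux9XY _ _) (aux9XY _ _) n k l hl
    (by rw [← aux9X_add, ← aux9X_pow, ht, aux9X_zero])
    (by rw [← aux9Y_add, ← aux9Y_pow, ht, aux9Y_zero])
  rw [← aux9X_add, ← aux9Y_add] at r1 r2
  change aux9D (u + w) (2 ^ n) k * _ * _ = 0 at r1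
  change aux9D (u + w) (2 ^ n) k * _ * _ * _ = _ at r2
  set c : TensorProduct K V V →ₗ[K] K :=
    (aux9Del lam).comp (aux9D (u + w) (2 ^ n) k * (aux9X u + aux9Y u) ^ (2 ^ n)) with hc
  have hcs : ∀ f g, c (f ⊗ₜ g) = c (g ⊗ₜ f) := by
    intro f g
    rw [hc, LinearMap.comp_apply, LinearMap.comp_apply, aux9_c_tmul h2, aux9_c_tmul h2,
      aux9_DelD _ _ _ _ _ g, aux9_DelD _ _ _ _ f _, add_comm]
  have hca : ∀ f, c (f ⊗ₜ f) = 0 := by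
    intro f
    rw [hc, LinearMap.comp_apply, aux9_c_tmul h2, aux9_DelD _ _ _ _ _ f, ← two_mul, h2, zero_mul]
  refine ⟨TensorProduct.curry (c.comp ((aux9X u * aux9Y u - 1) ^ (2 ^ n - 1))), ⟨?_, ?_, ?_⟩, ?_⟩
  · intro f
    exact aux9_alt_pow u _ c hca f
  · intro f g
    rw [TensorProduct.curry_apply, TensorProduct.curry_apply]
    have e : u f ⊗ₜ[K] u g = (aux9X u * aux9Y u - 1) (f ⊗ₜ g) + f ⊗ₜ g := by simp
    rw [e, map_add, add_eq_right, LinearMap.comp_apply, ← Module.End.mul_apply, ← pow_succ,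
      Nat.sub_add_cancel Nat.one_le_two_pow, hc, LinearMap.comp_apply, ← Module.End.mul_apply, r1]
    simp
  · intro z hz
    rw [show TensorProduct.lift (TensorProduct.curry
      (c.comp ((aux9X u * aux9Y u - 1) ^ (2 ^ n - 1)))) =
      (c.comp ((aux9X u * aux9Y u - 1) ^ (2 ^ n - 1))) by ext; simp]
    exact aux9_rel_le c hcs _ hz
  · rw [TensorProduct.curry_apply]
    have e : ((u + w) ^ l) (u v) ⊗ₜ[K] v = (aux9X (u + w) ^ l * aux9X u) (v ⊗ₜ v) := by
      rw [← aux9X_pow]; simp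
    rw [e, hc, LinearMap.comp_apply, LinearMap.comp_apply, ← Module.End.mul_apply,
      ← Module.End.mul_apply, r2, ← aux9X_pow, ← aux9Y_pow]
    have e2 : aux9Del lam (((1 + aux9X u * aux9Y u) * (aux9X ((u + w) ^ l) *
        aux9Y ((u + w) ^ l))) (v ⊗ₜ[K] v)) =
        (lam (((u + w) ^ l) v) + lam (u (((u + w) ^ l) v))) ^ 2 := by
      simp only [Module.End.mul_apply, LinearMap.add_apply, Module.End.one_apply,
        TensorProduct.map_tmul, map_add, aux9Del_tmul]
      linear_combination -(lam (((u + w) ^ l) v) * lam (u (((u + w) ^ l) v))) * h2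
    rw [e2]
    exact pow_ne_zero 2 hlam

end Aux9c

section Aux9d

variable {K V : Type*} [Field K] [AddCommGroup V] [Module K V]

theorem aux9_mul_comm (x y : V) : (SymSq.mul x y : SymSq K V) = SymSq.mul y x := by
  rw [SymSq.mul, SymSq.mul, Submodule.Quotient.eq]
  exact Submodule.subset_span ⟨x, y, rfl⟩

theorem aux9_mul_add (x y z : V) :
    (SymSq.mul (x + y) z : SymSq K V) = SymSq.mul x z + SymSq.mul y z := by
  rw [SymSq.mul, TensorProduct.add_tmul]; rfl

theorem aux9_mul_zero (z : V) : (SymSq.mul 0 z : SymSq K V) = 0 := by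
  rw [SymSq.mul, TensorProduct.zero_tmul]; rfl

theorem aux9_pow_form (h2 : (2 : K) = 0) (u w : Module.End K V) (hwu : w * u = 1)
    (huw : u * w = 1) (n : ℕ) :
    u ^ 2 ^ n * u ^ 2 ^ n = 1 + (u + w) ^ 2 ^ n * u ^ 2 ^ n := by
  have hc : Commute u w := by show u * w = w * u; rw [huw, hwu]
  rw [aux9_two_nc (aux9_end2 h2 V) u w hc.eq, add_mul, ← (hc.symm.mul_pow), hwu, one_pow]
  have : (1 : Module.End K V) + 1 = 0 := by rw [one_add_one_eq_two, aux9_end2 h2 V]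
  rw [add_comm, add_assoc, this, add_zero]

theorem aux9_uq (h2 : (2 : K) = 0) (u w : Module.End K V) (huw : u * w = 1) (hwu : w * u = 1)
    (v : V) (b : V →ₗ[K] V →ₗ[K] K)
    (halt : ∀ v : V, b v v = 0)
    (hSp : ∀ v w : V, b (u v) (u w) = b v w) (n : ℕ) : ∀ j : ℕ,
    b (((u + w) ^ j) ((u ^ 2 ^ n) v)) v = b (((u + w) ^ (j + (2 ^ n - 1))) (u v)) v := by
  induction n with
  | zero => simp
  | succ n ih =>
    intro j
    have h1 : 1 ≤ 2 ^ n := Nat.one_le_two_pow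
    rw [pow_succ 2 n, mul_two, pow_add, aux9_pow_form h2 u w hwu huw, LinearMap.add_apply, map_add,
      map_add, LinearMap.add_apply, Module.End.one_apply, aux9_T h2 u w huw hwu b halt hSp,
      zero_add, Module.End.mul_apply, ← Module.End.mul_apply _ ((u + w) ^ 2 ^ n), ← pow_add, ih]
    congr 4
    omega

/-- second half -/
theorem aux9_part2 (h2 : (2 : K) = 0) (u w : Module.End K V) (huw : u * w = 1) (hwu : w * u = 1)
    (v : V) (n k l : ℕ) (hk : Odd k) (hl : l + 1 = 2 ^ n * k) (ht : (u + w) ^ (l + 1) = 0)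
    (b : V →ₗ[K] V →ₗ[K] K)
    (halt : ∀ v : V, b v v = 0)
    (hSp : ∀ v w : V, b (u v) (u w) = b v w)
    (hb : b (((u + w) ^ l) (u v)) v ≠ 0)
    (ut : Module.End K (SymSq K V))
    (hut : ∀ x y : V, ut (SymSq.mul x y) = SymSq.mul (u x) (u y))
    (φ : SymSq K V →ₗ[K] K)
    (hφ : ∀ x y : V, φ (SymSq.mul x y) = b x y) :
    ∃ z : SymSq K V, ((ut - 1 : Module.End K (SymSq K V)) ^ (2 ^ n)) z = 0 ∧ φ z ≠ 0 := by
  set t := u + w with htt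
  set q := 2 ^ n with hq
  have h1 : 1 ≤ q := Nat.one_le_two_pow
  have hc : Commute u t := by
    show u * t = t * u
    rw [htt, add_mul, mul_add, huw, hwu]
  have key : ∀ (i j : ℕ) (x : V), (u ^ j) ((t ^ i) x) = (t ^ i) ((u ^ j) x) := by
    intro i j x
    rw [← Module.End.mul_apply, (hc.pow_pow j i).eq, Module.End.mul_apply]
  have hutq : ∀ (m : ℕ) (x y : V), (ut ^ m) (SymSq.mul x y) = SymSq.mul ((u ^ m) x) ((u ^ m) y) := by
    intro m
    induction m with
    | zero => intro x y; rfl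
    | succ m ih =>
      intro x y
      rw [pow_succ, pow_succ, Module.End.mul_apply, hut, ih]; rfl
  have htadj : ∀ (i : ℕ) (x y : V), b x ((t ^ i) y) = b ((t ^ i) x) y := by
    intro i
    induction i with
    | zero => intro x y; rfl
    | succ i ih =>
      intro x y
      have e : ∀ x y : V, b x (t y) = b (t x) y := by
        intro x y
        have h3 := aux9_adj u w huw b hSp
        rw [htt, LinearMap.add_apply, LinearMap.add_apply, map_add, map_add, LinearMap.add_apply,
          h3 x y, aux9_symm h2 b halt x (w y), h3 y x, aux9_symm h2 b halt y (u x), add_comm]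
      rw [pow_succ, Module.End.mul_apply, Module.End.mul_apply, ih, e, ← Module.End.mul_apply,
        ← Module.End.mul_apply, ← pow_succ', ← pow_succ]
  have s2 : ∀ s : SymSq K V, s + s = 0 := by
    intro s
    rw [← two_smul K s, h2, zero_smul]
  refine ⟨∑ i ∈ Finset.range k, SymSq.mul ((t ^ (q * i)) ((u ^ q) v)) ((t ^ (q * (k - 1 - i))) v),
    ?_, ?_⟩
  · have e1 : (ut - 1) ^ q = ut ^ q + 1 := by
      have := aux9_two_nc (aux9_end2 h2 (SymSq K V)) ut 1 (by simp) n
      rw [one_pow] at this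
      rw [← this, sub_eq_add_neg]
      congr 2
      rw [neg_eq_iff_add_eq_zero, one_add_one_eq_two]
      exact aux9_end2 h2 _
    rw [e1, LinearMap.add_apply, Module.End.one_apply, map_sum]
    have e2 : ∀ i ∈ Finset.range k, (ut ^ q) (SymSq.mul ((t ^ (q * i)) ((u ^ q) v))
        ((t ^ (q * (k - 1 - i))) v)) =
        (SymSq.mul ((t ^ (q * i)) v) ((t ^ (q * (k - 1 - i))) ((u ^ q) v)) : SymSq K V) +
        SymSq.mul ((t ^ (q * (i + 1))) ((u ^ q) v)) ((t ^ (q * (k - 1 - i))) ((u ^ q) v)) := by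
      intro i _
      rw [hutq, key, key, ← Module.End.mul_apply (u ^ q), aux9_pow_form h2 u w hwu huw,
        LinearMap.add_apply, map_add, aux9_mul_add, Module.End.one_apply, Module.End.mul_apply,
        ← Module.End.mul_apply (t ^ (q * i)), ← htt, ← hq, ← pow_add, ← mul_add_one]
    rw [Finset.sum_congr rfl e2, Finset.sum_add_distrib]
    have e3 : ∑ i ∈ Finset.range k, (SymSq.mul ((t ^ (q * i)) v)
        ((t ^ (q * (k - 1 - i))) ((u ^ q) v)) : SymSq K V) =
        ∑ i ∈ Finset.range k, SymSq.mul ((t ^ (q * i)) ((u ^ q) v)) ((t ^ (q * (k - 1 - i))) v) := by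
      rw [← Finset.sum_range_reflect _ k]
      refine Finset.sum_congr rfl fun i hi => ?_
      have := Finset.mem_range.1 hi
      rw [aux9_mul_comm, show k - 1 - (k - 1 - i) = i by omega]
    have e4 : ∑ i ∈ Finset.range k, (SymSq.mul ((t ^ (q * (i + 1))) ((u ^ q) v))
        ((t ^ (q * (k - 1 - i))) ((u ^ q) v)) : SymSq K V) = 0 := by
      obtain ⟨m, rfl⟩ := hk
      rw [Finset.sum_range_succ, ← hl, ht, LinearMap.zero_apply, aux9_mul_zero, add_zero]
      refine Finset.sum_involution (fun i _ => 2 * m - 1 - i) ?_ ?_ ?_ ?_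
      · intro i hi
        have := Finset.mem_range.1 hi
        rw [aux9_mul_comm, show 2 * m + 1 - 1 - i = 2 * m - 1 - i + 1 by omega,
          show 2 * m + 1 - 1 - (2 * m - 1 - i) = i + 1 by omega]
        exact s2 _
      · intro i hi _ h
        have := Finset.mem_range.1 hi
        omega
      · intro i hi
        have := Finset.mem_range.1 hi
        exact Finset.mem_range.2 (by omega)
      · intro i hi
        have := Finset.mem_range.1 hi
        show 2 * m - 1 - (2 * m - 1 - i) = i
        omega
    rw [e3, e4, add_zero]
    exact s2 _
  · rw [map_sum]
    have hk1 : 1 ≤ k := hk.pos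
    have hkk : q * k = q * (k - 1) + q := by
      conv_lhs => rw [← Nat.sub_add_cancel hk1]
      ring
    have e5 : ∀ i ∈ Finset.range k, φ (SymSq.mul ((t ^ (q * i)) ((u ^ q) v))
        ((t ^ (q * (k - 1 - i))) v)) = b ((t ^ l) (u v)) v := by
      intro i hi
      have := Finset.mem_range.1 hi
      rw [hφ, htadj, ← Module.End.mul_apply, ← pow_add, ← mul_add,
        show k - 1 - i + i = k - 1 by omega, aux9_uq h2 u w huw hwu v b halt hSp]
      congr 4
      omega
    rw [Finset.sum_congr rfl e5, Finset.sum_const, Finset.card_range]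
    obtain ⟨m, rfl⟩ := hk
    have : (2 * m + 1) • b ((t ^ l) (u v)) v = b ((t ^ l) (u v)) v := by
      rw [nsmul_eq_mul]
      push_cast
      linear_combination (m * b ((t ^ l) (u v)) v) * h2
    rw [this]
    exact hb

end Aux9d

section Aux9e

variable {K V : Type*} [Field K] [AddCommGroup V] [Module K V]

theorem aux9_cyc [FiniteDimensional K V] (d : ℕ) (hdim : Module.finrank K V = d + 1)
    (u : Module.End K V) (hu2 : (u - 1) ^ (d + 1) = 0) (v : V) (hv : ((u - 1) ^ d) v ≠ 0) :
    ∀ M : Submodule K V, v ∈ M → (∀ m ∈ M, u m ∈ M) → M = ⊤ := by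
  intro M hvM hM
  have hli : LinearIndependent K (fun i : Fin (d + 1) => ((u - 1) ^ (i : ℕ)) v) := by
    rw [Fintype.linearIndependent_iff]
    intro g hg
    by_contra! hne
    obtain ⟨i0, hi0⟩ := hne
    -- minimal index
    obtain ⟨i, hi, hmin⟩ := WellFounded.has_min (wellFounded_lt (α := Fin (d + 1)))
      {i | g i ≠ 0} ⟨i0, hi0⟩
    have h := congrArg (fun x => ((u - 1) ^ (d - (i : ℕ))) x) hg
    rw [map_sum, map_zero, Finset.sum_eq_single i] at h
    · rw [map_smul, ← Module.End.mul_apply, ← pow_add, Nat.sub_add_cancel (by omega)] at h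
      exact (smul_ne_zero hi hv) h
    · intro j _ hj
      by_cases hji : j < i
      · have : g j = 0 := by
          by_contra h0
          exact hmin j h0 hji
        rw [this, zero_smul, map_zero]
      · have : (i : ℕ) < j := by
          have : (i : ℕ) ≠ j := fun h => hj (Fin.ext h.symm)
          have : ¬ (j : ℕ) < i := hji
          omega
        rw [map_smul, ← Module.End.mul_apply, ← pow_add,
          show d - i + j = (d + 1) + (j - i - 1) by omega, pow_add, hu2]
        simp
    · simp
  have hmem : ∀ i : ℕ, ((u - 1) ^ i) v ∈ M := by
    intro i
    induction i with
    | zero => exact hvM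
    | succ i ih =>
      rw [pow_succ', Module.End.mul_apply, LinearMap.sub_apply]
      exact sub_mem (hM _ ih) ih
  have hsp := hli.span_eq_top_of_card_eq_finrank' (by simp [hdim])
  rw [eq_top_iff, ← hsp, Submodule.span_le]
  rintro _ ⟨i, rfl⟩
  exact hmem i

end Aux9e

/-- Lemma: for unipotent `u ∈ Sp(V)` with `V ↓ K[u] = V(2ℓ)` (a single Jordan block of size
`2ℓ`), with `α = ν₂(ℓ)`: `ker(ũ - 1)^(2^α - 1) ⊆ ker φ` and `ker(ũ - 1)^(2^α) ⊄ ker φ`. -/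
theorem stmt9 (K : Type*) [Field K] [IsAlgClosed K] [CharP K 2]
    (V : Type*) [AddCommGroup V] [Module K V] [FiniteDimensional K V]
    (ℓ : ℕ) (hl : 1 ≤ ℓ) (hdim : Module.finrank K V = 2 * ℓ)
    (b : V →ₗ[K] V →ₗ[K] K)
    (halt : ∀ v : V, b v v = 0)
    (hnd : ∀ v : V, (∀ w : V, b v w = 0) → v = 0)
    (u : Module.End K V)
    (hSp : ∀ v w : V, b (u v) (u w) = b v w)
    (hu1 : (u - 1) ^ (2 * ℓ - 1) ≠ 0) (hu2 : (u - 1) ^ (2 * ℓ) = 0)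
    (ut : Module.End K (SymSq K V))
    (hut : ∀ x y : V, ut (SymSq.mul x y) = SymSq.mul (u x) (u y))
    (φ : SymSq K V →ₗ[K] K)
    (hφ : ∀ x y : V, φ (SymSq.mul x y) = b x y) :
    LinearMap.ker ((ut - 1) ^ (2 ^ padicValNat 2 ℓ - 1)) ≤ LinearMap.ker φ ∧
      ¬ LinearMap.ker ((ut - 1) ^ (2 ^ padicValNat 2 ℓ)) ≤ LinearMap.ker φ := by
  have h2 : (2 : K) = 0 := by exact_mod_cast CharP.cast_eq_zero K 2
  obtain ⟨k, hk2, hlk⟩ : ∃ k, ¬ 2 ∣ k ∧ ℓ = 2 ^ padicValNat 2 ℓ * k := by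
    obtain ⟨k, hk⟩ := pow_padicValNat_dvd (p := 2) (n := ℓ)
    refine ⟨k, ?_, hk⟩
    rintro ⟨m, rfl⟩
    apply pow_succ_padicValNat_not_dvd (p := 2) (n := ℓ) (by omega)
    exact ⟨m, by rw [pow_succ, mul_assoc, ← hk]⟩
  have hkodd : Odd k := by
    rw [← Nat.not_even_iff_odd, even_iff_two_dvd]; exact hk2
  generalize padicValNat 2 ℓ = n at *
  obtain ⟨l, rfl⟩ : ∃ l, ℓ = l + 1 := ⟨ℓ - 1, by omega⟩
  have hinj : Function.Injective u := by
    rw [← LinearMap.ker_eq_bot, LinearMap.ker_eq_bot']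
    intro m hm
    apply hnd
    intro x
    rw [← hSp, hm]; simp
  obtain ⟨w, hwu⟩ : ∃ w : Module.End K V, w * u = 1 :=
    LinearMap.exists_leftInverse_of_injective u (LinearMap.ker_eq_bot.2 hinj)
  have huw : u * w = 1 := mul_eq_one_comm.1 hwu
  have hc : Commute u w := by show u * w = w * u; rw [huw, hwu]
  have e2 := aux9_end2 h2 V
  have e2' : (1 : Module.End K V) + 1 = 0 := by rw [one_add_one_eq_two, e2]
  have hneg : u - 1 = u + 1 := by
    rw [sub_eq_iff_eq_add, add_assoc, e2', add_zero]
  have htw : u + w = w * (u - 1) ^ 2 := by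
    rw [hneg, sq, mul_add, add_mul, mul_one, one_mul,
      show u * u + u + (u + 1) = u * u + ((1 + 1) * u) + 1 by noncomm_ring, e2', zero_mul, add_zero,
      mul_add, ← mul_assoc, hwu, one_mul, mul_one]
  have hcX : Commute w (u - 1) := hc.symm.sub_right (Commute.one_right _)
  have htp : ∀ i, (u + w) ^ i = w ^ i * (u - 1) ^ (2 * i) := by
    intro i
    rw [htw, (hcX.pow_right 2).mul_pow, ← pow_mul]
  have ht : (u + w) ^ (l + 1) = 0 := by rw [htp, hu2, mul_zero]
  obtain ⟨v, hv⟩ : ∃ v, ((u - 1) ^ (2 * l + 1)) v ≠ 0 := by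
    by_contra! h
    exact hu1 (LinearMap.ext h)
  have hcyc := aux9_cyc (2 * l + 1) hdim u hu2 v hv
  have hbv : b (((u - 1) ^ (2 * l + 1)) v) v ≠ 0 := by
    intro h0
    apply hv
    apply hnd
    intro x
    have hfix : u (((u - 1) ^ (2 * l + 1)) v) = ((u - 1) ^ (2 * l + 1)) v := by
      rw [← sub_eq_zero]
      have : (u - 1) (((u - 1) ^ (2 * l + 1)) v) = 0 := by
        rw [← Module.End.mul_apply, ← pow_succ',
          show 2 * l + 1 + 1 = 2 * (l + 1) by ring, hu2]; rfl
      exact this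
    have hM := hcyc (LinearMap.ker (b (((u - 1) ^ (2 * l + 1)) v))) h0 (by
      intro m hm
      rw [LinearMap.mem_ker] at hm ⊢
      rw [← hm, ← hSp _ m, hfix])
    have : x ∈ LinearMap.ker (b (((u - 1) ^ (2 * l + 1)) v)) := hM ▸ trivial
    exact this
  -- value at the top
  have htop : ((u - 1) ^ (2 * l + 1)) v =
      ((u + w) ^ l) (u v) - ((u + w) ^ l) v := by
    have hw1 : w * (u - 1) ^ (2 * l + 1) = (u - 1) ^ (2 * l + 1) := by
      have h3 : (u - 1) * (u - 1) ^ (2 * l + 1) = 0 := by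
        rw [← pow_succ', show 2 * l + 1 + 1 = 2 * (l + 1) by ring, hu2]
      have h4 : u * (u - 1) ^ (2 * l + 1) = (u - 1) ^ (2 * l + 1) := by
        rw [sub_mul, one_mul, sub_eq_zero] at h3; exact h3
      conv_lhs => rw [← h4, ← mul_assoc, hwu, one_mul]
    have hwi : ∀ i, w ^ i * (u - 1) ^ (2 * l + 1) = (u - 1) ^ (2 * l + 1) := by
      intro i
      induction i with
      | zero => simp
      | succ i ih => rw [pow_succ, mul_assoc, hw1, ih]
    rw [← map_sub, htp, ← hwi l, pow_succ, ← mul_assoc, Module.End.mul_apply]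
    rfl
  have hT := aux9_T h2 u w huw hwu b halt hSp l v
  have hb : b (((u + w) ^ l) (u v)) v ≠ 0 := by
    rw [htop, map_sub, LinearMap.sub_apply, hT, sub_zero] at hbv
    exact hbv
  constructor
  · obtain ⟨P, hP, hPl⟩ := aux9_exP h2 u w huw hwu v n k l hlk ht (b.flip v) (by
      rw [LinearMap.flip_apply, LinearMap.flip_apply, hT, zero_add, ← Module.End.mul_apply,
        ((Commute.refl u).add_right hc |>.pow_right l).eq]
      exact hb)
    have hG := aux9_all h2 u w huw hwu v hcyc (2 ^ n - 1) l ht P hP hPl (l + 1) le_rfl b halt hSp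
      (by
        intro i hi
        rw [show i = (l + 1) + (i - (l + 1)) by omega, pow_add, ht]
        simp)
    intro s hs
    obtain ⟨z, rfl⟩ := Submodule.mkQ_surjective _ s
    have hcomm : ∀ z, ut ((aux9Rel K V).mkQ z) = (aux9Rel K V).mkQ ((aux9X u * aux9Y u) z) := by
      intro z
      induction z using TensorProduct.induction_on with
      | zero => simp
      | add x y hx hy => rw [map_add, map_add, hx, hy, map_add, map_add]
      | tmul x y =>
        have := hut x y
        simpa [SymSq.mul] using this
    have hpow : ∀ (m : ℕ) z, ((ut - 1) ^ m) ((aux9Rel K V).mkQ z) =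
        (aux9Rel K V).mkQ (((aux9X u * aux9Y u - 1) ^ m) z) := by
      intro m
      induction m with
      | zero => intro z; rfl
      | succ m ih =>
        intro z
        rw [pow_succ, pow_succ, Module.End.mul_apply, Module.End.mul_apply, ← ih,
          LinearMap.sub_apply, LinearMap.sub_apply, hcomm, Module.End.one_apply, Module.End.one_apply, map_sub (aux9Rel K V).mkQ]
    have hz : ((aux9X u * aux9Y u - 1 : Module.End K (TensorProduct K V V)) ^ (2 ^ n - 1)) z ∈ aux9Rel K V := by
      have h5 := LinearMap.mem_ker.1 hs
      rw [hpow] at h5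
      exact (Submodule.Quotient.mk_eq_zero _).1 h5
    have h6 := hG.2.2 z hz
    rw [LinearMap.mem_ker, ← h6]
    have h7 : φ.comp (aux9Rel K V).mkQ = TensorProduct.lift b := by
      ext x y
      exact (hφ x y).trans (by simp)
    exact LinearMap.congr_fun h7 z
  · intro hle
    obtain ⟨z, hz, hz2⟩ := aux9_part2 h2 u w huw hwu v n k l hkodd hlk ht b halt hSp hb ut hut φ hφ
    exact hz2 (hle hz)
end

section
/- Let (V, b) be a symplectic vector space of dimension 2ℓ (ℓ ≥ 1) over an algebraically closed field K of characteristic 2, and let u ∈ Sp(V) be unipotent such that V = W ⊕ Z where W and Z are totally singular u-invariant subspaces on each of which u acts with a single Jordan block of size ℓ. Let ũ be the map induced by u on S²(V), let φ : S²(V) → K be determined by φ(xy) = b(x, y), and set α = ν₂(ℓ). Then ker(ũ − 1)^{2^α − 1} ⊆ ker φ, and ker(ũ − 1)^{2^α} ⊄ ker φ. -/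
open scoped TensorProduct

open Polynomial in
theorem aux_li {K V : Type*} [Field K] [AddCommGroup V] [Module K V] (u : Module.End K V)
    (ℓ : ℕ) (hl : 1 ≤ ℓ) (w : V) (h1 : ((u - 1) ^ (ℓ - 1)) w ≠ 0) (h2 : ((u - 1) ^ ℓ) w = 0) :
    LinearIndependent K (fun i : Fin ℓ => (u ^ (i : ℕ)) w) := by
  have key : ∀ f : K[X], f.degree < ℓ → aeval u f w = 0 → f = 0 := by
    intro f hd hf
    by_contra hne
    obtain ⟨g, hg, hnd⟩ := exists_eq_pow_rootMultiplicity_mul_and_not_dvd f hne 1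
    set k := f.rootMultiplicity 1 with hk
    have hkl : k < ℓ := by
      have h3 : (k : WithBot ℕ) ≤ f.degree := by
        have := degree_le_of_dvd (Dvd.intro g hg.symm) hne
        rw [degree_pow, degree_X_sub_C] at this
        simpa using this
      exact_mod_cast lt_of_le_of_lt h3 hd
    have hcop : IsCoprime g ((X - C (1:K)) ^ ℓ) := by
      apply IsCoprime.pow_right
      exact ((Irreducible.coprime_iff_not_dvd (irreducible_X_sub_C (1:K))).2 hnd).symm
    obtain ⟨a, c, hac⟩ := hcop
    have h4 : (X - C (1:K)) ^ (ℓ - 1) =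
        ((X - C (1:K)) ^ (ℓ - 1 - k) * a) * f + ((X - C (1:K)) ^ (ℓ - 1) * c) * (X - C (1:K)) ^ ℓ := by
      have h5 : (X - C (1:K)) ^ (ℓ - 1) = (X - C (1:K)) ^ (ℓ - 1 - k) * (X - C (1:K)) ^ k := by
        rw [← pow_add]; congr 1; omega
      calc (X - C (1:K)) ^ (ℓ - 1) = (X - C (1:K)) ^ (ℓ - 1) * (a * g + c * (X - C (1:K)) ^ ℓ) := by
            rw [hac, mul_one]
        _ = (X - C (1:K)) ^ (ℓ - 1) * (a * g) + ((X - C (1:K)) ^ (ℓ - 1) * c) * (X - C (1:K)) ^ ℓ := by ring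
        _ = _ := by
            congr 1
            rw [h5]
            conv_rhs => rw [hg]
            ring
    apply h1
    have h6 := congrArg (fun p => aeval u p w) h4
    have h7 : aeval u (X - C (1:K)) = u - 1 := by simp
    simp only [map_add, map_mul, map_pow, h7, LinearMap.add_apply, Module.End.mul_apply, hf, h2] at h6
    simpa using h6
  rw [Fintype.linearIndependent_iff]
  intro g hg i
  have h := key (∑ i : Fin ℓ, C (g i) * X ^ (i : ℕ)) (degree_sum_fin_lt g) (by
    simp only [map_sum, map_mul, aeval_C, map_pow, aeval_X, LinearMap.sum_apply]
    simpa [Module.algebraMap_end_apply] using hg)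
  have h8 := congrArg (fun p => coeff p (i : ℕ)) h
  simpa [finsetSum_coeff, coeff_C_mul, coeff_X_pow, Fin.val_inj] using h8

open Polynomial in
theorem aux_Y {K V : Type*} [Field K] [CharP K 2] [AddCommGroup V] [Module K V] (u : Module.End K V)
    (ℓ a m : ℕ) (hl : 1 ≤ ℓ) (hm : ℓ = 2 ^ a * m) (w : V) (h1 : ((u - 1) ^ (ℓ - 1)) w ≠ 0)
    (h2 : ((u - 1) ^ ℓ) w = 0) :
    ∃ Y : V →ₗ[K] V, ∀ j : ℕ, Y ((u ^ j) w) = if 2 ^ a ∣ j then (u ^ j) w else 0 := by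
  have hli := aux_li u ℓ hl w h1 h2
  obtain ⟨Y, hY⟩ : ∃ Y : V →ₗ[K] V, ∀ i : Fin ℓ, Y ((u ^ (i:ℕ)) w) =
      if 2 ^ a ∣ (i:ℕ) then (u ^ (i:ℕ)) w else 0 := by
    obtain ⟨Y, hY⟩ := LinearMap.exists_extend
      ((Module.Basis.span hli).constr K (fun i : Fin ℓ => if 2 ^ a ∣ (i:ℕ) then (u ^ (i:ℕ)) w else 0))
    refine ⟨Y, fun i => ?_⟩
    have h3 := congrArg (fun f => f (Module.Basis.span hli i)) hY
    simp only [LinearMap.comp_apply, Module.Basis.constr_basis] at h3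
    rw [← h3, Submodule.subtype_apply, Module.Basis.span_apply]
  refine ⟨Y, fun j => ?_⟩
  -- relation
  have hrel : (u ^ ℓ) w = - ∑ k ∈ Finset.range m,
      (((X - 1 : K[X]) ^ m).coeff k) • (u ^ (2 ^ a * k)) w := by
    have e1 : aeval (u ^ 2 ^ a) ((X - 1 : K[X]) ^ m) = (u - 1) ^ ℓ := by
      have : (X - 1 : K[X]) ^ 2 ^ a = X ^ 2 ^ a - 1 := by
        rw [sub_pow_char_pow, one_pow]
      have h := congrArg (aeval u) this
      simp only [map_pow, map_sub, aeval_X, map_one] at h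
      simp only [map_pow, map_sub, aeval_X, map_one]
      rw [← h, hm, pow_mul]
    have hdeg : ((X - 1 : K[X]) ^ m).natDegree = m := by
      have : (X - 1 : K[X]) = X - C 1 := by simp
      rw [this, natDegree_pow, natDegree_X_sub_C, mul_one]
    have hmon : ((X - 1 : K[X]) ^ m).coeff m = 1 := by
      have h : ((X - C 1 : K[X]) ^ m).Monic := (monic_X_sub_C 1).pow m
      have := h.coeff_natDegree
      simpa [hdeg] using this
    rw [aeval_eq_sum_range, hdeg, Finset.sum_range_succ, hmon] at e1
    have e2 := congrArg (fun f => f w) e1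
    simp only [h2, LinearMap.add_apply, LinearMap.sum_apply, LinearMap.smul_apply, one_smul,
      ← pow_mul, ← hm] at e2
    rw [eq_neg_iff_add_eq_zero, add_comm]
    exact e2
  induction j using Nat.strong_induction_on with
  | _ j ih =>
    by_cases hj : j < ℓ
    · exact hY ⟨j, hj⟩
    push Not at hj
    have hexp : (u ^ j) w = - ∑ k ∈ Finset.range m,
      (((X - 1 : K[X]) ^ m).coeff k) • (u ^ (j - ℓ + 2 ^ a * k)) w := by
      have : u ^ j = u ^ (j - ℓ) * u ^ ℓ := by rw [← pow_add]; congr 1; omega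
      rw [this, Module.End.mul_apply, hrel]
      simp only [map_neg, map_sum, map_smul, pow_add, Module.End.mul_apply]
    have hd : ∀ k, (2 ^ a ∣ j - ℓ + 2 ^ a * k) ↔ 2 ^ a ∣ j := by
      intro k
      rw [Nat.dvd_add_left (Dvd.intro _ rfl)]
      rw [← Nat.dvd_add_left (show 2 ^ a ∣ ℓ from ⟨m, hm⟩), Nat.sub_add_cancel hj]
    have hY2 : Y ((u ^ j) w) = - ∑ k ∈ Finset.range m, (((X - 1 : K[X]) ^ m).coeff k) •
        (if 2 ^ a ∣ j then (u ^ (j - ℓ + 2 ^ a * k)) w else 0) := by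
      rw [hexp]
      simp only [map_neg, map_sum, map_smul]
      congr 1
      refine Finset.sum_congr rfl fun k hk => ?_
      rw [ih, if_congr (hd k) rfl rfl]
      have : 2 ^ a * k < 2 ^ a * m :=
        Nat.mul_lt_mul_of_pos_left (Finset.mem_range.1 hk) (by positivity)
      omega
    rw [hY2]
    split_ifs
    · exact hexp.symm
    · simp

open Polynomial in
theorem aux_geom {K A : Type*} [Field K] [CharP K 2] [Ring A] [Algebra K A] (t : A) (a : ℕ) :
    (t - 1) ^ (2 ^ a - 1) = ∑ i ∈ Finset.range (2 ^ a), t ^ i := by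
  have h : (X - 1 : K[X]) ^ (2 ^ a - 1) = ∑ i ∈ Finset.range (2 ^ a), X ^ i := by
    have hne : (X - 1 : K[X]) ≠ 0 := by simpa using X_sub_C_ne_zero (1 : K)
    apply mul_right_cancel₀ hne
    rw [geom_sum_mul, ← pow_succ, Nat.sub_add_cancel Nat.one_le_two_pow, sub_pow_char_pow, one_pow]
  simpa using congrArg (aeval t) h

open Polynomial in
theorem aux_frob {K A : Type*} [Field K] [CharP K 2] [Ring A] [Algebra K A] (t : A) (a : ℕ) :
    (t - 1) ^ (2 ^ a) = t ^ 2 ^ a - 1 := by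
  have h : (X - 1 : K[X]) ^ (2 ^ a) = X ^ 2 ^ a - 1 := by
    rw [sub_pow_char_pow, one_pow]
  simpa using congrArg (aeval t) h

theorem aux_sum_one {M : Type*} [AddCommMonoid M] (q : ℕ) (hq : 0 < q) (j : ℕ) (x : M) :
    ∑ i ∈ Finset.range q, (if q ∣ i + j then x else 0) = x := by
  have hc : ∀ i ∈ Finset.range q, ((q ∣ i + j) ↔ i = (q - j % q) % q) := by
    intro i hi
    rw [Finset.mem_range] at hi
    have hj := Nat.mod_lt j hq
    rw [Nat.dvd_iff_mod_eq_zero, Nat.add_mod, Nat.mod_eq_of_lt hi]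
    generalize j % q = r at *
    rcases Nat.eq_zero_or_pos r with rfl | hr
    · simp [Nat.mod_eq_of_lt hi]
    · rw [Nat.mod_eq_of_lt (show q - r < q by omega), ← Nat.dvd_iff_mod_eq_zero]
      constructor
      · rintro ⟨c, hc⟩
        have : c = 1 := by
          have : c ≠ 0 := by rintro rfl; omega
          by_contra h
          have : q * 2 ≤ q * c := Nat.mul_le_mul_left _ (by omega)
          omega
        subst this; omega
      · rintro rfl; exact ⟨1, by omega⟩
  rw [Finset.sum_congr rfl (fun i hi => if_congr (hc i hi) rfl rfl), Finset.sum_ite_eq']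
  simp [Nat.mod_lt _ hq]

theorem aux_count (R : Type*) [Semiring R] (q : ℕ) (hq : 0 < q) (m : ℕ) :
    ∑ i ∈ Finset.range (q * m), (if q ∣ i then (1 : R) else 0) = m := by
  induction m with
  | zero => simp
  | succ m ih =>
    rw [Nat.mul_succ, Finset.sum_range_add, ih]
    have := aux_sum_one q hq (q * m) (1 : R)
    simp only [add_comm _ (q * m)] at this
    rw [this]; simp

/-- Lemma: for unipotent `u ∈ Sp(V)` with `V ↓ K[u] = W(ℓ)` (i.e. `V = W ⊕ Z` with `W`, `Z`
totally singular `u`-invariant, `u` a single Jordan block of size `ℓ` on each), with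
`α = ν₂(ℓ)`: `ker(ũ - 1)^(2^α - 1) ⊆ ker φ` and `ker(ũ - 1)^(2^α) ⊄ ker φ`. -/
theorem stmt10 (K : Type*) [Field K] [IsAlgClosed K] [CharP K 2]
    (V : Type*) [AddCommGroup V] [Module K V] [FiniteDimensional K V]
    (ℓ : ℕ) (hl : 1 ≤ ℓ) (hdim : Module.finrank K V = 2 * ℓ)
    (b : V →ₗ[K] V →ₗ[K] K)
    (halt : ∀ v : V, b v v = 0)
    (hnd : ∀ v : V, (∀ w : V, b v w = 0) → v = 0)
    (u : Module.End K V)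
    (hSp : ∀ v w : V, b (u v) (u w) = b v w)
    (hunip : IsNilpotent (u - 1))
    (W Z : Submodule K V) (hcompl : IsCompl W Z)
    (hWsing : ∀ x ∈ W, ∀ y ∈ W, b x y = 0)
    (hZsing : ∀ x ∈ Z, ∀ y ∈ Z, b x y = 0)
    (hWinv : ∀ x ∈ W, u x ∈ W) (hZinv : ∀ x ∈ Z, u x ∈ Z)
    (hWdim : Module.finrank K ↥W = ℓ) (hZdim : Module.finrank K ↥Z = ℓ)
    (hW1 : ∃ x ∈ W, ((u - 1) ^ (ℓ - 1)) x ≠ 0)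
    (hW2 : ∀ x ∈ W, ((u - 1) ^ ℓ) x = 0)
    (hZ1 : ∃ x ∈ Z, ((u - 1) ^ (ℓ - 1)) x ≠ 0)
    (hZ2 : ∀ x ∈ Z, ((u - 1) ^ ℓ) x = 0)
    (ut : Module.End K (SymSq K V))
    (hut : ∀ x y : V, ut (SymSq.mul x y) = SymSq.mul (u x) (u y))
    (φ : SymSq K V →ₗ[K] K)
    (hφ : ∀ x y : V, φ (SymSq.mul x y) = b x y) :
    LinearMap.ker ((ut - 1) ^ (2 ^ padicValNat 2 ℓ - 1)) ≤ LinearMap.ker φ ∧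
      ¬ LinearMap.ker ((ut - 1) ^ (2 ^ padicValNat 2 ℓ)) ≤ LinearMap.ker φ := by
  obtain ⟨m, hm⟩ : 2 ^ padicValNat 2 ℓ ∣ ℓ := pow_padicValNat_dvd
  have hmodd : ¬ 2 ∣ m := by
    rintro ⟨c, rfl⟩
    have h := pow_succ_padicValNat_not_dvd (p := 2) (n := ℓ) (by omega)
    exact h ⟨c, by rw [pow_succ, mul_assoc]; exact hm⟩
  generalize padicValNat 2 ℓ = a at hm ⊢
  obtain ⟨w, hwW, hw1⟩ := hW1
  have hw2 := hW2 w hwW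
  have hli := aux_li u ℓ hl w hw1 hw2
  obtain ⟨Y, hY⟩ := aux_Y u ℓ a m hl hm w hw1 hw2
  have hq : 0 < 2 ^ a := by positivity
  have hupW : ∀ (j : ℕ), ∀ x ∈ W, (u ^ j) x ∈ W := by
    intro j
    induction j with
    | zero => intro x hx; simpa using hx
    | succ j ih => intro x hx; rw [pow_succ, Module.End.mul_apply]; exact ih _ (hWinv x hx)
  have hupZ : ∀ (j : ℕ), ∀ x ∈ Z, (u ^ j) x ∈ Z := by
    intro j
    induction j with
    | zero => intro x hx; simpa using hx
    | succ j ih => intro x hx; rw [pow_succ, Module.End.mul_apply]; exact ih _ (hZinv x hx)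
  have hSpp : ∀ (j : ℕ) (x y : V), b ((u ^ j) x) ((u ^ j) y) = b x y := by
    intro j
    induction j with
    | zero => intro x y; simp
    | succ j ih => intro x y; simp only [pow_succ, Module.End.mul_apply]; rw [ih, hSp]
  have hutp : ∀ (j : ℕ) (x y : V),
      (ut ^ j) (SymSq.mul x y) = SymSq.mul ((u ^ j) x) ((u ^ j) y) := by
    intro j
    induction j with
    | zero => intro x y; simp
    | succ j ih => intro x y; simp only [pow_succ, Module.End.mul_apply]; rw [hut, ih]
  have hsymm : ∀ x y : V, b x y = b y x := by
    intro x y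
    have h := halt (x + y)
    simp only [map_add, LinearMap.add_apply, halt, zero_add, add_zero] at h
    have h2 := CharTwo.add_eq_zero.1 h
    exact h2.symm
  -- basis of `W`
  have hliW : LinearIndependent K (fun i : Fin ℓ => (⟨(u ^ (i : ℕ)) w, hupW i w hwW⟩ : W)) :=
    LinearIndependent.of_comp W.subtype hli
  have : Nonempty (Fin ℓ) := ⟨⟨0, hl⟩⟩
  let c : Module.Basis (Fin ℓ) K W :=
    basisOfLinearIndependentOfCardEqFinrank hliW (by rw [hWdim, Fintype.card_fin])
  have hc : ∀ i : Fin ℓ, ((c i : W) : V) = (u ^ (i : ℕ)) w := by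
    intro i; simp [c]
  have hWext : ∀ (f g : V →ₗ[K] K), (∀ i : ℕ, f ((u ^ i) w) = g ((u ^ i) w)) →
      ∀ x ∈ W, f x = g x := by
    intro f g h x hx
    have : f ∘ₗ W.subtype = g ∘ₗ W.subtype := by
      apply c.ext
      intro i
      simp only [LinearMap.comp_apply, Submodule.subtype_apply, hc, h]
    exact congrArg (fun F => F ⟨x, hx⟩) this
  have hSymext : ∀ (f g : SymSq K V →ₗ[K] K),
      (∀ x y, f (SymSq.mul x y) = g (SymSq.mul x y)) → f = g := by
    intro f g h
    apply Submodule.linearMap_qext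
    apply TensorProduct.ext'
    intro x y
    exact h x y
  constructor
  · let P : V →ₗ[K] V := W.projection Z hcompl
    let Q : V →ₗ[K] V := Z.projection W hcompl.symm
    have hPQ : ∀ x, P x + Q x = x := fun x => Submodule.projection_add_projection_eq_self hcompl x
    have hPm : ∀ x, P x ∈ W := fun x => Submodule.projection_apply_mem hcompl x
    have hQm : ∀ x, Q x ∈ Z := fun x => Submodule.projection_apply_mem hcompl.symm x
    have hPu : ∀ (j : ℕ) (x : V), P ((u ^ j) x) = (u ^ j) (P x) := by
      intro j x
      conv_lhs => rw [← hPQ x]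
      rw [map_add, map_add]
      have h1 : P ((u ^ j) (P x)) = (u ^ j) (P x) :=
        Submodule.projection_apply_of_mem_left hcompl (hupW j _ (hPm x))
      have h2 : P ((u ^ j) (Q x)) = 0 :=
        Submodule.projection_apply_of_mem_right hcompl (hupZ j _ (hQm x))
      rw [h1, h2, add_zero]
    have hQu : ∀ (j : ℕ) (x : V), Q ((u ^ j) x) = (u ^ j) (Q x) := by
      intro j x
      have h1 := hPQ ((u ^ j) x)
      conv_rhs at h1 => rw [← hPQ x, map_add, ← hPu]
      exact add_left_cancel h1
    have hkey : ∀ x ∈ W, ∀ z : V,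
        ∑ i ∈ Finset.range (2 ^ a), b (Y ((u ^ i) x)) ((u ^ i) z) = b x z := by
      intro x hx z
      let F : V →ₗ[K] K := ∑ i ∈ Finset.range (2 ^ a), (b.flip ((u ^ i) z)) ∘ₗ Y ∘ₗ (u ^ i)
      have hF : ∀ y, F y = ∑ i ∈ Finset.range (2 ^ a), b (Y ((u ^ i) y)) ((u ^ i) z) := by
        intro y; simp [F, LinearMap.sum_apply]
      have := hWext F (b.flip z) (by
        intro j
        rw [hF, LinearMap.flip_apply, ← aux_sum_one (2 ^ a) hq j (b ((u ^ j) w) z)]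
        refine Finset.sum_congr rfl fun i _ => ?_
        rw [← Module.End.mul_apply (u ^ i) (u ^ j), ← pow_add, hY]
        split_ifs
        · rw [pow_add, Module.End.mul_apply, hSpp]
        · simp) x hx
      rw [hF] at this
      exact this
    let B0 : V →ₗ[K] V →ₗ[K] K := b.compl₁₂ (Y ∘ₗ P) Q
    let B : V →ₗ[K] V →ₗ[K] K := B0 + B0.flip
    have hB : ∀ x y, B x y = b (Y (P x)) (Q y) + b (Y (P y)) (Q x) := by
      intro x y; simp [B, B0]
    let ψ : SymSq K V →ₗ[K] K := Submodule.liftQ _ (TensorProduct.lift B) (by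
      rw [Submodule.span_le]
      rintro _ ⟨x, y, rfl⟩
      simp only [SetLike.mem_coe, LinearMap.mem_ker, map_sub, TensorProduct.lift.tmul, hB]
      ring)
    have hψ : ∀ x y, ψ (SymSq.mul x y) = B x y := by
      intro x y
      simp only [ψ, SymSq.mul, Submodule.liftQ_apply, TensorProduct.lift.tmul]
    have hmain : φ = ψ ∘ₗ ((ut - 1) ^ (2 ^ a - 1)) := by
      apply hSymext
      intro x y
      rw [LinearMap.comp_apply, aux_geom (K := K), LinearMap.sum_apply, map_sum, hφ]
      simp only [hutp, hψ, hB, hPu, hQu]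
      rw [Finset.sum_add_distrib, hkey _ (hPm x), hkey _ (hPm y)]
      conv_lhs => rw [← hPQ x, ← hPQ y]
      simp only [map_add, LinearMap.add_apply]
      rw [hWsing _ (hPm x) _ (hPm y), hZsing _ (hQm x) _ (hQm y), hsymm (Q x) (P y)]
      ring
    intro x hx
    rw [LinearMap.mem_ker] at hx ⊢
    rw [hmain, LinearMap.comp_apply, hx, map_zero]
  · -- dual basis in `Z`
    let D : Z →ₗ[K] Module.Dual K W := (b.flip.compl₁₂ Z.subtype W.subtype)
    have hD : ∀ (z : Z) (x : W), D z x = b x z := by intro z x; simp [D]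
    have hDinj : Function.Injective D := by
      rw [injective_iff_map_eq_zero]
      intro z hz
      apply Subtype.ext
      apply hnd
      intro v
      obtain ⟨x, hx, y, hy, rfl⟩ := Submodule.mem_sup.1
        (show v ∈ W ⊔ Z by rw [hcompl.sup_eq_top]; trivial)
      rw [map_add, hZsing _ z.2 _ hy, add_zero, hsymm]
      have := hD z ⟨x, hx⟩
      rw [hz] at this
      simpa using this.symm
    have hDsurj : Function.Surjective D := by
      apply (LinearMap.injective_iff_surjective_of_finrank_eq_finrank _).1 hDinj
      rw [Subspace.dual_finrank_eq, hWdim, hZdim]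
    choose z hz using fun i : Fin ℓ => hDsurj (c.coord i)
    have hbz : ∀ (x : W) (i : Fin ℓ), b x (z i) = c.repr x i := by
      intro x i
      rw [← hD, hz]; simp
    have hZexp : ∀ x ∈ Z, x = ∑ i : Fin ℓ, b ((u ^ (i : ℕ)) w) x • (z i : V) := by
      intro x hx
      have : (⟨x, hx⟩ : Z) = ∑ i : Fin ℓ, b ((u ^ (i : ℕ)) w) x • z i := by
        apply hDinj
        apply c.ext
        intro k
        simp only [map_sum, map_smul, LinearMap.sum_apply, LinearMap.smul_apply, hz, hD, hc]
        simp [Finsupp.single_apply]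
      have h2 := congrArg (fun t : Z => (t : V)) this
      simpa using h2
    have hWexp : ∀ x ∈ W, x = ∑ i : Fin ℓ, b x (z i) • (u ^ (i : ℕ)) w := by
      intro x hx
      have h2 := congrArg (fun t : W => (t : V)) (c.sum_repr ⟨x, hx⟩)
      simp only [← hbz, Submodule.coe_sum, Submodule.coe_smul, hc] at h2
      exact h2.symm
    have huinj : Function.Injective (⇑(u ^ 2 ^ a)) := by
      rw [injective_iff_map_eq_zero]
      intro v hv
      apply hnd
      intro y
      rw [← hSpp (2 ^ a), hv]; simp
    have huZsurj : ∀ y ∈ Z, ∃ x ∈ Z, (u ^ 2 ^ a) x = y := by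
      intro y hy
      let r : Z →ₗ[K] Z := (u ^ 2 ^ a).restrict (hupZ (2 ^ a))
      have hr : Function.Injective r := by
        intro s t hst
        apply Subtype.ext
        apply huinj
        exact congrArg (fun t : Z => (t : V)) hst
      obtain ⟨x, hx⟩ := (LinearMap.injective_iff_surjective.1 hr) ⟨y, hy⟩
      exact ⟨x, x.2, congrArg (fun t : Z => (t : V)) hx⟩
    let M : V →ₗ[K] V →ₗ[K] SymSq K V := (TensorProduct.mk K V V).compr₂ (Submodule.mkQ _)
    have hM : ∀ x y, M x y = SymSq.mul x y := fun x y => rfl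
    let ξ : SymSq K V := ∑ i : Fin ℓ, M (Y ((u ^ (i : ℕ)) w)) (z i)
    have hφξ : φ ξ = (m : K) := by
      rw [← aux_count K (2 ^ a) hq m, ← hm, Finset.sum_range, map_sum]
      refine Finset.sum_congr rfl fun i _ => ?_
      rw [hM, hφ, hY]
      split_ifs
      · rw [← hc, hbz]; simp
      · simp
    have hYu : ∀ i : ℕ, (u ^ 2 ^ a) (Y ((u ^ i) w)) = Y ((u ^ 2 ^ a) ((u ^ i) w)) := by
      intro i
      rw [← Module.End.mul_apply (u ^ 2 ^ a) (u ^ i), ← pow_add, hY, hY]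
      rw [if_congr (Nat.dvd_add_right (dvd_refl (2 ^ a))) rfl rfl]
      split_ifs
      · rw [pow_add, Module.End.mul_apply]
      · simp
    have hinv : (ut ^ 2 ^ a) ξ = ξ := by
      have h1 : (ut ^ 2 ^ a) ξ = ∑ j : Fin ℓ, ∑ i : Fin ℓ,
          b ((u ^ 2 ^ a) ((u ^ (j : ℕ)) w)) (z i) •
            M (Y ((u ^ (i : ℕ)) w)) ((u ^ 2 ^ a) (z j)) := by
        rw [map_sum]
        refine Finset.sum_congr rfl fun j _ => ?_
        rw [hM, hutp, hYu, ← hM]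
        conv_lhs => rw [hWexp _ (hupW (2 ^ a) _ (hupW j w hwW))]
        simp only [map_sum, map_smul, LinearMap.sum_apply, LinearMap.smul_apply]
      rw [h1, Finset.sum_comm]
      refine Finset.sum_congr rfl fun i _ => ?_
      obtain ⟨x, hx, hxz⟩ := huZsurj (z i) (z i).2
      simp only [← map_smul, ← map_sum]
      congr 1
      rw [← hxz]
      simp only [hSpp]
      rw [← hZexp x hx]
    intro hle
    have h3 : ξ ∈ LinearMap.ker ((ut - 1) ^ 2 ^ a) := by
      rw [LinearMap.mem_ker, aux_frob (K := K), LinearMap.sub_apply, hinv]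
      simp
    have h4 := hle h3
    rw [LinearMap.mem_ker, hφξ, CharP.cast_eq_zero_iff K 2] at h4
    exact hmodd h4
end

section
/- Let K be an algebraically closed field of characteristic 2, let ℓ ≥ 3 and 0 < k < ℓ/2 be integers, n = 2ℓ, and let V be the K-vector space with basis v_1, …, v_n equipped with the alternating bilinear form b with b(v_i, v_j) = 1 if i + j = n + 1 and b(v_i, v_j) = 0 otherwise. Let e be the linear map with e v_1 = 0, e v_{ℓ+1} = 0, e v_{n−k+1} = v_{n−k} + v_k, and e v_i = v_{i−1} for all other i (so e ∈ sp(V) is nilpotent; this is the model W_k(ℓ)). Let ẽ be the map induced by e on S²(V), let φ : S²(V) → K be determined by φ(xy) = b(x, y), and set α = ν₂(ℓ). Then ker(ẽ^{2^α − 1}) ⊆ ker φ, and ker(ẽ^{2^α}) ⊄ ker φ. -/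
open scoped TensorProduct

theorem aux_pow {K V : Type*} [Field K] [CharP K 2] [AddCommGroup V] [Module K V]
    (e : Module.End K V) (et : Module.End K (SymSq K V))
    (het : ∀ x y : V, et (SymSq.mul x y) = SymSq.mul (e x) y + SymSq.mul x (e y)) (a : ℕ) :
    ∀ x y : V, (et ^ (2 ^ a)) (SymSq.mul x y) =
      SymSq.mul ((e ^ (2 ^ a)) x) y + SymSq.mul x ((e ^ (2 ^ a)) y) := by
  induction a with
  | zero => intro x y; simpa using het x y
  | succ a ih =>
    intro x y
    have h2 : ∀ z : SymSq K V, z + z = 0 := by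
      intro z
      rw [← two_smul K z, CharTwo.two_eq_zero, zero_smul]
    have hp : 2 ^ (a + 1) = 2 ^ a + 2 ^ a := by ring
    rw [hp, pow_add, pow_add, Module.End.mul_apply, ih, map_add, ih, ih,
      Module.End.mul_apply, Module.End.mul_apply]
    have := h2 (SymSq.mul (K := K) ((e ^ (2 ^ a)) x) ((e ^ (2 ^ a)) y))
    generalize SymSq.mul (K := K) ((e ^ (2 ^ a)) x) ((e ^ (2 ^ a)) y) = z at *
    generalize SymSq.mul (K := K) ((e ^ (2 ^ a)) ((e ^ (2 ^ a)) x)) y = p at *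
    generalize SymSq.mul (K := K) x ((e ^ (2 ^ a)) ((e ^ (2 ^ a)) y)) = q at *
    calc _ = p + q + (z + z) := by abel
      _ = _ := by rw [this, add_zero]

theorem aux_pow_sub {K V : Type*} [Field K] [CharP K 2] [AddCommGroup V] [Module K V]
    (e : Module.End K V) (et : Module.End K (SymSq K V))
    (het : ∀ x y : V, et (SymSq.mul x y) = SymSq.mul (e x) y + SymSq.mul x (e y)) (a : ℕ) :
    ∀ x y : V, (et ^ (2 ^ a - 1)) (SymSq.mul x y) =
      ∑ i ∈ Finset.range (2 ^ a), SymSq.mul ((e ^ i) x) ((e ^ (2 ^ a - 1 - i)) y) := by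
  induction a with
  | zero => intro x y; simp
  | succ a ih =>
    intro x y
    have h1 : 0 < 2 ^ a := by positivity
    have hp : 2 ^ (a + 1) - 1 = 2 ^ a + (2 ^ a - 1) := by rw [pow_succ]; omega
    have hp' : 2 ^ (a + 1) = 2 ^ a + 2 ^ a := by ring
    rw [hp, pow_add, Module.End.mul_apply, ih, map_sum, hp', Finset.sum_range_add]
    simp_rw [aux_pow e et het a]
    rw [Finset.sum_add_distrib, add_comm]
    congr 1
    · apply Finset.sum_congr rfl
      intro i hi
      have hi := Finset.mem_range.1 hi
      rw [← Module.End.mul_apply, ← pow_add]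
      congr 3
      omega
    · apply Finset.sum_congr rfl
      intro i hi
      rw [← Module.End.mul_apply, ← pow_add]
      congr 3
      omega

theorem aux_unique (m : ℕ) (hm : 0 < m) (s r : ℕ) :
    ∃ i < m, s + i + 1 ≡ r [MOD m] ∧ ∀ j < m, s + j + 1 ≡ r [MOD m] → j = i := by
  refine ⟨(r + (m - 1) * (s + 1)) % m, Nat.mod_lt _ hm, ?_, ?_⟩
  · have h : s + (r + (m - 1) * (s + 1)) % m + 1 ≡ s + (r + (m - 1) * (s + 1)) + 1 [MOD m] :=
      ((Nat.mod_modEq _ _).add_left _).add_right _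
    refine h.trans ?_
    have : s + (r + (m - 1) * (s + 1)) + 1 = r + m * (s + 1) := by
      obtain ⟨n, rfl⟩ : ∃ n, m = n + 1 := ⟨m - 1, by omega⟩
      simp; ring
    rw [this]
    simp [Nat.ModEq]
  · intro j hj h
    have h' : (s + 1) + j ≡ (s + 1) + (r + (m - 1) * (s + 1)) [MOD m] := by
      have : (s + 1) + (r + (m - 1) * (s + 1)) = r + m * (s + 1) := by
        obtain ⟨n, rfl⟩ : ∃ n, m = n + 1 := ⟨m - 1, by omega⟩
        simp; ring
      rw [this]
      have h2 : r + m * (s + 1) ≡ r [MOD m] := by simp [Nat.ModEq]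
      rw [show s + 1 + j = s + j + 1 by ring]
      exact h.trans h2.symm
    have h3 := Nat.ModEq.add_left_cancel' _ h'
    rw [Nat.ModEq, Nat.mod_eq_of_lt hj] at h3
    exact h3

/-- mixed coefficients -/
theorem aux_sum1 {K : Type*} [Field K] (ℓ m s t : ℕ) (hm : 0 < m) (hml : m ∣ ℓ)
    (hs : s < ℓ) (ht : t < ℓ) :
    (∑ i ∈ Finset.range m, if s + i < ℓ ∧ t + (m - 1 - i) < ℓ ∧
      (s + i) + (t + (m - 1 - i)) + 2 = ℓ + m ∧ m ∣ s + i + 1 then (1 : K) else 0) =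
      if s + t = ℓ - 1 then 1 else 0 := by
  obtain ⟨i, him, hi, hu⟩ := aux_unique m hm s 0
  rw [Nat.modEq_zero_iff_dvd] at hi
  rw [Finset.sum_eq_single i]
  · congr 1
    apply propext
    constructor
    · rintro ⟨h1, h2, h3, h4⟩; omega
    · intro h
      obtain ⟨q, rfl⟩ := hml
      obtain ⟨p, hp⟩ := hi
      have hp1 : 1 ≤ p := by
        rcases Nat.eq_zero_or_pos p with h | h
        · subst h; omega
        · exact h
      have hp2 : p ≤ q := by
        by_contra hc
        have : q + 1 ≤ p := by omega
        have := Nat.mul_le_mul_left m this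
        rw [mul_add] at this
        omega
      have e1 := Nat.mul_le_mul_left m hp1
      have e2 := Nat.mul_le_mul_left m hp2
      refine ⟨by omega, by omega, by omega, ⟨p, hp⟩⟩
  · intro j hj hji
    rw [if_neg]
    rintro ⟨_, _, _, h⟩
    exact hji (hu j (Finset.mem_range.1 hj) (Nat.modEq_zero_iff_dvd.2 h))
  · intro h; exact absurd (Finset.mem_range.2 him) h

/-- key congruence fact: support avoids out-of-range indices -/
theorem aux_bd (ℓ m k i : ℕ) (hm : m = 1 ∨ 2 ∣ m) (q : ℕ) (hq : ℓ = m * (2 * q + 1))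
    (hk : 2 * k < ℓ) (hk0 : 0 < k) (hi : i + 2 ≤ 2 * k + m) (h : i + 1 ≡ k + m / 2 [MOD m]) :
    i < ℓ := by
  by_contra hc
  rcases hm with rfl | ⟨h2, rfl⟩
  · omega
  · rw [Nat.mul_div_cancel_left _ (by norm_num)] at h
    have hle : k + h2 ≤ i + 1 := by
      rcases Nat.eq_zero_or_pos q with h' | h'
      · subst h'; omega
      · have : h2 * 1 ≤ h2 * q := Nat.mul_le_mul_left _ h'
        have : 2 * h2 * (2 * q + 1) = 4 * (h2 * q) + 2 * h2 := by ring
        omega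
    have hd := (Nat.modEq_iff_dvd' hle).1 h.symm
    obtain ⟨p, hp⟩ := hd
    have e1 : 2 * h2 * (2 * q + 1) = 2 * (2 * h2 * q) + 2 * h2 := by ring
    have h20 : 0 < h2 := by
      rcases Nat.eq_zero_or_pos h2 with h' | h'
      · subst h'; omega
      · exact h'
    rcases Nat.lt_or_ge q p with hlt | hge
    · have := Nat.mul_le_mul_left (2 * h2) hlt
      rw [Nat.mul_succ] at this
      omega
    · have := Nat.mul_le_mul_left (2 * h2) hge
      omega

theorem aux_symm (m k i j : ℕ) (hm : m = 1 ∨ 2 ∣ m) (hij : i + j + 2 = 2 * k + m)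
    (h : i + 1 ≡ k + m / 2 [MOD m]) : j + 1 ≡ k + m / 2 [MOD m] := by
  rcases hm with rfl | ⟨h2, rfl⟩
  · exact Nat.modEq_one
  · rw [Nat.mul_div_cancel_left _ (by norm_num)] at *
    have : (i + 1) + (j + 1) = (k + h2) + (k + h2) := by omega
    exact Nat.ModEq.add_left_cancel h (by rw [this])

theorem aux_sum2 {K : Type*} [Field K] (ℓ m k s t : ℕ) (hm0 : 0 < m) (hm : m = 1 ∨ 2 ∣ m) (q : ℕ)
    (hq : ℓ = m * (2 * q + 1)) (hk : 2 * k < ℓ) (hk0 : 0 < k) (hs : s < ℓ) (ht : t < ℓ) :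
    (∑ i ∈ Finset.range m, if s + i < ℓ ∧ t + (m - 1 - i) < ℓ ∧
      (s + i) + (t + (m - 1 - i)) + 2 = 2 * k + m ∧ s + i + 1 ≡ k + m / 2 [MOD m]
        then (1 : K) else 0) =
      if s + t = 2 * k - 1 then 1 else 0 := by
  obtain ⟨i, him, hi, hu⟩ := aux_unique m hm0 s (k + m / 2)
  rw [Finset.sum_eq_single i]
  · congr 1
    apply propext
    constructor
    · rintro ⟨h1, h2, h3, h4⟩; omega
    · intro h
      have hij : (s + i) + (t + (m - 1 - i)) + 2 = 2 * k + m := by omega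
      have hj := aux_symm m k _ _ hm hij hi
      exact ⟨aux_bd ℓ m k _ hm q hq hk hk0 (by omega) hi,
        aux_bd ℓ m k _ hm q hq hk hk0 (by omega) hj, hij, hi⟩
  · intro j hj hji
    rw [if_neg]
    rintro ⟨_, _, _, h⟩
    exact hji (hu j (Finset.mem_range.1 hj) h)
  · intro h; exact absurd (Finset.mem_range.2 him) h

/-- abstract first part -/
theorem aux_part1 {K V : Type*} [Field K] [CharP K 2] [AddCommGroup V] [Module K V]
    (ℓ k a q : ℕ) (hq : ℓ = 2 ^ a * (2 * q + 1)) (hk : 2 * k < ℓ) (hk0 : 0 < k)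
    (e : Module.End K V) (et : Module.End K (SymSq K V))
    (het : ∀ x y : V, et (SymSq.mul x y) = SymSq.mul (e x) y + SymSq.mul x (e y))
    (b : V →ₗ[K] V →ₗ[K] K) (φ : SymSq K V →ₗ[K] K)
    (hφ : ∀ x y : V, φ (SymSq.mul x y) = b x y)
    (x y : V) (B : Module.Basis (Fin ℓ ⊕ Fin ℓ) K V)
    (hBx : ∀ i : Fin ℓ, B (Sum.inl i) = (e ^ (i : ℕ)) x)
    (hBy : ∀ i : Fin ℓ, B (Sum.inr i) = (e ^ (i : ℕ)) y)
    (hx : (e ^ ℓ) x = 0) (hy : (e ^ ℓ) y = 0)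
    (hxx : ∀ i j, i < ℓ → j < ℓ → b ((e ^ i) x) ((e ^ j) x) = 0)
    (hxy : ∀ i j, i < ℓ → j < ℓ → b ((e ^ i) x) ((e ^ j) y) = if i + j = ℓ - 1 then 1 else 0)
    (hyx : ∀ i j, i < ℓ → j < ℓ → b ((e ^ i) y) ((e ^ j) x) = if i + j = ℓ - 1 then 1 else 0)
    (hyy : ∀ i j, i < ℓ → j < ℓ → b ((e ^ i) y) ((e ^ j) y) =
      if i + j = 2 * k - 1 then 1 else 0) :
    LinearMap.ker (et ^ (2 ^ a - 1)) ≤ LinearMap.ker φ := by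
  classical
  set m := 2 ^ a with hmdef
  have hm0 : 0 < m := by positivity
  have hm : m = 1 ∨ 2 ∣ m := by
    rcases a with _ | a
    · left; simp [hmdef]
    · right; exact ⟨2 ^ a, by rw [hmdef]; ring⟩
  have hml : m ∣ ℓ := ⟨_, hq⟩
  let g : ℕ → ℕ → K := fun i j =>
    if i < ℓ ∧ j < ℓ ∧ i + j + 2 = ℓ + m ∧ m ∣ i + 1 then 1 else 0
  let d : ℕ → ℕ → K := fun i j =>
    if i < ℓ ∧ j < ℓ ∧ i + j + 2 = 2 * k + m ∧ i + 1 ≡ k + m / 2 [MOD m] then 1 else 0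
  have gsymm : ∀ i j, g i j = g j i := by
    have : ∀ i j, (i < ℓ ∧ j < ℓ ∧ i + j + 2 = ℓ + m ∧ m ∣ i + 1) →
        (j < ℓ ∧ i < ℓ ∧ j + i + 2 = ℓ + m ∧ m ∣ j + 1) := by
      rintro i j ⟨h1, h2, h3, h4⟩
      refine ⟨h2, h1, by omega, ?_⟩
      have : m ∣ (i + 1) + (j + 1) := by
        rw [show (i + 1) + (j + 1) = ℓ + m by omega]
        exact Dvd.dvd.add hml dvd_rfl
      exact (Nat.dvd_add_right h4).1 this
    intro i j
    simp only [g]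
    congr 1
    exact propext ⟨this i j, this j i⟩
  have dsymm : ∀ i j, d i j = d j i := by
    have : ∀ i j, (i < ℓ ∧ j < ℓ ∧ i + j + 2 = 2 * k + m ∧ i + 1 ≡ k + m / 2 [MOD m]) →
        (j < ℓ ∧ i < ℓ ∧ j + i + 2 = 2 * k + m ∧ j + 1 ≡ k + m / 2 [MOD m]) := by
      rintro i j ⟨h1, h2, h3, h4⟩
      exact ⟨h2, h1, by omega, aux_symm m k i j hm h3 h4⟩
    intro i j
    simp only [d]
    congr 1
    exact propext ⟨this i j, this j i⟩
  let M : Fin ℓ ⊕ Fin ℓ → Fin ℓ ⊕ Fin ℓ → K := fun p r =>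
    match p, r with
    | Sum.inl _, Sum.inl _ => 0
    | Sum.inl i, Sum.inr j => g i j
    | Sum.inr i, Sum.inl j => g i j
    | Sum.inr i, Sum.inr j => d i j
  let c : V →ₗ[K] V →ₗ[K] K := B.constr K (fun p => B.constr K (fun r => M p r))
  have hc : ∀ p r, c (B p) (B r) = M p r := by
    intro p r
    simp [c, Module.Basis.constr_basis]
  have hx0 : ∀ i, ℓ ≤ i → (e ^ i) x = 0 := by
    intro i hi
    obtain ⟨n, rfl⟩ := Nat.exists_eq_add_of_le' hi
    rw [pow_add, Module.End.mul_apply, hx, map_zero]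
  have hy0 : ∀ i, ℓ ≤ i → (e ^ i) y = 0 := by
    intro i hi
    obtain ⟨n, rfl⟩ := Nat.exists_eq_add_of_le' hi
    rw [pow_add, Module.End.mul_apply, hy, map_zero]
  have g0 : ∀ i j, (ℓ ≤ i ∨ ℓ ≤ j) → g i j = 0 := by
    intro i j h
    simp only [g]
    rw [if_neg]
    omega
  have d0 : ∀ i j, (ℓ ≤ i ∨ ℓ ≤ j) → d i j = 0 := by
    intro i j h
    simp only [d]
    rw [if_neg]
    rintro ⟨h1, h2, _⟩
    omega
  have cxx : ∀ i j, c ((e ^ i) x) ((e ^ j) x) = 0 := by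
    intro i j
    rcases Nat.lt_or_ge i ℓ with hi | hi
    · rcases Nat.lt_or_ge j ℓ with hj | hj
      · have := hc (Sum.inl ⟨i, hi⟩) (Sum.inl ⟨j, hj⟩)
        rw [hBx, hBx] at this
        exact this
      · rw [hx0 j hj, map_zero]
    · rw [hx0 i hi, map_zero, LinearMap.zero_apply]
  have cxy : ∀ i j, c ((e ^ i) x) ((e ^ j) y) = g i j := by
    intro i j
    rcases Nat.lt_or_ge i ℓ with hi | hi
    · rcases Nat.lt_or_ge j ℓ with hj | hj
      · have := hc (Sum.inl ⟨i, hi⟩) (Sum.inr ⟨j, hj⟩)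
        rw [hBx, hBy] at this
        exact this
      · rw [hy0 j hj, map_zero, g0 i j (Or.inr hj)]
    · rw [hx0 i hi, map_zero, LinearMap.zero_apply, g0 i j (Or.inl hi)]
  have cyx : ∀ i j, c ((e ^ i) y) ((e ^ j) x) = g i j := by
    intro i j
    rcases Nat.lt_or_ge i ℓ with hi | hi
    · rcases Nat.lt_or_ge j ℓ with hj | hj
      · have := hc (Sum.inr ⟨i, hi⟩) (Sum.inl ⟨j, hj⟩)
        rw [hBx, hBy] at this
        exact this
      · rw [hx0 j hj, map_zero, g0 i j (Or.inr hj)]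
    · rw [hy0 i hi, map_zero, LinearMap.zero_apply, g0 i j (Or.inl hi)]
  have cyy : ∀ i j, c ((e ^ i) y) ((e ^ j) y) = d i j := by
    intro i j
    rcases Nat.lt_or_ge i ℓ with hi | hi
    · rcases Nat.lt_or_ge j ℓ with hj | hj
      · have := hc (Sum.inr ⟨i, hi⟩) (Sum.inr ⟨j, hj⟩)
        rw [hBy, hBy] at this
        exact this
      · rw [hy0 j hj, map_zero, d0 i j (Or.inr hj)]
    · rw [hy0 i hi, map_zero, LinearMap.zero_apply, d0 i j (Or.inl hi)]
  have csymm : ∀ u w, c u w = c w u := by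
    have : c = c.flip := by
      refine B.ext fun p => B.ext fun r => ?_
      rw [LinearMap.flip_apply, hc, hc]
      rcases p with p | p <;> rcases r with r | r
      · rfl
      · exact gsymm _ _
      · exact gsymm _ _
      · exact dsymm _ _
    intro u w
    conv_lhs => rw [this]
    rfl
  let ψ : SymSq K V →ₗ[K] K := Submodule.liftQ _ (TensorProduct.lift c) (by
    rw [Submodule.span_le]
    rintro z ⟨u, w, rfl⟩
    simp [csymm u w])
  have hψ : ∀ u w, ψ (SymSq.mul u w) = c u w := by
    intro u w
    simp [ψ, SymSq.mul]
  have key : (∑ i ∈ Finset.range m, (c.compl₁₂ (e ^ i) (e ^ (m - 1 - i)))) = b := by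
    refine B.ext fun p => B.ext fun r => ?_
    simp only [LinearMap.sum_apply, LinearMap.compl₁₂_apply]
    rcases p with p | p <;> rcases r with r | r <;> simp only [hBx, hBy] <;>
      simp only [← Module.End.mul_apply, ← pow_add]
    · rw [hxx _ _ p.2 r.2]
      exact Finset.sum_eq_zero fun i _ => cxx _ _
    · rw [hxy _ _ p.2 r.2, ← aux_sum1 ℓ m p r hm0 hml p.2 r.2]
      refine Finset.sum_congr rfl fun i _ => ?_
      rw [cxy, add_comm i, add_comm _ (r : ℕ)]
    · rw [hyx _ _ p.2 r.2, ← aux_sum1 ℓ m p r hm0 hml p.2 r.2]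
      refine Finset.sum_congr rfl fun i _ => ?_
      rw [cyx, add_comm i, add_comm _ (r : ℕ)]
    · rw [hyy _ _ p.2 r.2, ← aux_sum2 ℓ m k p r hm0 hm q hq hk hk0 p.2 r.2]
      refine Finset.sum_congr rfl fun i _ => ?_
      rw [cyy, add_comm i, add_comm _ (r : ℕ)]
  have hfin : φ = ψ ∘ₗ (et ^ (m - 1)) := by
    apply Submodule.linearMap_qext
    apply TensorProduct.ext'
    intro u w
    change φ (SymSq.mul u w) = ψ ((et ^ (m - 1)) (SymSq.mul u w))
    rw [hφ, aux_pow_sub e et het a, map_sum, ← key]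
    simp only [LinearMap.sum_apply, LinearMap.compl₁₂_apply, hψ]
    rfl
  intro z hz
  rw [LinearMap.mem_ker] at *
  rw [hfin, LinearMap.comp_apply, hz, map_zero]

theorem aux_part2 {K V : Type*} [Field K] [CharP K 2] [AddCommGroup V] [Module K V]
    (ℓ a q : ℕ) (hq : ℓ = 2 ^ a * (2 * q + 1))
    (e : Module.End K V) (et : Module.End K (SymSq K V))
    (het : ∀ x y : V, et (SymSq.mul x y) = SymSq.mul (e x) y + SymSq.mul x (e y))
    (b : V →ₗ[K] V →ₗ[K] K) (φ : SymSq K V →ₗ[K] K)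
    (hφ : ∀ x y : V, φ (SymSq.mul x y) = b x y)
    (x y : V) (hx : (e ^ ℓ) x = 0) (hy : (e ^ ℓ) y = 0)
    (hxy : ∀ i j, i < ℓ → j < ℓ → b ((e ^ i) x) ((e ^ j) y) = if i + j = ℓ - 1 then 1 else 0) :
    ¬ LinearMap.ker (et ^ (2 ^ a)) ≤ LinearMap.ker φ := by
  set m := 2 ^ a with hmdef
  have hm0 : 0 < m := by positivity
  have hz0 : ∀ z : V, SymSq.mul (K := K) z 0 = 0 := by intro z; simp [SymSq.mul]
  have h0z : ∀ z : V, SymSq.mul (K := K) 0 z = 0 := by intro z; simp [SymSq.mul]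
  have h2 : ∀ z : SymSq K V, z + z = 0 := by
    intro z
    rw [← two_smul K z, CharTwo.two_eq_zero, zero_smul]
  let F : ℕ → SymSq K V := fun s =>
    SymSq.mul ((e ^ (m * s + (m - 1))) x) ((e ^ (m * (2 * q + 1 - s))) y)
  have hF : ∀ s < 2 * q + 1, (et ^ m)
      (SymSq.mul ((e ^ (m * s + (m - 1))) x) ((e ^ (m * (2 * q - s))) y)) = F (s + 1) + F s := by
    intro s hs
    rw [hmdef, aux_pow e et het a, ← hmdef]
    simp only [F, ← Module.End.mul_apply, ← pow_add]
    have e1 : m + (m * s + (m - 1)) = m * (s + 1) + (m - 1) := by ring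
    have e2 : 2 * q - s = 2 * q + 1 - (s + 1) := by omega
    have e3 : m + m * (2 * q - s) = m * (2 * q + 1 - s) := by
      rw [show 2 * q + 1 - s = (2 * q - s) + 1 by omega]; ring
    rw [e1, e3, e2]
  have htel : ∀ n, (∑ s ∈ Finset.range n, (F (s + 1) + F s)) = F n + F 0 := by
    intro n
    induction n with
    | zero => simp [h2]
    | succ n ih =>
      rw [Finset.sum_range_succ, ih]
      calc _ = F (n + 1) + F 0 + (F n + F n) := by abel
        _ = _ := by rw [h2, add_zero]
  intro h
  have hk : (∑ s ∈ Finset.range (2 * q + 1),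
      SymSq.mul ((e ^ (m * s + (m - 1))) x) ((e ^ (m * (2 * q - s))) y) : SymSq K V) ∈
      LinearMap.ker (et ^ m) := by
    rw [LinearMap.mem_ker, map_sum,
      Finset.sum_congr rfl (fun s hs => hF s (Finset.mem_range.1 hs)), htel]
    simp only [F]
    rw [← hq, add_comm ℓ, pow_add, Module.End.mul_apply, hx, map_zero, h0z, Nat.sub_zero, ← hq,
      hy, hz0, add_zero]
  have h1 := h hk
  rw [LinearMap.mem_ker, map_sum] at h1
  have hone : ∀ s ∈ Finset.range (2 * q + 1),
      φ (SymSq.mul ((e ^ (m * s + (m - 1))) x) ((e ^ (m * (2 * q - s))) y)) = 1 := by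
    intro s hs
    have hs := Finset.mem_range.1 hs
    obtain ⟨t, ht⟩ : ∃ t, 2 * q = s + t := ⟨2 * q - s, by omega⟩
    have : ℓ = m * s + m * t + m := by rw [hq, ht]; ring
    have e2 : 2 * q - s = t := by omega
    rw [hφ, e2, hxy _ _ (by omega) (by omega), if_pos (by omega)]
  rw [Finset.sum_congr rfl hone] at h1
  simp [CharTwo.two_eq_zero] at h1

/-- Lemma: for the nilpotent model `e = W_k(ℓ)` on `V = K^{2ℓ}` (standard symplectic basis
`v_0, …, v_{2ℓ-1}`, 0-indexed: `e v_0 = 0`, `e v_ℓ = 0`, `e v_{2ℓ-k} = v_{2ℓ-k-1} + v_{k-1}`,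
`e v_n = v_{n-1}` otherwise), with `α = ν₂(ℓ)`:
`ker(ẽ^(2^α - 1)) ⊆ ker φ` and `ker(ẽ^(2^α)) ⊄ ker φ`. -/
theorem stmt14 (K : Type*) [Field K] [IsAlgClosed K] [CharP K 2]
    (ℓ k : ℕ) (hl : 3 ≤ ℓ) (hk0 : 0 < k) (hk : 2 * k < ℓ)
    (v : ℕ → (Fin (2 * ℓ) → K))
    (hv : ∀ i : Fin (2 * ℓ), v (i : ℕ) = Pi.single i 1)
    (b : (Fin (2 * ℓ) → K) →ₗ[K] (Fin (2 * ℓ) → K) →ₗ[K] K)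
    (hb : ∀ n n' : ℕ, n < 2 * ℓ → n' < 2 * ℓ →
      b (v n) (v n') = if n + n' = 2 * ℓ - 1 then 1 else 0)
    (e : Module.End K (Fin (2 * ℓ) → K))
    (he : ∀ n : ℕ, n < 2 * ℓ → e (v n) =
      if n = 0 ∨ n = ℓ then 0
      else if n = 2 * ℓ - k then v (2 * ℓ - k - 1) + v (k - 1)
      else v (n - 1))
    (et : Module.End K (SymSq K (Fin (2 * ℓ) → K)))
    (het : ∀ x y : Fin (2 * ℓ) → K,
      et (SymSq.mul x y) = SymSq.mul (e x) y + SymSq.mul x (e y))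
    (φ : SymSq K (Fin (2 * ℓ) → K) →ₗ[K] K)
    (hφ : ∀ x y : Fin (2 * ℓ) → K, φ (SymSq.mul x y) = b x y) :
    LinearMap.ker (et ^ (2 ^ padicValNat 2 ℓ - 1)) ≤ LinearMap.ker φ ∧
      ¬ LinearMap.ker (et ^ (2 ^ padicValNat 2 ℓ)) ≤ LinearMap.ker φ := by
  classical
  set a := padicValNat 2 ℓ with ha
  obtain ⟨q, hq⟩ : ∃ q, ℓ = 2 ^ a * (2 * q + 1) := by
    obtain ⟨r, hr⟩ := (pow_padicValNat_dvd : 2 ^ padicValNat 2 ℓ ∣ ℓ)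
    have hodd : ¬ 2 ∣ r := by
      rintro ⟨u, rfl⟩
      have : 2 ^ (padicValNat 2 ℓ + 1) ∣ ℓ := ⟨u, by rw [pow_succ, mul_assoc]; exact hr⟩
      exact pow_succ_padicValNat_not_dvd (by omega) this
    refine ⟨r / 2, ?_⟩
    rw [show 2 * (r / 2) + 1 = r by omega]
    exact hr
  have hX : ∀ i, i < ℓ → (e ^ i) (v (ℓ - 1)) = v (ℓ - 1 - i) := by
    intro i
    induction i with
    | zero => intro _; simp
    | succ i ih =>
      intro h
      rw [pow_succ', Module.End.mul_apply, ih (by omega), he _ (by omega), if_neg (by omega),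
        if_neg (by omega)]
      congr 1
  have hX0 : (e ^ ℓ) (v (ℓ - 1)) = 0 := by
    obtain ⟨n, rfl⟩ : ∃ n, ℓ = n + 1 := ⟨ℓ - 1, by omega⟩
    rw [pow_succ', Module.End.mul_apply, hX n (by omega), he _ (by omega), if_pos (by omega)]
  have hY : ∀ j, j < ℓ → (e ^ j) (v (2 * ℓ - 1)) =
      v (2 * ℓ - 1 - j) + if k ≤ j ∧ j < 2 * k then v (2 * k - 1 - j) else 0 := by
    intro j
    induction j with
    | zero => intro _; rw [if_neg (by omega)]; simp
    | succ j ih =>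
      intro h
      rw [pow_succ', Module.End.mul_apply, ih (by omega), map_add, he _ (by omega),
        if_neg (by omega)]
      by_cases h1 : j + 1 = k
      · rw [if_pos (by omega), if_neg (by omega), if_pos (by omega), map_zero, add_zero]
        congr 2 <;> omega
      · rw [if_neg (by omega)]
        by_cases h2 : k ≤ j ∧ j < 2 * k
        · rw [if_pos h2, he _ (by omega)]
          by_cases h3 : j + 1 = 2 * k
          · rw [if_pos (by omega), if_neg (by omega)]
            congr 2
          · rw [if_neg (by omega), if_neg (by omega), if_pos (by omega)]
            congr 2
        · rw [if_neg h2, map_zero, if_neg (by omega)]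
          congr 2
  have hY0 : (e ^ ℓ) (v (2 * ℓ - 1)) = 0 := by
    obtain ⟨n, rfl⟩ : ∃ n, ℓ = n + 1 := ⟨ℓ - 1, by omega⟩
    rw [pow_succ', Module.End.mul_apply, hY n (by omega), map_add, he _ (by omega),
      if_pos (by omega), zero_add]
    split_ifs with h
    · rw [he _ (by omega), if_pos (by omega)]
    · rw [map_zero]
  have hxx : ∀ i j, i < ℓ → j < ℓ →
      b ((e ^ i) (v (ℓ - 1))) ((e ^ j) (v (ℓ - 1))) = 0 := by
    intro i j hi hj
    rw [hX i hi, hX j hj, hb _ _ (by omega) (by omega), if_neg (by omega)]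
  have hxy : ∀ i j, i < ℓ → j < ℓ →
      b ((e ^ i) (v (ℓ - 1))) ((e ^ j) (v (2 * ℓ - 1))) = if i + j = ℓ - 1 then 1 else 0 := by
    intro i j hi hj
    rw [hX i hi, hY j hj, map_add, hb _ _ (by omega) (by omega)]
    have : b (v (ℓ - 1 - i)) (if k ≤ j ∧ j < 2 * k then v (2 * k - 1 - j) else 0) = 0 := by
      split_ifs with h
      · rw [hb _ _ (by omega) (by omega), if_neg (by omega)]
      · rw [map_zero]
    rw [this, add_zero]
    congr 1
    apply propext
    omega
  have hyx : ∀ i j, i < ℓ → j < ℓ →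
      b ((e ^ i) (v (2 * ℓ - 1))) ((e ^ j) (v (ℓ - 1))) = if i + j = ℓ - 1 then 1 else 0 := by
    intro i j hi hj
    rw [hX j hj, hY i hi, map_add, LinearMap.add_apply, hb _ _ (by omega) (by omega)]
    have : b (if k ≤ i ∧ i < 2 * k then v (2 * k - 1 - i) else 0) (v (ℓ - 1 - j)) = 0 := by
      split_ifs with h
      · rw [hb _ _ (by omega) (by omega), if_neg (by omega)]
      · rw [map_zero, LinearMap.zero_apply]
    rw [this, add_zero]
    congr 1
    apply propext
    omega
  have hyy : ∀ i j, i < ℓ → j < ℓ →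
      b ((e ^ i) (v (2 * ℓ - 1))) ((e ^ j) (v (2 * ℓ - 1))) =
        if i + j = 2 * k - 1 then 1 else 0 := by
    intro i j hi hj
    rw [hY j hj, hY i hi, map_add b, LinearMap.add_apply, map_add, map_add,
      hb _ _ (by omega) (by omega), if_neg (by omega), zero_add]
    by_cases h1 : k ≤ i ∧ i < 2 * k
    · by_cases h2 : k ≤ j ∧ j < 2 * k
      · rw [if_pos h1, if_pos h2, hb _ _ (by omega) (by omega), hb _ _ (by omega) (by omega),
          hb _ _ (by omega) (by omega), if_neg (by omega), if_neg (by omega), if_neg (by omega),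
          if_neg (by omega)]
        simp
      · rw [if_pos h1, if_neg h2, hb _ _ (by omega) (by omega), map_zero, map_zero, add_zero,
          zero_add]
        congr 1
        apply propext
        omega
    · by_cases h2 : k ≤ j ∧ j < 2 * k
      · rw [if_neg h1, if_pos h2, hb _ _ (by omega) (by omega), map_zero, LinearMap.zero_apply,
          LinearMap.zero_apply, add_zero, add_zero]
        congr 1
        apply propext
        omega
      · rw [if_neg h1, if_neg h2, if_neg (by omega)]
        simp
  let f : Fin ℓ ⊕ Fin ℓ → (Fin (2 * ℓ) → K) :=
    Sum.elim (fun i => (e ^ (i : ℕ)) (v (ℓ - 1))) (fun i => (e ^ (i : ℕ)) (v (2 * ℓ - 1)))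
  have hlow : ∀ n, n < ℓ → v n ∈ Submodule.span K (Set.range f) := by
    intro n hn
    apply Submodule.subset_span
    refine ⟨Sum.inl ⟨ℓ - 1 - n, by omega⟩, ?_⟩
    simp only [f, Sum.elim_inl]
    rw [hX _ (by omega)]
    congr 1
    omega
  have hall : ∀ n, n < 2 * ℓ → v n ∈ Submodule.span K (Set.range f) := by
    intro n hn
    rcases Nat.lt_or_ge n ℓ with h | h
    · exact hlow n h
    · have h1 : (e ^ (2 * ℓ - 1 - n)) (v (2 * ℓ - 1)) ∈ Submodule.span K (Set.range f) :=
        Submodule.subset_span ⟨Sum.inr ⟨2 * ℓ - 1 - n, by omega⟩, rfl⟩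
      rw [hY _ (by omega), show 2 * ℓ - 1 - (2 * ℓ - 1 - n) = n by omega] at h1
      refine (Submodule.add_mem_iff_left _ ?_).1 h1
      split_ifs with h2
      · exact hlow _ (by omega)
      · exact Submodule.zero_mem _
  have hspan : ⊤ ≤ Submodule.span K (Set.range f) := by
    rw [← (Pi.basisFun K (Fin (2 * ℓ))).span_eq, Submodule.span_le]
    rintro _ ⟨i, rfl⟩
    rw [Pi.basisFun_apply, ← hv]
    exact hall _ i.2
  let B := basisOfTopLeSpanOfCardEqFinrank f hspan (by simp; ring)
  have hB : ∀ p, B p = f p := by intro p; simp [B]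
  exact ⟨aux_part1 ℓ k a q hq hk hk0 e et het b φ hφ (v (ℓ - 1)) (v (2 * ℓ - 1)) B
    (fun i => hB _) (fun i => hB _) hX0 hY0 hxx hxy hyx hyy,
    aux_part2 ℓ a q hq e et het b φ hφ (v (ℓ - 1)) (v (2 * ℓ - 1)) hX0 hY0 hxy⟩
end
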